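/- Let N = 2n ≥ 4 be even, write ℝ^N = ℝ^n × ℝ^n, and let α > 0. If (2N+2α−4)/(N−2) < p < (2N+2α)/(N−2), then there exists a positive classical solution u of −Δu + u = |x|^α u^{p−1} in ℝ^N which is a K_+ ground state (a mountain-pass critical point of the energy restricted to K_+). -/

import Mathlib

open MeasureTheory Real Set Filter

noncomputable section

abbrev Euc (N : ℕ) := EuclideanSpace ℝ (Fin N)

variable {N : ℕ}

/-- The Euclidean Laplacian. -/
def lap (u : Euc N → ℝ) (x : Euc N) : ℝ :=
  ∑ i : Fin N,
    iteratedFDeriv ℝ 2 u x ![EuclideanSpace.single i 1, EuclideanSpace.single i 1]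

/-- `s = (x₁² + ⋯ + xₙ²)^{1/2}`. -/
def sVar (n : ℕ) (x : Euc N) : ℝ :=
  Real.sqrt (∑ j : Fin N, if (j : ℕ) < n then x j ^ 2 else 0)

/-- `t = (x_{n+1}² + ⋯ + x_N²)^{1/2}`. -/
def tVar (n : ℕ) (x : Euc N) : ℝ :=
  Real.sqrt (∑ j : Fin N, if n ≤ (j : ℕ) then x j ^ 2 else 0)

/-- Pragmatic membership in `H¹(ℝ^N)` (continuous representative). -/
def MemH1 (u : Euc N → ℝ) : Prop :=
  Continuous u ∧ (∀ x, DifferentiableAt ℝ u x) ∧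
    Integrable (fun x => ‖gradient u x‖ ^ 2) volume ∧
    Integrable (fun x => u x ^ 2) volume

/-- The cone `K₊` on the full space `ℝ^N = ℝ^n × ℝ^n`: nonnegative `G = O(n)×O(n)`
invariant functions in `H¹(ℝ^N)`, even across `θ = π/4` and nondecreasing in `θ` on
`(0, π/4)`. -/
def KplusFull (n : ℕ) : Set (Euc N → ℝ) :=
  { u | MemH1 u ∧ (∀ x, 0 ≤ u x) ∧
      ∃ w : ℝ → ℝ → ℝ,
        (∀ x, u x = w (sVar n x) (tVar n x)) ∧
        (∀ s t, w s t = w t s) ∧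
        (∀ r θ₁ θ₂ : ℝ, 0 < r → 0 < θ₁ → θ₁ ≤ θ₂ → θ₂ < π / 4 →
          w (r * Real.cos θ₁) (r * Real.sin θ₁) ≤ w (r * Real.cos θ₂) (r * Real.sin θ₂)) }

/-- The energy `E(u) = (1/2)∫(|∇u|² + u²) − (1/p)∫ |x|^α |u|^p` on `ℝ^N`. -/
def energy (α p : ℝ) (u : Euc N → ℝ) : ℝ :=
  (1 / 2) * (∫ x, (‖gradient u x‖ ^ 2 + u x ^ 2)) -
    (1 / p) * (∫ x, ‖x‖ ^ α * |u x| ^ p)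

/-- The norm of the space `V = H¹(ℝ^N) ∩ L^p(ℝ^N, |x|^α dx)`. -/
def vnorm (α p : ℝ) (u : Euc N → ℝ) : ℝ :=
  (∫ x, (‖gradient u x‖ ^ 2 + u x ^ 2)) ^ (1 / 2 : ℝ) +
    (∫ x, ‖x‖ ^ α * |u x| ^ p) ^ (1 / p)

/-- The mountain pass level of the energy restricted to `K`. -/
def mountainPassLevel (α p : ℝ) (K : Set (Euc N → ℝ)) : ℝ :=
  sInf { c : ℝ | ∃ γ : ℝ → Euc N → ℝ,
    (∀ t ∈ Icc (0 : ℝ) 1, γ t ∈ K) ∧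
    (∀ t ∈ Icc (0 : ℝ) 1, ∀ ε > (0 : ℝ), ∃ δ > (0 : ℝ), ∀ s ∈ Icc (0 : ℝ) 1,
      |s - t| < δ → vnorm α p (γ s - γ t) < ε) ∧
    γ 0 = 0 ∧ γ 1 ≠ 0 ∧ energy α p (γ 1) ≤ 0 ∧
    c = sSup ((fun t => energy α p (γ t)) '' Icc (0 : ℝ) 1) }

/-- `u` is a `K` ground state of the energy on `ℝ^N`. -/
def IsGroundState (α p : ℝ) (K : Set (Euc N → ℝ)) (u : Euc N → ℝ) : Prop :=
  u ∈ K ∧ 0 < energy α p u ∧ energy α p u = mountainPassLevel α p K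

set_option maxSynthPendingDepth 3

section Proof
variable {n : ℕ} {α p τ Q B : ℝ} {f u : Euc N → ℝ}

def XV (n : ℕ) (x : Euc N) : ℝ := ∑ j : Fin N, if (j : ℕ) < n then x j ^ 2 else -(x j ^ 2)

def KC (n : ℕ) (u : Euc N → ℝ) : Prop :=
  (∀ x, 0 ≤ u x) ∧ ∀ x₁ x₂, ‖x₁‖ = ‖x₂‖ → |XV n x₂| ≤ |XV n x₁| → u x₁ ≤ u x₂

lemma sVar_nonneg (n : ℕ) (x : Euc N) : 0 ≤ sVar n x := Real.sqrt_nonneg _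
lemma tVar_nonneg (n : ℕ) (x : Euc N) : 0 ≤ tVar n x := Real.sqrt_nonneg _

lemma sVar_sq (n : ℕ) (x : Euc N) :
    sVar n x ^ 2 = ∑ j : Fin N, if (j : ℕ) < n then x j ^ 2 else 0 := by
  unfold sVar
  rw [Real.sq_sqrt]
  exact Finset.sum_nonneg fun j _ => by split_ifs <;> positivity

lemma tVar_sq (n : ℕ) (x : Euc N) :
    tVar n x ^ 2 = ∑ j : Fin N, if n ≤ (j : ℕ) then x j ^ 2 else 0 := by
  unfold tVar
  rw [Real.sq_sqrt]
  exact Finset.sum_nonneg fun j _ => by split_ifs <;> positivity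

lemma st_norm (n : ℕ) (x : Euc N) : sVar n x ^ 2 + tVar n x ^ 2 = ‖x‖ ^ 2 := by
  rw [sVar_sq, tVar_sq, EuclideanSpace.norm_sq_eq, ← Finset.sum_add_distrib]
  refine Finset.sum_congr rfl fun j _ => ?_
  by_cases h : (j : ℕ) < n
  · simp [h, not_le.mpr h]
  · simp [h, not_lt.mp h]

lemma st_XV (n : ℕ) (x : Euc N) : sVar n x ^ 2 - tVar n x ^ 2 = XV n x := by
  rw [sVar_sq, tVar_sq, XV, ← Finset.sum_sub_distrib]
  refine Finset.sum_congr rfl fun j _ => ?_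
  by_cases h : (j : ℕ) < n
  · simp [h, not_le.mpr h]
  · simp [h, not_lt.mp h]

def pt (n : ℕ) (s t : ℝ) : Euc N :=
  WithLp.toLp 2 (fun j : Fin N => if (j : ℕ) = 0 then s else if (j : ℕ) = n then t else 0)

lemma sVar_pt (hn : 1 ≤ n) (hN : n < N) (s t : ℝ) :
    sVar n (pt n s t : Euc N) = |s| := by
  unfold sVar pt
  rw [Finset.sum_eq_single (⟨0, by omega⟩ : Fin N)]
  · simp [show 0 < n by omega, Real.sqrt_sq_eq_abs]
  · intro j _ hj
    have hj' : (j : ℕ) ≠ 0 := fun h => hj (Fin.ext h)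
    by_cases h : (j : ℕ) < n
    · have : (j : ℕ) ≠ n := by omega
      simp [hj', this]
    · simp [h]
  · simp

lemma tVar_pt (hn : 1 ≤ n) (hN : n < N) (s t : ℝ) :
    tVar n (pt n s t : Euc N) = |t| := by
  unfold tVar pt
  rw [Finset.sum_eq_single (⟨n, by omega⟩ : Fin N)]
  · simp [show n ≠ 0 by omega, Real.sqrt_sq_eq_abs]
  · intro j _ hj
    have hj' : (j : ℕ) ≠ n := fun h => hj (Fin.ext h)
    by_cases h : n ≤ (j : ℕ)
    · have : (j : ℕ) ≠ 0 := by omega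
      simp [hj', this]
    · simp [h]
  · simp

lemma continuous_XV (n : ℕ) : Continuous (XV n : Euc N → ℝ) := by
  unfold XV
  refine continuous_finsetSum _ fun j _ => ?_
  split_ifs <;> fun_prop

lemma continuous_pt (n : ℕ) {T : Type*} [TopologicalSpace T] {f g : T → ℝ} (hf : Continuous f)
    (hg : Continuous g) : Continuous (fun a => (pt n (f a) (g a) : Euc N)) := by
  unfold pt
  refine (PiLp.continuous_toLp 2 _).comp (continuous_pi fun j => ?_)
  split_ifs <;> fun_prop

lemma norm_pt_sq (hn : 1 ≤ n) (hN : n < N) (s t : ℝ) :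
    ‖(pt n s t : Euc N)‖ ^ 2 = s ^ 2 + t ^ 2 := by
  rw [← st_norm n, sVar_pt hn hN, tVar_pt hn hN, sq_abs, sq_abs]

lemma XV_pt (hn : 1 ≤ n) (hN : n < N) (s t : ℝ) :
    XV n (pt n s t : Euc N) = s ^ 2 - t ^ 2 := by
  rw [← st_XV n, sVar_pt hn hN, tVar_pt hn hN, sq_abs, sq_abs]

lemma KC.eq_of (h : KC n u) {x y : Euc N} (h1 : ‖x‖ = ‖y‖)
    (h2 : |XV n x| = |XV n y|) : u x = u y :=
  le_antisymm (h.2 x y h1 h2.symm.le) (h.2 y x h1.symm h2.le)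

lemma KC.eq_pt (hn : 1 ≤ n) (hN : n < N) (h : KC n u) (x : Euc N) :
    u x = u (pt n (sVar n x) (tVar n x)) := by
  apply h.eq_of
  · rw [← sq_eq_sq₀ (norm_nonneg _) (norm_nonneg _), norm_pt_sq hn hN, st_norm]
  · rw [XV_pt hn hN, st_XV]

lemma mem_Kplus_of_KC (hn : 1 ≤ n) (hN : n < N) (h : KC n u)
    (hu : MemH1 u) : u ∈ (KplusFull n : Set (Euc N → ℝ)) := by
  refine ⟨hu, h.1, fun s t => u (pt n s t), fun x => h.eq_pt hn hN x, fun s t => ?_, ?_⟩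
  · apply h.eq_of
    · rw [← sq_eq_sq₀ (norm_nonneg _) (norm_nonneg _), norm_pt_sq hn hN, norm_pt_sq hn hN, add_comm]
    · rw [XV_pt hn hN, XV_pt hn hN, abs_sub_comm]
  · intro r θ₁ θ₂ hr h1 h12 h2
    have key : ∀ θ : ℝ, XV n (pt n (r * cos θ) (r * sin θ) : Euc N) = r ^ 2 * cos (2 * θ) := by
      intro θ
      rw [XV_pt hn hN, Real.cos_two_mul']; ring
    apply h.2
    · rw [← sq_eq_sq₀ (norm_nonneg _) (norm_nonneg _), norm_pt_sq hn hN, norm_pt_sq hn hN]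
      have a := Real.sin_sq_add_cos_sq θ₁
      have b := Real.sin_sq_add_cos_sq θ₂
      linear_combination r ^ 2 * a - r ^ 2 * b
    · rw [key, key, abs_mul, abs_mul]
      have hc : ∀ θ : ℝ, 0 < θ → θ < π / 4 → 0 ≤ cos (2 * θ) := fun θ h0 h4 =>
        Real.cos_nonneg_of_neg_pi_div_two_le_of_le (by linarith [Real.pi_pos]) (by linarith)
      rw [abs_of_nonneg (hc θ₁ h1 (by linarith)), abs_of_nonneg (hc θ₂ (by linarith) h2)]
      refine mul_le_mul_of_nonneg_left ?_ (abs_nonneg _)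
      exact Real.cos_le_cos_of_nonneg_of_le_pi (by linarith) (by linarith [Real.pi_pos]) (by linarith)

lemma KC_of_mem_Kplus (hn : 1 ≤ n) (hN : n < N)
    (hu : u ∈ (KplusFull n : Set (Euc N → ℝ))) : KC n u := by
  obtain ⟨⟨hc, -⟩, h0, w, hw, hsym, hmono⟩ := hu
  refine ⟨h0, fun x₁ x₂ hx hX => ?_⟩
  rcases eq_or_lt_of_le (norm_nonneg x₁) with h | hr
  · have e1 : x₁ = 0 := norm_eq_zero.mp h.symm
    have e2 : x₂ = 0 := norm_eq_zero.mp (by rw [← hx, ← h])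
    rw [e1, e2]
  set r := ‖x₁‖ with hrdef
  have hval : ∀ x : Euc N, u x = w (max (sVar n x) (tVar n x)) (min (sVar n x) (tVar n x)) := by
    intro x
    rcases le_total (sVar n x) (tVar n x) with h | h
    · rw [max_eq_right h, min_eq_left h, hsym, hw]
    · rw [max_eq_left h, min_eq_right h, hw]
  have hmm : ∀ x : Euc N, ‖x‖ = r → 0 ≤ min (sVar n x) (tVar n x) ∧
      max (sVar n x) (tVar n x) ^ 2 = (r ^ 2 + |XV n x|) / 2 ∧
      min (sVar n x) (tVar n x) ^ 2 = (r ^ 2 - |XV n x|) / 2 := by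
    intro x hxr
    have h1 := st_norm n x
    have h2 := st_XV n x
    have hs := sVar_nonneg n x
    have ht := tVar_nonneg n x
    rw [hxr] at h1
    refine ⟨le_min hs ht, ?_⟩
    rcases le_total (sVar n x) (tVar n x) with h | h
    · rw [max_eq_right h, min_eq_left h, abs_of_nonpos (by rw [← h2]; nlinarith)]
      constructor <;> linarith
    · rw [max_eq_left h, min_eq_right h, abs_of_nonneg (by rw [← h2]; nlinarith)]
      constructor <;> linarith
  set φ : ℝ → ℝ := fun θ => u (pt n (r * cos θ) (r * sin θ)) with hφ
  have hφc : Continuous φ := hc.comp (continuous_pt n (by fun_prop) (by fun_prop))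
  have hφw : ∀ θ ∈ Icc 0 (π / 4), φ θ = w (r * cos θ) (r * sin θ) := by
    intro θ hθ
    have hcos : 0 ≤ cos θ := Real.cos_nonneg_of_neg_pi_div_two_le_of_le
      (by linarith [Real.pi_pos, hθ.1]) (by linarith [Real.pi_pos, hθ.2])
    have hsin : 0 ≤ sin θ := Real.sin_nonneg_of_nonneg_of_le_pi hθ.1 (by linarith [Real.pi_pos, hθ.2])
    simp only [hφ]
    rw [hw, sVar_pt hn hN, tVar_pt hn hN, abs_of_nonneg (by positivity), abs_of_nonneg (by positivity)]
  have hmonoI : MonotoneOn φ (Ioo 0 (π / 4)) := by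
    intro a ha b hb hab
    rw [hφw a ⟨ha.1.le, ha.2.le⟩, hφw b ⟨hb.1.le, hb.2.le⟩]
    exact hmono r a b hr ha.1 hab hb.2
  have hmonoC : MonotoneOn φ (Icc 0 (π / 4)) := by
    intro a ha b hb hab
    have hpi := Real.pi_pos
    have hlim : ∀ c : ℝ, Tendsto (fun ε : ℝ => φ (c + ε * (π / 8 - c))) (nhdsWithin 0 (Ioi 0))
        (nhds (φ c)) := by
      intro c
      have : Continuous fun ε : ℝ => φ (c + ε * (π / 8 - c)) := hφc.comp (by fun_prop)
      have h2 := this.tendsto 0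
      simp only [zero_mul, add_zero] at h2
      exact h2.mono_left nhdsWithin_le_nhds
    refine le_of_tendsto_of_tendsto (hlim a) (hlim b) ?_
    filter_upwards [Ioo_mem_nhdsGT (show (0:ℝ) < 1 by norm_num)] with ε hε
    have hin : ∀ c ∈ Icc 0 (π / 4), c + ε * (π / 8 - c) ∈ Ioo 0 (π / 4) := by
      intro c hc
      constructor
      · nlinarith [mul_nonneg (sub_nonneg.mpr hε.2.le) hc.1, mul_pos hε.1 hpi]
      · nlinarith [mul_nonneg (sub_nonneg.mpr hε.2.le) (sub_nonneg.mpr hc.2), mul_pos hε.1 hpi]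
    refine hmonoI (hin a ha) (hin b hb) ?_
    nlinarith [hε.2]
  have hθ : ∀ x : Euc N, ‖x‖ = r → u x = φ (arcsin (min (sVar n x) (tVar n x) / r)) ∧
      arcsin (min (sVar n x) (tVar n x) / r) ∈ Icc 0 (π / 4) := by
    intro x hxr
    obtain ⟨m0, hM, hm⟩ := hmm x hxr
    set mn := min (sVar n x) (tVar n x)
    set mx := max (sVar n x) (tVar n x)
    have hmx0 : 0 ≤ mx := m0.trans min_le_max
    have hle : mn / r ≤ √2 / 2 := by
      rw [div_le_iff₀ hr]
      refine (sq_le_sq₀ m0 (by positivity)).mp ?_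
      rw [mul_pow, div_pow, Real.sq_sqrt (by norm_num)]
      linarith [abs_nonneg (XV n x)]
    have h4 : arcsin (√2 / 2) = π / 4 := by
      rw [← Real.sin_pi_div_four]
      exact Real.arcsin_sin (by linarith [Real.pi_pos]) (by linarith [Real.pi_pos])
    have hmem : arcsin (mn / r) ∈ Icc 0 (π / 4) :=
      ⟨Real.arcsin_nonneg.mpr (by positivity), h4 ▸ Real.monotone_arcsin hle⟩
    refine ⟨?_, hmem⟩
    rw [hφw _ hmem, hval]
    have hs1 : mn / r ≤ 1 := hle.trans (by nlinarith [Real.sq_sqrt (show (0:ℝ) ≤ 2 by norm_num), Real.sqrt_nonneg 2])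
    have hsin : r * sin (arcsin (mn / r)) = mn := by
      rw [Real.sin_arcsin (by have : 0 ≤ mn / r := by positivity
                              linarith) hs1]; field_simp
    have hcos : r * cos (arcsin (mn / r)) = mx := by
      have h0 : 0 ≤ r * cos (arcsin (mn / r)) := mul_nonneg hr.le (Real.cos_arcsin_nonneg _)
      rw [← sq_eq_sq₀ h0 hmx0]
      have := Real.sin_sq_add_cos_sq (arcsin (mn / r))
      have e : (r * cos (arcsin (mn / r))) ^ 2 = r ^ 2 - (r * sin (arcsin (mn / r))) ^ 2 := by
        linear_combination r ^ 2 * this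
      rw [e, hsin, hM, hm]; ring
    rw [hsin, hcos]
  obtain ⟨e1, m1⟩ := hθ x₁ rfl
  obtain ⟨e2, m2⟩ := hθ x₂ hx.symm
  rw [e1, e2]
  refine hmonoC m1 m2 (Real.monotone_arcsin ?_)
  gcongr ?_ / _
  refine (sq_le_sq₀ (hmm x₁ rfl).1 (hmm x₂ hx.symm).1).mp ?_
  rw [(hmm x₁ rfl).2.2, (hmm x₂ hx.symm).2.2]
  linarith

def gk (τ : ℝ) (y : Euc N) : ℝ := (4 * π * τ) ^ (-(N : ℝ) / 2) * rexp (-‖y‖ ^ 2 / (4 * τ))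

lemma gk_pos (hτ : 0 < τ) (y : Euc N) : 0 < gk τ y := by
  unfold gk; positivity

lemma gk_nonneg (hτ : 0 < τ) (y : Euc N) : 0 ≤ gk τ y := (gk_pos hτ y).le

lemma gk_continuous (τ : ℝ) : Continuous (gk τ : Euc N → ℝ) := by
  unfold gk; fun_prop

lemma gk_neg (τ : ℝ) (y : Euc N) : gk τ (-y) = gk τ y := by simp [gk]

lemma gk_integral (hτ : 0 < τ) : ∫ y : Euc N, gk τ y = 1 := by
  unfold gk
  rw [integral_const_mul]
  have h := GaussianFourier.integral_rexp_neg_mul_sq_norm (V := Euc N) (b := 1 / (4 * τ)) (by positivity)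
  have e : (fun y : Euc N => rexp (-‖y‖ ^ 2 / (4 * τ))) = fun y => rexp (-(1 / (4 * τ)) * ‖y‖ ^ 2) := by
    ext y; congr 1; ring
  rw [e, h]
  have : π / (1 / (4 * τ)) = 4 * π * τ := by field_simp
  rw [this, finrank_euclideanSpace, Fintype.card_fin, ← Real.rpow_add (by positivity)]
  norm_num [neg_div]

lemma gk_integrable (hτ : 0 < τ) : Integrable (gk τ : Euc N → ℝ) := by
  by_contra h
  have := gk_integral (N := N) hτ
  rw [integral_undef h] at this
  norm_num at this

lemma gk_integral_sub (hτ : 0 < τ) (x : Euc N) : ∫ y : Euc N, gk τ (x - y) = 1 := by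
  rw [integral_sub_left_eq_self (fun y => gk τ y) volume x, gk_integral hτ]

lemma gk_integrable_sub (hτ : 0 < τ) (x : Euc N) : Integrable (fun y : Euc N => gk τ (x - y)) :=
  (gk_integrable hτ).comp_sub_left x

lemma gk_le {σ σ' : ℝ} (h0 : 0 < σ) (h : σ ≤ σ') (y : Euc N) :
    gk σ y ≤ (σ' / σ) ^ ((N : ℝ) / 2) * gk σ' y := by
  have h0' : 0 < σ' := h0.trans_le h
  unfold gk
  have e : (4 * π * σ) ^ (-(N : ℝ) / 2) = (σ' / σ) ^ ((N : ℝ) / 2) * (4 * π * σ') ^ (-(N : ℝ) / 2) := by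
    rw [neg_div, Real.rpow_neg (by positivity), Real.rpow_neg (by positivity), ← Real.inv_rpow (by positivity),
      ← Real.inv_rpow (by positivity), ← Real.mul_rpow (by positivity) (by positivity)]
    congr 1; field_simp
  rw [e, mul_assoc]
  refine mul_le_mul_of_nonneg_left (mul_le_mul_of_nonneg_left ?_ (by positivity)) (by positivity)
  rw [Real.exp_le_exp, neg_div, neg_div, neg_le_neg_iff]
  gcongr

lemma pow_exp_bound (a : ℝ) (ha : 0 ≤ a) : ∃ C : ℝ, 0 < C ∧ ∀ s : ℝ, 0 ≤ s →
    s ^ a ≤ C * rexp (s ^ 2 / 8) := by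
  obtain ⟨k, hk⟩ := exists_nat_ge a
  refine ⟨1 + 8 ^ k * k.factorial, by positivity, fun s hs => ?_⟩
  have h1 : s ^ a ≤ 1 + s ^ (2 * k) := by
    rcases le_total s 1 with h | h
    · have := Real.rpow_le_one hs h ha
      have : 0 ≤ s ^ (2 * k) := by positivity
      linarith
    · have : s ^ a ≤ s ^ ((2 * k : ℕ) : ℝ) := Real.rpow_le_rpow_of_exponent_le h
        (by push_cast; linarith)
      rw [Real.rpow_natCast] at this
      linarith
  have h2 : s ^ (2 * k) ≤ 8 ^ k * k.factorial * rexp (s ^ 2 / 8) := by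
    have := Real.pow_div_factorial_le_exp (s ^ 2 / 8) (by positivity) k
    rw [div_pow, ← pow_mul, div_div, div_le_iff₀ (by positivity)] at this
    linarith
  have h3 : 1 ≤ rexp (s ^ 2 / 8) := Real.one_le_exp (by positivity)
  nlinarith

lemma gk_moment (a : ℝ) (ha : 0 ≤ a) : ∃ C : ℝ, 0 < C ∧ ∀ τ : ℝ, 0 < τ → ∀ y : Euc N,
    ‖y‖ ^ a * gk τ y ≤ C * τ ^ (a / 2) * gk (2 * τ) y := by
  obtain ⟨C, hC, h⟩ := pow_exp_bound a ha
  refine ⟨C * 2 ^ ((N : ℝ) / 2), by positivity, fun τ hτ y => ?_⟩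
  have h1 := h (‖y‖ / τ ^ (1 / 2 : ℝ)) (by positivity)
  have e1 : (‖y‖ / τ ^ (1 / 2 : ℝ)) ^ 2 = ‖y‖ ^ 2 / τ := by
    rw [div_pow, ← Real.sqrt_eq_rpow, Real.sq_sqrt hτ.le]
  rw [e1, Real.div_rpow (by positivity) (by positivity), ← Real.rpow_mul hτ.le, div_le_iff₀ (by positivity)] at h1
  have e2 : (1 / 2 * a : ℝ) = a / 2 := by ring
  rw [e2] at h1
  unfold gk
  have e : (4 * π * τ) ^ (-(N : ℝ) / 2) = 2 ^ ((N : ℝ) / 2) * (4 * π * (2 * τ)) ^ (-(N : ℝ) / 2) := by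
    rw [neg_div, Real.rpow_neg (by positivity), Real.rpow_neg (by positivity), ← Real.inv_rpow (by positivity),
      ← Real.inv_rpow (by positivity), ← Real.mul_rpow (by positivity) (by positivity)]
    congr 1; field_simp
  have e3 : rexp (-‖y‖ ^ 2 / (4 * τ)) * rexp (‖y‖ ^ 2 / τ / 8) = rexp (-‖y‖ ^ 2 / (4 * (2 * τ))) := by
    rw [← Real.exp_add]; congr 1; field_simp; ring
  rw [e, ← e3]
  calc ‖y‖ ^ a * (2 ^ ((N : ℝ) / 2) * (4 * π * (2 * τ)) ^ (-(N : ℝ) / 2) * rexp (-‖y‖ ^ 2 / (4 * τ)))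
      ≤ (C * rexp (‖y‖ ^ 2 / τ / 8) * τ ^ (a / 2)) * (2 ^ ((N : ℝ) / 2) * (4 * π * (2 * τ)) ^ (-(N : ℝ) / 2) * rexp (-‖y‖ ^ 2 / (4 * τ))) := by
        gcongr
    _ = _ := by ring

def innL : Euc N →L[ℝ] Euc N →L[ℝ] ℝ := innerSL ℝ

lemma innL_apply (v w : Euc N) : innL v w = inner ℝ v w := rfl

def gk1 (τ : ℝ) (y : Euc N) : Euc N →L[ℝ] ℝ := (-(1 / (2 * τ)) * gk τ y) • innL y

def gk2 (τ : ℝ) (y : Euc N) : Euc N →L[ℝ] Euc N →L[ℝ] ℝ :=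
  (-(1 / (2 * τ)) * gk τ y) • innL + ((-(1 / (2 * τ))) • gk1 τ y).smulRight (innL y)

lemma gk_hasFDerivAt (hτ : 0 < τ) (y : Euc N) : HasFDerivAt (gk τ) (gk1 τ y) y := by
  have h1 : HasFDerivAt (fun y : Euc N => ‖y‖ ^ 2) (2 • innerSL ℝ y) y := (hasStrictFDerivAt_norm_sq y).hasFDerivAt
  have h2 := (((h1.neg).mul_const (1 / (4 * τ))).exp).const_mul ((4 * π * τ) ^ (-(N : ℝ) / 2))
  have e : (gk τ : Euc N → ℝ) = fun y => (4 * π * τ) ^ (-(N : ℝ) / 2) * rexp (-‖y‖ ^ 2 * (1 / (4 * τ))) := by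
    ext y; unfold gk; congr 2; ring
  rw [e]
  refine h2.congr_fderiv ?_
  ext v
  simp [gk1, gk, innL_apply, div_eq_mul_inv]
  field_simp
  ring

lemma gk1_hasFDerivAt (hτ : 0 < τ) (y : Euc N) : HasFDerivAt (gk1 τ) (gk2 τ y) y := by
  have h := ((gk_hasFDerivAt hτ y).const_mul (-(1 / (2 * τ)))).smul ((innL (N := N)).hasFDerivAt (x := y))
  exact h

lemma gk1_continuous (τ : ℝ) : Continuous (gk1 τ : Euc N → _) := by
  unfold gk1
  exact (continuous_const.mul (gk_continuous τ)).smul (innL (N := N)).continuous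

lemma gk2_apply (τ : ℝ) (y v w : Euc N) : gk2 τ y v w =
    -(1 / (2 * τ)) * gk τ y * inner ℝ v w + (1 / (2 * τ)) ^ 2 * gk τ y * inner ℝ y v * inner ℝ y w := by
  simp only [gk2, gk1, innL_apply, add_apply, smul_apply, ContinuousLinearMap.smulRight_apply, smul_eq_mul]
  ring

set_option synthInstance.maxHeartbeats 400000 in
lemma gk2_continuous (τ : ℝ) : Continuous (gk2 τ : Euc N → _) := by
  unfold gk2
  have h0 : Continuous fun y : Euc N => (-(1 / (2 * τ)) * gk τ y) • (innL : Euc N →L[ℝ] Euc N →L[ℝ] ℝ) :=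
    (continuous_const.mul (gk_continuous τ)).smul continuous_const
  have h1 : Continuous fun y : Euc N => (-(1 / (2 * τ))) • gk1 τ y := (gk1_continuous τ).const_smul (-(1 / (2 * τ)))
  have h2 : Continuous fun y : Euc N => ContinuousLinearMap.smulRightL ℝ (Euc N) (Euc N →L[ℝ] ℝ) ((-(1 / (2 * τ))) • gk1 τ y) (innL y) :=
    ((ContinuousLinearMap.smulRightL ℝ (Euc N) (Euc N →L[ℝ] ℝ)).continuous.comp h1).clm_apply (innL (N := N)).continuous
  exact h0.add h2

lemma gk1_norm (hτ : 0 < τ) (y : Euc N) : ‖gk1 τ y‖ = 1 / (2 * τ) * (‖y‖ * gk τ y) := by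
  unfold gk1
  have hi : ‖innL y‖ = ‖y‖ := innerSL_apply_norm ℝ y
  rw [norm_smul, hi, norm_mul, norm_neg, Real.norm_of_nonneg (by positivity),
    Real.norm_of_nonneg (gk_nonneg hτ y)]
  ring

lemma gk2_norm (hτ : 0 < τ) (y : Euc N) :
    ‖gk2 τ y‖ ≤ 1 / (2 * τ) * gk τ y + (1 / (2 * τ)) ^ 2 * (‖y‖ ^ 2 * gk τ y) := by
  have hg := gk_nonneg hτ y
  refine ContinuousLinearMap.opNorm_le_bound₂ _ (by positivity) fun v w => ?_
  rw [gk2_apply]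
  have h1 := abs_real_inner_le_norm v w
  have h2 := abs_real_inner_le_norm y v
  have h3 := abs_real_inner_le_norm y w
  rw [Real.norm_eq_abs]
  refine (abs_add_le _ _).trans ?_
  rw [abs_mul, abs_mul, abs_mul, abs_mul, abs_mul, abs_neg, abs_of_nonneg hg, abs_of_nonneg (show 0 ≤ 1 / (2 * τ) by positivity),
    abs_of_nonneg (show 0 ≤ (1 / (2 * τ)) ^ 2 by positivity)]
  calc _ ≤ 1 / (2 * τ) * gk τ y * (‖v‖ * ‖w‖) + (1 / (2 * τ)) ^ 2 * gk τ y * (‖y‖ * ‖v‖) * (‖y‖ * ‖w‖) := by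
        gcongr
    _ = _ := by ring

lemma gk1_bound : ∃ C : ℝ, 0 < C ∧ ∀ τ : ℝ, 0 < τ → ∀ y : Euc N,
    ‖gk1 τ y‖ ≤ C * τ ^ (-(1 / 2) : ℝ) * gk (2 * τ) y := by
  obtain ⟨C, hC, h⟩ := gk_moment (N := N) 1 zero_le_one
  refine ⟨C, hC, fun τ hτ y => ?_⟩
  rw [gk1_norm hτ]
  have := h τ hτ y
  rw [Real.rpow_one] at this
  have e : τ ^ (-(1 / 2) : ℝ) = τ⁻¹ * τ ^ (1 / 2 : ℝ) := by
    rw [← Real.rpow_neg_one, ← Real.rpow_add hτ]; norm_num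
  rw [e]
  have hg := gk_nonneg (show 0 < 2 * τ by positivity) y
  calc _ ≤ 1 / (2 * τ) * (C * τ ^ (1 / 2 : ℝ) * gk (2 * τ) y) := by gcongr
    _ = (1 / 2) * (C * (τ⁻¹ * τ ^ (1 / 2 : ℝ)) * gk (2 * τ) y) := by field_simp
    _ ≤ 1 * (C * (τ⁻¹ * τ ^ (1 / 2 : ℝ)) * gk (2 * τ) y) := by gcongr; norm_num
    _ = _ := one_mul _

lemma gk2_bound (γ : ℝ) (hγ : 0 ≤ γ) : ∃ C : ℝ, 0 < C ∧ ∀ τ : ℝ, 0 < τ → ∀ y : Euc N,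
    ‖y‖ ^ γ * ‖gk2 τ y‖ ≤ C * τ ^ (-1 + γ / 2) * gk (2 * τ) y := by
  obtain ⟨C, hC, h⟩ := gk_moment (N := N) γ hγ
  obtain ⟨C', hC', h'⟩ := gk_moment (N := N) (γ + 2) (by positivity)
  refine ⟨C + C', by positivity, fun τ hτ y => ?_⟩
  have a1 := h τ hτ y
  have a2 := h' τ hτ y
  have hg := gk_nonneg (show 0 < 2 * τ by positivity) y
  have hg' := gk_nonneg hτ y
  have e0 : ‖y‖ ^ (γ + 2) = ‖y‖ ^ γ * ‖y‖ ^ 2 := by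
    rw [Real.rpow_add_of_nonneg (norm_nonneg _) hγ (by norm_num)]; norm_num
  have e1 : τ ^ (-1 + γ / 2) = τ⁻¹ * τ ^ (γ / 2) := by
    rw [Real.rpow_add hτ, Real.rpow_neg_one]
  have e2 : τ ^ ((γ + 2) / 2) = τ * τ ^ (γ / 2) := by
    rw [add_div, add_comm, Real.rpow_add hτ]; norm_num
  rw [e0, e2] at a2
  rw [e1]
  calc _ ≤ ‖y‖ ^ γ * (1 / (2 * τ) * gk τ y + (1 / (2 * τ)) ^ 2 * (‖y‖ ^ 2 * gk τ y)) := by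
        gcongr; exact gk2_norm hτ y
    _ = 1 / (2 * τ) * (‖y‖ ^ γ * gk τ y) + (1 / (2 * τ)) ^ 2 * (‖y‖ ^ γ * ‖y‖ ^ 2 * gk τ y) := by ring
    _ ≤ 1 / (2 * τ) * (C * τ ^ (γ / 2) * gk (2 * τ) y) + (1 / (2 * τ)) ^ 2 * (C' * (τ * τ ^ (γ / 2)) * gk (2 * τ) y) := by
        gcongr
    _ = (1 / 2 * C + 1 / 4 * C') * (τ⁻¹ * τ ^ (γ / 2) * gk (2 * τ) y) := by field_simp; ring
    _ ≤ (C + C') * (τ⁻¹ * τ ^ (γ / 2) * gk (2 * τ) y) := by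
        refine mul_le_mul_of_nonneg_right (by linarith) (by positivity)
    _ = _ := by ring

lemma gk_hasDerivAt_time (hτ : 0 < τ) (y : Euc N) :
    HasDerivAt (fun τ => gk τ y) (∑ i : Fin N, gk2 τ y (EuclideanSpace.single i 1) (EuclideanSpace.single i 1)) τ := by
  have h1 : HasDerivAt (fun τ : ℝ => 4 * π * τ) (4 * π) τ := by
    simpa using (hasDerivAt_id τ).const_mul (4 * π)
  have h2 := h1.rpow_const (p := -(N : ℝ) / 2) (Or.inl (by positivity))
  have h3 : HasDerivAt (fun τ : ℝ => -‖y‖ ^ 2 / (4 * τ)) (‖y‖ ^ 2 / (4 * τ ^ 2)) τ := by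
    have := ((hasDerivAt_id τ).const_mul 4).inv (by simpa using hτ.ne') |>.const_mul (-‖y‖ ^ 2)
    refine (this.congr_deriv ?_).congr_of_eventuallyEq ?_
    · simp; field_simp
    · filter_upwards with t; simp [div_eq_mul_inv]
  have h4 := h2.mul h3.exp
  refine h4.congr_deriv ?_
  simp only [gk2_apply]
  rw [Finset.sum_add_distrib]
  have e1 : ∀ i : Fin N, inner ℝ (EuclideanSpace.single i (1:ℝ)) (EuclideanSpace.single i (1:ℝ)) = (1 : ℝ) := by
    intro i; simp
  have e2 : ∀ i : Fin N, inner ℝ y (EuclideanSpace.single i (1:ℝ)) = y i := by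
    intro i; simp [EuclideanSpace.inner_single_right]
  simp only [e1, e2]
  have e3 : ∑ i : Fin N, (1 / (2 * τ)) ^ 2 * gk τ y * y i * y i = (1 / (2 * τ)) ^ 2 * gk τ y * ‖y‖ ^ 2 := by
    rw [EuclideanSpace.norm_sq_eq, Finset.mul_sum]
    refine Finset.sum_congr rfl fun i _ => ?_
    rw [Real.norm_eq_abs, sq_abs]; ring
  rw [e3]
  simp only [Finset.sum_const, Finset.card_univ, Fintype.card_fin, nsmul_eq_mul, gk]
  rw [Real.rpow_sub_one (by positivity)]
  field_simp
  ring

def GInt (f : Euc N → ℝ) : Prop :=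
  AEStronglyMeasurable f volume ∧ ∀ σ : ℝ, 0 < σ → ∀ x, Integrable (fun y => f y * gk σ (x - y))

lemma GInt.of_bdd (hf : AEStronglyMeasurable f volume) (hB : ∀ x, |f x| ≤ B) : GInt f :=
  ⟨hf, fun _ hσ x => (gk_integrable_sub hσ x).bdd_mul hf (.of_forall hB)⟩

lemma gk_le_const (hτ : 0 < τ) (y : Euc N) : gk τ y ≤ τ ^ (-(N : ℝ) / 2) := by
  unfold gk
  have h1 : rexp (-‖y‖ ^ 2 / (4 * τ)) ≤ 1 := by
    rw [Real.exp_le_one_iff, neg_div]; have : 0 ≤ ‖y‖ ^ 2 / (4 * τ) := by positivity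
    linarith
  have h2 : (4 * π * τ) ^ (-(N : ℝ) / 2) ≤ τ ^ (-(N : ℝ) / 2) := by
    apply Real.rpow_le_rpow_of_nonpos hτ
    · nlinarith [Real.pi_gt_three]
    · have : (0 : ℝ) ≤ N := by positivity
      linarith
  calc _ ≤ τ ^ (-(N : ℝ) / 2) * 1 := by gcongr
    _ = _ := mul_one _

lemma GInt.of_sq (hf : AEStronglyMeasurable f volume) (h2 : Integrable (fun x => f x ^ 2)) : GInt f := by
  refine ⟨hf, fun σ hσ x => ?_⟩
  have hm : AEStronglyMeasurable (fun y : Euc N => gk σ (x - y)) volume :=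
    ((gk_continuous σ).comp (by fun_prop)).aestronglyMeasurable
  have h3 : Integrable (fun y => f y ^ 2 * gk σ (x - y)) := by
    refine h2.mul_bdd (c := σ ^ (-(N : ℝ) / 2)) hm (.of_forall fun y => ?_)
    rw [Real.norm_of_nonneg (gk_nonneg hσ _)]; exact gk_le_const hσ _
  refine ((gk_integrable_sub hσ x).add h3).mono' (hf.mul hm) (.of_forall fun y => ?_)
  have := gk_nonneg hσ (x - y)
  rw [norm_mul, Real.norm_of_nonneg this, Real.norm_eq_abs]
  simp only [Pi.add_apply]
  have h4 : |f y| ≤ 1 + f y ^ 2 := by nlinarith [sq_abs (f y), sq_nonneg (|f y| - 1), abs_nonneg (f y)]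
  nlinarith

lemma GInt.abs (hf : GInt f) : GInt (fun x => |f x|) :=
  ⟨hf.1.norm, fun σ hσ x => by
    refine ((hf.2 σ hσ x).norm).congr (.of_forall fun y => ?_)
    simp only [norm_mul, Real.norm_of_nonneg (gk_nonneg hσ _), Real.norm_eq_abs]⟩

lemma gk_shift {σ : ℝ} (hσ : 0 < σ) {x x' : Euc N} (h : ‖x' - x‖ ≤ 1) (y : Euc N) :
    gk σ (x' - y) ≤ 2 ^ ((N : ℝ) / 2) * rexp (1 / (4 * σ)) * gk (2 * σ) (x - y) := by
  unfold gk
  have e : (4 * π * σ) ^ (-(N : ℝ) / 2) = 2 ^ ((N : ℝ) / 2) * (4 * π * (2 * σ)) ^ (-(N : ℝ) / 2) := by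
    rw [neg_div, Real.rpow_neg (by positivity), Real.rpow_neg (by positivity), ← Real.inv_rpow (by positivity),
      ← Real.inv_rpow (by positivity), ← Real.mul_rpow (by positivity) (by positivity)]
    congr 1; field_simp
  have h1 : ‖x - y‖ ≤ ‖x' - y‖ + 1 := by
    have : x - y = (x' - y) - (x' - x) := by abel
    rw [this]; exact (norm_sub_le _ _).trans (by linarith)
  have h2 : ‖x - y‖ ^ 2 ≤ 2 * ‖x' - y‖ ^ 2 + 2 := by
    nlinarith [norm_nonneg (x - y), norm_nonneg (x' - y), sq_nonneg (‖x' - y‖ - 1)]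
  have h3 : rexp (-‖x' - y‖ ^ 2 / (4 * σ)) ≤ rexp (1 / (4 * σ)) * rexp (-‖x - y‖ ^ 2 / (4 * (2 * σ))) := by
    rw [← Real.exp_add, Real.exp_le_exp]
    have : 1 / (4 * σ) + -‖x - y‖ ^ 2 / (4 * (2 * σ)) = (1 - ‖x - y‖ ^ 2 / 2) / (4 * σ) := by field_simp; ring
    rw [this]
    gcongr; linarith
  rw [e]
  calc _ ≤ 2 ^ ((N : ℝ) / 2) * (4 * π * (2 * σ)) ^ (-(N : ℝ) / 2) * (rexp (1 / (4 * σ)) * rexp (-‖x - y‖ ^ 2 / (4 * (2 * σ)))) := by gcongr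
    _ = _ := by ring

section conv
variable {F : Type*} [NormedAddCommGroup F] [NormedSpace ℝ F]

lemma conv_integrable {k : Euc N → F} (hk : Continuous k) {A σ : ℝ} (hσ : 0 < σ)
    (hb : ∀ y, ‖k y‖ ≤ A * gk σ y) (hf : GInt f) (x : Euc N) :
    Integrable (fun y => f y • k (x - y)) := by
  refine ((hf.2 σ hσ x).norm.const_mul A).mono' (hf.1.smul (hk.comp (by fun_prop)).aestronglyMeasurable) (.of_forall fun y => ?_)
  rw [norm_smul, norm_mul, Real.norm_of_nonneg (gk_nonneg hσ (x - y))]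
  nlinarith [hb (x - y), norm_nonneg (f y)]

lemma conv_bound {k : Euc N → F} {A σ : ℝ} (hσ : 0 < σ)
    (hb : ∀ y, ‖k y‖ ≤ A * gk σ y) (hf : GInt f) (x : Euc N) :
    ‖∫ y, f y • k (x - y)‖ ≤ A * ∫ y, |f y| * gk σ (x - y) := by
  rw [← integral_const_mul]
  refine norm_integral_le_of_norm_le ((hf.abs.2 σ hσ x).const_mul A) (.of_forall fun y => ?_)
  rw [norm_smul, Real.norm_eq_abs]
  nlinarith [hb (x - y), abs_nonneg (f y)]

lemma conv_continuous {k : Euc N → F} (hk : Continuous k) {A σ : ℝ} (hσ : 0 < σ)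
    (hb : ∀ y, ‖k y‖ ≤ A * gk σ y) (hf : GInt f) :
    Continuous (fun x => ∫ y, f y • k (x - y)) := by
  have hA : 0 ≤ A := by
    have := (norm_nonneg _).trans (hb 0)
    exact nonneg_of_mul_nonneg_left this (gk_pos hσ 0)
  rw [continuous_iff_continuousAt]
  intro x
  refine continuousAt_of_dominated (bound := fun y => A * (2 ^ ((N : ℝ) / 2) * rexp (1 / (4 * σ))) * (|f y| * gk (2 * σ) (x - y)))
    ?_ ?_ ((hf.abs.2 _ (by positivity) x).const_mul _) ?_
  · exact .of_forall fun x' => (conv_integrable hk hσ hb hf x').1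
  · filter_upwards [Metric.closedBall_mem_nhds x one_pos] with x' hx'
    refine .of_forall fun y => ?_
    rw [norm_smul, Real.norm_eq_abs]
    have h1 := gk_shift hσ (by simpa [dist_eq_norm] using hx') y
    calc |f y| * ‖k (x' - y)‖ ≤ |f y| * (A * (2 ^ ((N : ℝ) / 2) * rexp (1 / (4 * σ)) * gk (2 * σ) (x - y))) := by
          gcongr; exact (hb _).trans (by gcongr)
      _ = _ := by ring
  · exact .of_forall fun y => (continuous_const.smul (hk.comp (by fun_prop))).continuousAt

lemma conv_hasFDerivAt [CompleteSpace F] {k : Euc N → F} {k' : Euc N → Euc N →L[ℝ] F}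
    (hk : ∀ y, HasFDerivAt k (k' y) y) (hk' : Continuous k') {A σ : ℝ} (hσ : 0 < σ)
    (hb : ∀ y, ‖k y‖ ≤ A * gk σ y) (hb' : ∀ y, ‖k' y‖ ≤ A * gk σ y)
    (hf : GInt f) (x : Euc N) :
    HasFDerivAt (fun x => ∫ y, f y • k (x - y)) (∫ y, f y • k' (x - y)) x := by
  have hA : 0 ≤ A := by
    have := (norm_nonneg _).trans (hb 0)
    exact nonneg_of_mul_nonneg_left this (gk_pos hσ 0)
  have hkc : Continuous k := continuous_iff_continuousAt.2 fun y => (hk y).continuousAt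
  refine hasFDerivAt_integral_of_dominated_of_fderiv_le (F' := fun x y => f y • k' (x - y))
    (bound := fun y => A * (2 ^ ((N : ℝ) / 2) * rexp (1 / (4 * σ))) * (|f y| * gk (2 * σ) (x - y)))
    (Metric.closedBall_mem_nhds x one_pos) (.of_forall fun x' => (conv_integrable hkc hσ hb hf x').1)
    (conv_integrable hkc hσ hb hf x) (conv_integrable hk' hσ hb' hf x).1 ?_
    ((hf.abs.2 _ (by positivity) x).const_mul _) ?_
  · refine .of_forall fun y x' hx' => ?_
    rw [norm_smul, Real.norm_eq_abs]
    have h1 := gk_shift hσ (by simpa [dist_eq_norm] using hx') y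
    calc |f y| * ‖k' (x' - y)‖ ≤ |f y| * (A * (2 ^ ((N : ℝ) / 2) * rexp (1 / (4 * σ)) * gk (2 * σ) (x - y))) := by
          gcongr; exact (hb' _).trans (by gcongr)
      _ = _ := by ring
  · refine .of_forall fun y x' _ => ?_
    exact ((hk (x' - y)).comp x' ((hasFDerivAt_id x').sub_const y)).const_smul (f y)
end conv

def PP (τ : ℝ) (f : Euc N → ℝ) (x : Euc N) : ℝ := ∫ y, f y * gk τ (x - y)
def PP1 (τ : ℝ) (f : Euc N → ℝ) (x : Euc N) : Euc N →L[ℝ] ℝ := ∫ y, f y • gk1 τ (x - y)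
def PP2 (τ : ℝ) (f : Euc N → ℝ) (x : Euc N) : Euc N →L[ℝ] Euc N →L[ℝ] ℝ := ∫ y, f y • gk2 τ (x - y)

lemma gk_le_two (hτ : 0 < τ) (y : Euc N) : gk τ y ≤ 2 ^ ((N : ℝ) / 2) * gk (2 * τ) y := by
  have := gk_le hτ (show τ ≤ 2 * τ by linarith) y
  rwa [mul_div_assoc, div_self hτ.ne', mul_one] at this

lemma gk_all_bound (hτ : 0 < τ) : ∃ A : ℝ, (∀ y : Euc N, ‖gk τ y‖ ≤ A * gk (2 * τ) y) ∧
    (∀ y : Euc N, ‖gk1 τ y‖ ≤ A * gk (2 * τ) y) ∧ (∀ y : Euc N, ‖gk2 τ y‖ ≤ A * gk (2 * τ) y) := by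
  obtain ⟨C1, _, h1⟩ := gk1_bound (N := N)
  obtain ⟨C2, _, h2⟩ := gk2_bound (N := N) 0 le_rfl
  refine ⟨2 ^ ((N : ℝ) / 2) + C1 * τ ^ (-(1 / 2) : ℝ) + C2 * τ ^ (-1 + 0 / 2 : ℝ), fun y => ?_, fun y => ?_, fun y => ?_⟩
  all_goals have hg := gk_nonneg (show 0 < 2 * τ by positivity) y
  · rw [Real.norm_of_nonneg (gk_nonneg hτ y)]
    refine (gk_le_two hτ y).trans (mul_le_mul_of_nonneg_right ?_ hg)
    have : 0 ≤ C1 * τ ^ (-(1 / 2) : ℝ) + C2 * τ ^ (-1 + 0 / 2 : ℝ) := by positivity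
    linarith
  · refine (h1 τ hτ y).trans (mul_le_mul_of_nonneg_right ?_ hg)
    have : 0 ≤ (2 : ℝ) ^ ((N : ℝ) / 2) + C2 * τ ^ (-1 + 0 / 2 : ℝ) := by positivity
    linarith
  · have := h2 τ hτ y
    rw [Real.rpow_zero, one_mul] at this
    refine this.trans (mul_le_mul_of_nonneg_right ?_ hg)
    have : 0 ≤ (2 : ℝ) ^ ((N : ℝ) / 2) + C1 * τ ^ (-(1 / 2) : ℝ) := by positivity
    linarith

lemma PP_hasFDerivAt (hτ : 0 < τ) (hf : GInt f) (x : Euc N) :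
    HasFDerivAt (PP τ f) (PP1 τ f x) x := by
  obtain ⟨A, h0, h1, _⟩ := gk_all_bound (N := N) hτ
  exact conv_hasFDerivAt (gk_hasFDerivAt hτ) (gk1_continuous τ) (by positivity) h0 h1 hf x

lemma PP1_hasFDerivAt (hτ : 0 < τ) (hf : GInt f) (x : Euc N) :
    HasFDerivAt (PP1 τ f) (PP2 τ f x) x := by
  obtain ⟨A, _, h1, h2⟩ := gk_all_bound (N := N) hτ
  exact conv_hasFDerivAt (gk1_hasFDerivAt hτ) (gk2_continuous τ) (by positivity) h1 h2 hf x

lemma PP_continuous (hτ : 0 < τ) (hf : GInt f) : Continuous (PP τ f) :=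
  continuous_iff_continuousAt.2 fun x => (PP_hasFDerivAt hτ hf x).continuousAt

lemma PP1_continuous (hτ : 0 < τ) (hf : GInt f) : Continuous (PP1 τ f) :=
  continuous_iff_continuousAt.2 fun x => (PP1_hasFDerivAt hτ hf x).continuousAt

lemma PP2_continuous (hτ : 0 < τ) (hf : GInt f) : Continuous (PP2 τ f) := by
  obtain ⟨A, _, _, h2⟩ := gk_all_bound (N := N) hτ
  exact conv_continuous (gk2_continuous τ) (by positivity) h2 hf

lemma PP1_bound : ∃ C : ℝ, 0 < C ∧ ∀ τ : ℝ, 0 < τ → ∀ f : Euc N → ℝ, GInt f → ∀ x,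
    ‖PP1 τ f x‖ ≤ C * τ ^ (-(1 / 2) : ℝ) * PP (2 * τ) (fun y => |f y|) x := by
  obtain ⟨C, hC, h⟩ := gk1_bound (N := N)
  exact ⟨C, hC, fun τ hτ f hf x => conv_bound (by positivity) (h τ hτ) hf x⟩

lemma PP2_bound : ∃ C : ℝ, 0 < C ∧ ∀ τ : ℝ, 0 < τ → ∀ f : Euc N → ℝ, GInt f → ∀ x,
    ‖PP2 τ f x‖ ≤ C * τ ^ (-1 : ℝ) * PP (2 * τ) (fun y => |f y|) x := by
  obtain ⟨C, hC, h⟩ := gk2_bound (N := N) 0 le_rfl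
  refine ⟨C, hC, fun τ hτ f hf x => conv_bound (by positivity) (fun y => ?_) hf x⟩
  simpa using h τ hτ y

lemma PP_mono (hτ : 0 < τ) {f g : Euc N → ℝ} (hf : GInt f) (hg : GInt g) (h : ∀ x, f x ≤ g x) (x : Euc N) :
    PP τ f x ≤ PP τ g x :=
  integral_mono (hf.2 τ hτ x) (hg.2 τ hτ x) fun y => mul_le_mul_of_nonneg_right (h y) (gk_nonneg hτ _)

lemma PP_nonneg (hτ : 0 < τ) (h : ∀ x, 0 ≤ f x) (x : Euc N) :
    0 ≤ PP τ f x := integral_nonneg fun y => mul_nonneg (h y) (gk_nonneg hτ _)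

lemma PP_const (hτ : 0 < τ) (c : ℝ) (x : Euc N) : PP τ (fun _ => c) x = c := by
  unfold PP; rw [integral_const_mul, gk_integral_sub hτ, mul_one]

lemma PP_abs_le (hτ : 0 < τ) (x : Euc N) :
    |PP τ f x| ≤ PP τ (fun y => |f y|) x := by
  unfold PP
  refine (norm_integral_le_integral_norm (μ := volume) (fun y => f y * gk τ (x - y))).trans (le_of_eq ?_)
  congr 1; ext y
  simp only [norm_mul, Real.norm_of_nonneg (gk_nonneg hτ _), Real.norm_eq_abs]

lemma PP_bdd (hτ : 0 < τ) (hf : AEStronglyMeasurable f volume) (hB : ∀ x, |f x| ≤ B) (x : Euc N) :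
    PP τ (fun y => |f y|) x ≤ B := by
  have := PP_mono hτ (GInt.of_bdd hf hB).abs (GInt.of_bdd (B := |B|) aestronglyMeasurable_const fun _ => le_rfl) hB x
  rwa [PP_const hτ] at this

lemma PP_hasDerivAt_time (hτ : 0 < τ) (hf : GInt f) (x : Euc N) :
    HasDerivAt (fun τ => PP τ f x)
      (∑ i : Fin N, PP2 τ f x (EuclideanSpace.single i 1) (EuclideanSpace.single i 1)) τ := by
  obtain ⟨C, hC, h⟩ := gk2_bound (N := N) 0 le_rfl
  obtain ⟨A, _, _, hA⟩ := gk_all_bound (N := N) hτ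
  have e : (∑ i : Fin N, PP2 τ f x (EuclideanSpace.single i 1) (EuclideanSpace.single i 1)) =
      ∫ y, f y * ∑ i : Fin N, gk2 τ (x - y) (EuclideanSpace.single i 1) (EuclideanSpace.single i 1) := by
    have hi := conv_integrable (gk2_continuous τ) (by positivity) hA hf x
    have : ∀ v w, PP2 τ f x v w = ∫ y, f y * gk2 τ (x - y) v w := by
      intro v w
      unfold PP2
      rw [ContinuousLinearMap.integral_apply hi, ContinuousLinearMap.integral_apply (hi.apply_continuousLinearMap v)]
      rfl
    simp only [this, Finset.mul_sum]
    rw [integral_finsetSum]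
    intro i _
    exact ((hi.apply_continuousLinearMap _).apply_continuousLinearMap _)
  rw [e]
  refine (hasDerivAt_integral_of_dominated_loc_of_deriv_le (F' := fun τ y => f y * ∑ i : Fin N, gk2 τ (x - y) (EuclideanSpace.single i 1) (EuclideanSpace.single i 1))
    (bound := fun y => N * (C * (τ / 2)⁻¹ * 4 ^ ((N : ℝ) / 2)) * (|f y| * gk (4 * τ) (x - y)))
    (Ioo_mem_nhds (show τ / 2 < τ by linarith) (show τ < 2 * τ by linarith)) ?_ (hf.2 τ hτ x) ?_ ?_
    ((hf.abs.2 _ (by positivity) x).const_mul _) ?_).2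
  · filter_upwards [lt_mem_nhds hτ] with t ht
    exact (hf.2 t ht x).1
  · refine hf.1.mul (Continuous.aestronglyMeasurable ?_)
    refine continuous_finsetSum _ fun i _ => ?_
    exact (((gk2_continuous τ).comp (by fun_prop : Continuous fun y : Euc N => x - y)).clm_apply continuous_const).clm_apply continuous_const
  · refine .of_forall fun y t ht => ?_
    have ht0 : 0 < t := lt_trans (by positivity) ht.1
    rw [norm_mul, Real.norm_eq_abs]
    have h1 : ‖gk2 t (x - y)‖ ≤ C * (τ / 2)⁻¹ * 4 ^ ((N : ℝ) / 2) * gk (4 * τ) (x - y) := by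
      have a1 := h t ht0 (x - y)
      rw [Real.rpow_zero, one_mul, zero_div, add_zero, Real.rpow_neg_one] at a1
      have a2 := gk_le (show 0 < 2 * t by positivity) (show 2 * t ≤ 4 * τ by linarith [ht.2]) (x - y)
      have a3 : (4 * τ / (2 * t)) ≤ 4 := by
        rw [div_le_iff₀ (by positivity)]; linarith [ht.1]
      have a4 : t⁻¹ ≤ (τ / 2)⁻¹ := inv_anti₀ (by positivity) ht.1.le
      have hg := gk_nonneg (show 0 < 4 * τ by positivity) (x - y)
      have hg2 := gk_nonneg (show 0 < 2 * t by positivity) (x - y)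
      calc _ ≤ C * t⁻¹ * gk (2 * t) (x - y) := a1
        _ ≤ C * (τ / 2)⁻¹ * (4 ^ ((N : ℝ) / 2) * gk (4 * τ) (x - y)) := by
            gcongr
            refine a2.trans ?_
            gcongr
        _ = _ := by ring
    have h2 : ‖∑ i : Fin N, gk2 t (x - y) (EuclideanSpace.single i 1) (EuclideanSpace.single i 1)‖ ≤ N * ‖gk2 t (x - y)‖ := by
      refine (norm_sum_le_of_le (f := fun i : Fin N => gk2 t (x - y) (EuclideanSpace.single i 1) (EuclideanSpace.single i 1)) Finset.univ (n := fun _ => ‖gk2 t (x - y)‖) fun i _ => ?_).trans (by simp)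
      refine (ContinuousLinearMap.le_opNorm₂ _ _ _).trans ?_
      simp
    calc _ ≤ |f y| * (N * (C * (τ / 2)⁻¹ * 4 ^ ((N : ℝ) / 2) * gk (4 * τ) (x - y))) := by
          gcongr; exact h2.trans (by gcongr)
      _ = _ := by ring
  · refine .of_forall fun y t ht => ?_
    have ht0 : 0 < t := lt_trans (by positivity) ht.1
    exact (gk_hasDerivAt_time ht0 (x - y)).const_mul (f y)

section CS
variable {X : Type*} [MeasurableSpace X] {μ : Measure X} {f g : X → ℝ}

lemma iadd (hf : Integrable f μ) (hg : Integrable g μ) : Integrable (fun x => f x + g x) μ := hf.add hg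
lemma isub (hf : Integrable f μ) (hg : Integrable g μ) : Integrable (fun x => f x - g x) μ := hf.sub hg

lemma int_mul_of_sq (hf : AEStronglyMeasurable f μ) (hg : AEStronglyMeasurable g μ)
    (hf2 : Integrable (fun x => f x ^ 2) μ) (hg2 : Integrable (fun x => g x ^ 2) μ) :
    Integrable (fun x => f x * g x) μ := by
  refine (hf2.add hg2).mono' (hf.mul hg) (.of_forall fun x => ?_)
  simp only [Pi.add_apply, Real.norm_eq_abs, abs_mul]
  nlinarith [sq_abs (f x), sq_abs (g x), sq_nonneg (|f x| - |g x|), sq_nonneg (f x), sq_nonneg (g x)]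

lemma cs_sq (hf : AEStronglyMeasurable f μ) (hg : AEStronglyMeasurable g μ)
    (hf2 : Integrable (fun x => f x ^ 2) μ) (hg2 : Integrable (fun x => g x ^ 2) μ) :
    (∫ x, f x * g x ∂μ) ^ 2 ≤ (∫ x, f x ^ 2 ∂μ) * ∫ x, g x ^ 2 ∂μ := by
  have hfg := int_mul_of_sq hf hg hf2 hg2
  have key : ∀ t : ℝ, 0 ≤ (∫ x, g x ^ 2 ∂μ) * (t * t) + (2 * ∫ x, f x * g x ∂μ) * t + ∫ x, f x ^ 2 ∂μ := by
    intro t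
    have h1 : 0 ≤ ∫ x, (f x + t * g x) ^ 2 ∂μ := integral_nonneg fun x => sq_nonneg _
    have h2 : ∫ x, (f x + t * g x) ^ 2 ∂μ = ∫ x, (f x ^ 2 + (2 * t) * (f x * g x) + (t * t) * g x ^ 2) ∂μ := by
      congr 1; ext x; ring
    rw [h2, integral_add (iadd hf2 (hfg.const_mul _)) (hg2.const_mul _), integral_add hf2 (hfg.const_mul _),
      integral_const_mul, integral_const_mul] at h1
    linarith
  have := discrim_le_zero key
  unfold discrim at this
  nlinarith
end CS

lemma PP2_holder (γ : ℝ) (hγ : 0 ≤ γ) : ∃ C : ℝ, 0 < C ∧ ∀ τ : ℝ, 0 < τ → ∀ f : Euc N → ℝ, GInt f → ∀ H : ℝ, 0 ≤ H →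
    (∀ x y, |f x - f y| ≤ H * ‖x - y‖ ^ γ) → ∀ x, ‖PP2 τ f x‖ ≤ C * H * τ ^ (-1 + γ / 2) := by
  obtain ⟨C, hC, h⟩ := gk2_bound (N := N) γ hγ
  refine ⟨C, hC, fun τ hτ f hf H hH0' hH x => ?_⟩
  have hone : GInt (fun _ : Euc N => (1 : ℝ)) := GInt.of_bdd (B := 1) aestronglyMeasurable_const (by simp)
  have z1 : ∀ x : Euc N, PP1 τ (fun _ => (1 : ℝ)) x = 0 := by
    intro x
    have h1 := PP_hasFDerivAt hτ hone x
    have e : PP τ (fun _ : Euc N => (1 : ℝ)) = fun _ => 1 := by ext x; exact PP_const hτ 1 x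
    rw [e] at h1
    exact h1.unique (hasFDerivAt_const _ _)
  have z2 : PP2 τ (fun _ : Euc N => (1 : ℝ)) x = 0 := by
    have h1 := PP1_hasFDerivAt hτ hone x
    have e : PP1 τ (fun _ : Euc N => (1 : ℝ)) = fun _ => 0 := by ext1 x; exact z1 x
    rw [e] at h1
    exact h1.unique (hasFDerivAt_const _ _)
  obtain ⟨A, _, _, hA⟩ := gk_all_bound (N := N) hτ
  have i1 := conv_integrable (gk2_continuous τ) (by positivity) hA hf x
  have i2 := conv_integrable (gk2_continuous τ) (by positivity) hA hone x
  have e : PP2 τ f x = ∫ y, (f y - f x) • gk2 τ (x - y) := by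
    have : ∀ y, (f y - f x) • gk2 τ (x - y) = f y • gk2 τ (x - y) - f x • ((1 : ℝ) • gk2 τ (x - y)) := by
      intro y; rw [one_smul, sub_smul]
    simp only [this]
    have e3 : ∫ y, f x • ((1 : ℝ) • gk2 τ (x - y)) = f x • PP2 τ (fun _ : Euc N => (1 : ℝ)) x := integral_smul _ _
    rw [integral_sub i1 (show Integrable (fun y => f x • ((1 : ℝ) • gk2 τ (x - y))) from i2.smul (f x)), e3, z2, smul_zero, sub_zero]; rfl
  rw [e]
  have hg := gk_integral_sub (show 0 < 2 * τ by positivity) x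
  have : C * H * τ ^ (-1 + γ / 2) = ∫ y, C * H * τ ^ (-1 + γ / 2) * gk (2 * τ) (x - y) := by
    rw [integral_const_mul, hg, mul_one]
  rw [this]
  refine norm_integral_le_of_norm_le ((gk_integrable_sub (by positivity) x).const_mul _) (.of_forall fun y => ?_)
  rw [norm_smul, Real.norm_eq_abs]
  have h1 := hH y x
  rw [norm_sub_rev] at h1
  have hH0 : 0 ≤ H * ‖x - y‖ ^ γ := (abs_nonneg _).trans h1
  calc |f y - f x| * ‖gk2 τ (x - y)‖ ≤ H * ‖x - y‖ ^ γ * ‖gk2 τ (x - y)‖ := by gcongr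
    _ = H * (‖x - y‖ ^ γ * ‖gk2 τ (x - y)‖) := by ring
    _ ≤ H * (C * τ ^ (-1 + γ / 2) * gk (2 * τ) (x - y)) := by
        exact mul_le_mul_of_nonneg_left (h τ hτ _) hH0'
    _ = _ := by ring

lemma young_sup {q : ℝ} (hq : 1 ≤ q) {l s : ℝ} (hl : 0 < l) (hs : 0 ≤ s) : s ≤ l + l ^ (1 - q) * s ^ q := by
  rcases le_or_gt s l with h | h
  · have : 0 ≤ l ^ (1 - q) * s ^ q := by positivity
    linarith
  · have hs' : 0 < s := hl.trans h
    have h1 : s ^ (1 - q) ≤ l ^ (1 - q) := Real.rpow_le_rpow_of_nonpos hl h.le (by linarith)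
    have h2 : s = s ^ (1 - q) * s ^ q := by rw [← Real.rpow_add hs']; simp
    have h3 : s ^ (1 - q) * s ^ q ≤ l ^ (1 - q) * s ^ q := by gcongr
    linarith

lemma PP_sup {q : ℝ} (hq : 1 ≤ q) (hfm : AEStronglyMeasurable f volume) (h0 : ∀ x, 0 ≤ f x)
    (hi : Integrable (fun x => f x ^ q)) (hQ : 0 < Q) (hle : ∫ x, f x ^ q ≤ Q ^ q) :
    GInt f ∧ ∀ τ : ℝ, 0 < τ → ∀ x, PP τ f x ≤ 2 * Q * τ ^ (-(N : ℝ) / (2 * q)) := by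
  have hm : ∀ σ (x : Euc N), AEStronglyMeasurable (fun y : Euc N => gk σ (x - y)) volume := fun σ x =>
    ((gk_continuous σ).comp (by fun_prop)).aestronglyMeasurable
  have h3 : ∀ σ, 0 < σ → ∀ x, Integrable (fun y => f y ^ q * gk σ (x - y)) := by
    intro σ hσ x
    refine hi.mul_bdd (c := σ ^ (-(N : ℝ) / 2)) (hm σ x) (.of_forall fun y => ?_)
    rw [Real.norm_of_nonneg (gk_nonneg hσ _)]; exact gk_le_const hσ _
  have hG : GInt f := by
    refine ⟨hfm, fun σ hσ x => ?_⟩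
    refine ((gk_integrable_sub hσ x).add (h3 σ hσ x)).mono' (hfm.mul (hm σ x)) (.of_forall fun y => ?_)
    have hg := gk_nonneg hσ (x - y)
    have hy := young_sup hq one_pos (h0 y)
    rw [Real.one_rpow, one_mul] at hy
    rw [norm_mul, Real.norm_of_nonneg hg, Real.norm_of_nonneg (h0 y)]
    simp only [Pi.add_apply]
    nlinarith
  refine ⟨hG, fun τ hτ x => ?_⟩
  set l := Q * τ ^ (-(N : ℝ) / (2 * q)) with hl
  have hl0 : 0 < l := by positivity
  have i1 : Integrable (fun y => l * gk τ (x - y) + l ^ (1 - q) * (f y ^ q * gk τ (x - y))) :=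
    ((gk_integrable_sub hτ x).const_mul _).add ((h3 τ hτ x).const_mul _)
  have h4 : PP τ f x ≤ ∫ y, (l * gk τ (x - y) + l ^ (1 - q) * (f y ^ q * gk τ (x - y))) := by
    refine integral_mono (hG.2 τ hτ x) i1 fun y => ?_
    have := gk_nonneg hτ (x - y)
    have hy := young_sup hq hl0 (h0 y)
    simp only
    nlinarith
  rw [integral_add ((gk_integrable_sub hτ x).const_mul _) ((h3 τ hτ x).const_mul _), integral_const_mul, integral_const_mul,
    gk_integral_sub hτ] at h4
  have h5 : ∫ y, f y ^ q * gk τ (x - y) ≤ τ ^ (-(N : ℝ) / 2) * Q ^ q := by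
    calc _ ≤ ∫ y, τ ^ (-(N : ℝ) / 2) * f y ^ q := by
          refine integral_mono (h3 τ hτ x) (hi.const_mul _) fun y => ?_
          have := gk_le_const hτ (x - y)
          have := Real.rpow_nonneg (h0 y) q
          simp only
          nlinarith
      _ = τ ^ (-(N : ℝ) / 2) * ∫ y, f y ^ q := integral_const_mul _ _
      _ ≤ _ := by gcongr
  have h6 : l ^ q = Q ^ q * τ ^ (-(N : ℝ) / 2) := by
    rw [hl, Real.mul_rpow hQ.le (by positivity), ← Real.rpow_mul hτ.le]
    congr 2; field_simp
  have h7 : l ^ (1 - q) * (τ ^ (-(N : ℝ) / 2) * Q ^ q) = l := by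
    rw [mul_comm (τ ^ _), ← h6, ← Real.rpow_add hl0]; simp
  have h8 := mul_le_mul_of_nonneg_left h5 (Real.rpow_nonneg hl0.le (1 - q))
  rw [h7] at h8
  linarith

lemma PP_jensen (hτ : 0 < τ) (hf : GInt f) (hf2 : GInt (fun x => f x ^ 2)) (x : Euc N) :
    PP τ f x ^ 2 ≤ PP τ (fun y => f y ^ 2) x := by
  set m := PP τ f x with hm
  have h1 : 0 ≤ ∫ y, (f y - m) ^ 2 * gk τ (x - y) := integral_nonneg fun y => mul_nonneg (sq_nonneg _) (gk_nonneg hτ _)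
  have h2 : ∀ y, (f y - m) ^ 2 * gk τ (x - y) = f y ^ 2 * gk τ (x - y) - (2 * m) * (f y * gk τ (x - y)) + m ^ 2 * gk τ (x - y) := by
    intro y; ring
  simp only [h2] at h1
  rw [integral_add (isub (hf2.2 τ hτ x) ((hf.2 τ hτ x).const_mul _)) ((gk_integrable_sub hτ x).const_mul _),
    integral_sub (hf2.2 τ hτ x) ((hf.2 τ hτ x).const_mul _), integral_const_mul, integral_const_mul, gk_integral_sub hτ] at h1
  change 0 ≤ PP τ (fun y => f y ^ 2) x - 2 * m * m + _ at h1
  nlinarith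

lemma GInt.of_integrable (h : Integrable f) : GInt f := by
  refine ⟨h.1, fun σ hσ x => h.mul_bdd (c := σ ^ (-(N : ℝ) / 2)) ((gk_continuous σ).comp (by fun_prop)).aestronglyMeasurable (.of_forall fun y => ?_)⟩
  rw [Real.norm_of_nonneg (gk_nonneg hσ _)]; exact gk_le_const hσ _

lemma PP_integral (hτ : 0 < τ) (hf : Integrable f) :
    Integrable (PP τ f) ∧ ∫ x, PP τ f x = ∫ x, f x := by
  have h1 := hf.integrable_convolution (ContinuousLinearMap.mul ℝ ℝ) (gk_integrable (N := N) hτ)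
  have h2 := integral_convolution (ContinuousLinearMap.mul ℝ ℝ) hf (gk_integrable (N := N) hτ)
  refine ⟨h1, ?_⟩
  rw [gk_integral hτ] at h2
  simp only [ContinuousLinearMap.mul_apply', mul_one] at h2
  exact h2

lemma PP_l2 (hτ : 0 < τ) (hm : AEStronglyMeasurable f volume) (hf : Integrable (fun x => f x ^ 2)) :
    Integrable (fun x => PP τ f x ^ 2) ∧ ∫ x, PP τ f x ^ 2 ≤ ∫ x, f x ^ 2 := by
  obtain ⟨h1, h2⟩ := PP_integral hτ hf
  have hj := PP_jensen hτ (GInt.of_sq hm hf) (GInt.of_integrable hf)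
  have h3 : Integrable (fun x => PP τ f x ^ 2) := by
    refine h1.mono' ((PP_continuous hτ (GInt.of_sq hm hf)).pow 2).aestronglyMeasurable (.of_forall fun x => ?_)
    rw [Real.norm_of_nonneg (sq_nonneg _)]; exact hj x
  exact ⟨h3, h2 ▸ integral_mono h3 h1 hj⟩

lemma PP_scaled (hτ : 0 < τ) (f : Euc N → ℝ) (x : Euc N) :
    PP τ f x = ∫ y, f (x - √τ • y) * gk 1 y := by
  unfold PP
  rw [← integral_sub_left_eq_self (fun y => f y * gk τ (x - y)) volume x]
  simp only [sub_sub_cancel]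
  have h := Measure.integral_comp_smul (volume : Measure (Euc N)) (fun z => f (x - z) * gk τ z) (√τ)
  have hs : 0 < √τ := Real.sqrt_pos.2 hτ
  have e : ∀ y : Euc N, gk τ (√τ • y) = (√τ ^ N)⁻¹ * gk 1 y := by
    intro y
    unfold gk
    rw [norm_smul, Real.norm_of_nonneg hs.le, mul_pow, Real.sq_sqrt hτ.le]
    have e1 : (√τ ^ N)⁻¹ = τ ^ (-(N : ℝ) / 2) := by
      rw [Real.sqrt_eq_rpow, ← Real.rpow_natCast, ← Real.rpow_mul hτ.le, ← Real.rpow_neg hτ.le]; congr 1; ring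
    rw [e1, mul_one, Real.mul_rpow (by positivity) hτ.le]
    have e2 : -(τ * ‖y‖ ^ 2) / (4 * τ) = -‖y‖ ^ 2 / (4 * 1) := by field_simp
    rw [e2]; ring
  simp only [e] at h
  rw [finrank_euclideanSpace, Fintype.card_fin, abs_of_nonneg (by positivity), smul_eq_mul] at h
  have h' : ∫ y, f (x - √τ • y) * ((√τ ^ N)⁻¹ * gk 1 y) = (√τ ^ N)⁻¹ * ∫ y, f (x - √τ • y) * gk 1 y := by
    rw [← integral_const_mul]; congr 1; ext y; ring
  rw [h'] at h
  exact (mul_left_cancel₀ (by positivity) h).symm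

def WW (f : Euc N → ℝ) (z : ℝ × Euc N) : ℝ := ∫ y, f (z.2 - √z.1 • y) * gk 1 y

lemma WW_continuous (hf : Continuous f) (hB : ∀ x, |f x| ≤ B) : Continuous (WW f) := by
  refine continuous_of_dominated (bound := fun y => B * gk 1 y) ?_ ?_ ((gk_integrable one_pos).const_mul _) ?_
  · intro z
    exact ((hf.comp (by fun_prop)).mul (gk_continuous 1)).aestronglyMeasurable
  · refine fun z => .of_forall fun y => ?_
    rw [norm_mul, Real.norm_of_nonneg (gk_nonneg one_pos y)]
    exact mul_le_mul_of_nonneg_right (hB _) (gk_nonneg one_pos y)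
  · refine .of_forall fun y => ?_
    have : Continuous fun z : ℝ × Euc N => z.2 - √z.1 • y := by fun_prop
    exact (hf.comp this).mul continuous_const

lemma WW_zero (f : Euc N → ℝ) (x : Euc N) : WW f (0, x) = f x := by
  simp [WW, integral_const_mul, gk_integral one_pos]

lemma PP_tendsto (hf : Continuous f) (hB : ∀ x, |f x| ≤ B) (x : Euc N) :
    Tendsto (fun τ => PP τ f x) (nhdsWithin 0 (Ioi 0)) (nhds (f x)) := by
  have h : ContinuousAt (fun τ : ℝ => WW f (τ, x)) 0 := by
    exact ((WW_continuous hf hB).comp (by fun_prop)).continuousAt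
  have h2 := h.tendsto
  simp only [WW_zero] at h2
  refine (h2.mono_left nhdsWithin_le_nhds).congr' ?_
  filter_upwards [self_mem_nhdsWithin] with τ hτ
  exact (PP_scaled hτ f x).symm

lemma second_test {g g' : ℝ → ℝ} {c : ℝ} (hg : ∀ t, HasDerivAt g (g' t) t) (hg' : HasDerivAt g' c 0)
    (hm : IsLocalMin g 0) : g' 0 = 0 ∧ 0 ≤ c := by
  have h0 : g' 0 = 0 := hm.hasDerivAt_eq_zero (hg 0)
  refine ⟨h0, ?_⟩
  by_contra hc
  push Not at hc
  have e : deriv g = g' := by ext t; exact (hg t).deriv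
  have hM : IsLocalMax g 0 := isLocalMax_of_deriv_deriv_neg (by rw [e, hg'.deriv]; exact hc) (by rw [e, h0])
    (hg 0).continuousAt
  have hc1 : g =ᶠ[nhds 0] fun _ => g 0 := by
    filter_upwards [hm, hM] with t h1 h2
    exact le_antisymm h2 h1
  have h2 := hc1.deriv.deriv_eq
  rw [e, hg'.deriv] at h2
  simp at h2
  linarith

section
variable {φ : Euc N → ℝ} {φ' : Euc N → Euc N →L[ℝ] ℝ} {φ'' : Euc N → Euc N →L[ℝ] Euc N →L[ℝ] ℝ}

lemma curve_deriv2 (h1 : ∀ x, HasFDerivAt φ (φ' x) x) {φx : Euc N →L[ℝ] Euc N →L[ℝ] ℝ} {c c' : ℝ → Euc N} {v : Euc N}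
    (hc : ∀ t, HasDerivAt c (c' t) t) (hc' : HasDerivAt c' v 0) (h2 : HasFDerivAt φ' φx (c 0)) :
    (∀ t, HasDerivAt (fun t => φ (c t)) (φ' (c t) (c' t)) t) ∧
    HasDerivAt (fun t => φ' (c t) (c' t)) (φx (c' 0) (c' 0) + φ' (c 0) v) 0 := by
  refine ⟨fun t => (h1 (c t)).comp_hasDerivAt t (hc t), ?_⟩
  exact (h2.comp_hasDerivAt (0 : ℝ) (hc 0)).clm_apply hc'

lemma sphere_min (h1 : ∀ x, HasFDerivAt φ (φ' x) x) (h2 : ∀ x, HasFDerivAt φ' (φ'' x) x) {x : Euc N}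
    (hm : ∀ᶠ y in nhds x, ‖y‖ = ‖x‖ → φ x ≤ φ y) (t : Euc N) (ht : inner ℝ x t = 0) :
    ‖t‖ ^ 2 * φ' x x ≤ ‖x‖ ^ 2 * φ'' x t t := by
  rcases eq_or_ne t 0 with rfl | ht0
  · simp
  have htn : 0 < ‖t‖ := norm_pos_iff.2 ht0
  have key : ∀ s : Euc N, inner ℝ x s = 0 → ‖s‖ = ‖x‖ → φ' x x ≤ φ'' x s s := by
    intro s hs hsn
    set c : ℝ → Euc N := fun θ => cos θ • x + sin θ • s with hcdef
    set c' : ℝ → Euc N := fun θ => (-sin θ) • x + cos θ • s with hc'def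
    have hc : ∀ θ, HasDerivAt c (c' θ) θ := fun θ =>
      ((hasDerivAt_cos θ).smul_const x).add ((hasDerivAt_sin θ).smul_const s)
    have hc' : HasDerivAt c' (-x) 0 := by
      have := (((hasDerivAt_sin 0).neg).smul_const x).add ((hasDerivAt_cos 0).smul_const s)
      refine this.congr_deriv ?_
      simp
    have c0 : c 0 = x := by simp [hcdef]
    have c0' : c' 0 = s := by simp [hc'def]
    obtain ⟨d1, d2⟩ := curve_deriv2 h1 hc hc' (h2 (c 0))
    rw [c0, c0'] at d2
    have hcn : ∀ θ, ‖c θ‖ = ‖x‖ := by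
      intro θ
      have : ‖c θ‖ ^ 2 = ‖x‖ ^ 2 := by
        rw [hcdef]
        simp only
        rw [norm_add_sq_real, norm_smul, norm_smul, inner_smul_left, inner_smul_right, hs, mul_pow, mul_pow, hsn]
        simp only [Real.norm_eq_abs, sq_abs]
        nlinarith [Real.sin_sq_add_cos_sq θ]
      exact (sq_eq_sq₀ (norm_nonneg _) (norm_nonneg _)).1 this
    have hmin : IsLocalMin (fun θ => φ (c θ)) 0 := by
      have hct : Tendsto c (nhds 0) (nhds x) := by
        have := (hc 0).continuousAt.tendsto; rwa [c0] at this
      filter_upwards [hct.eventually hm] with θ h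
      simp only [c0]
      exact h (hcn θ)
    have := (second_test d1 d2 hmin).2
    simp at this
    linarith
  have h3 := key ((‖x‖ / ‖t‖) • t) (by rw [inner_smul_right, ht, mul_zero]) (by
    rw [norm_smul, norm_div, norm_norm, norm_norm]; field_simp)
  simp only [map_smul, smul_apply, smul_eq_mul] at h3
  have h4 : ‖x‖ / ‖t‖ * (‖x‖ / ‖t‖ * φ'' x t t) = ‖x‖ ^ 2 * φ'' x t t / ‖t‖ ^ 2 := by field_simp
  rw [h4, le_div_iff₀ (by positivity)] at h3
  linarith

def trH (A : Euc N →L[ℝ] Euc N →L[ℝ] ℝ) : ℝ := ∑ i : Fin N, A (EuclideanSpace.single i 1) (EuclideanSpace.single i 1)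

lemma euc_sum (x : Euc N) : ∑ i : Fin N, x i • EuclideanSpace.single i (1 : ℝ) = x := by
  ext j
  simp [Finset.sum_apply, Pi.single_apply]

lemma sphere_min_tr (h1 : ∀ x, HasFDerivAt φ (φ' x) x) (h2 : ∀ x, HasFDerivAt φ' (φ'' x) x) {x : Euc N} (hx : x ≠ 0)
    (hm : ∀ᶠ y in nhds x, ‖y‖ = ‖x‖ → φ x ≤ φ y) :
    ((N : ℝ) - 1) * φ' x x ≤ ‖x‖ ^ 2 * trH (φ'' x) - φ'' x x x := by
  have hr : 0 < ‖x‖ := norm_pos_iff.2 hx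
  set A := φ'' x with hA
  set r := ‖x‖ with hrd
  have hsum2 : ∑ i : Fin N, x i ^ 2 = r ^ 2 := by
    rw [hrd, EuclideanSpace.norm_sq_eq]; simp
  let t : Fin N → Euc N := fun i => EuclideanSpace.single i 1 - (x i / r ^ 2) • x
  have hin : ∀ i, inner ℝ x (EuclideanSpace.single i (1:ℝ)) = x i := by
    intro i; simp [EuclideanSpace.inner_single_right]
  have ht : ∀ i, inner ℝ x (t i) = 0 := by
    intro i
    simp only [t]
    rw [inner_sub_right, inner_smul_right, hin, real_inner_self_eq_norm_sq, ← hrd]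
    field_simp; ring
  have htn : ∀ i, ‖t i‖ ^ 2 = 1 - x i ^ 2 / r ^ 2 := by
    intro i
    simp only [t]
    rw [norm_sub_sq_real, inner_smul_right, real_inner_comm, hin, norm_smul, mul_pow, ← hrd]
    simp
    field_simp
    try rw [sq_abs]
    ring
  have hsumn : ∑ i, ‖t i‖ ^ 2 = N - 1 := by
    simp only [htn]
    rw [Finset.sum_sub_distrib, ← Finset.sum_div, hsum2, div_self (by positivity)]; simp
  have hsumA : ∑ i, A (t i) (t i) = trH A - A x x / r ^ 2 := by
    have e : ∀ i, A (t i) (t i) = A (EuclideanSpace.single i 1) (EuclideanSpace.single i 1)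
        - (1 / r ^ 2) * A (x i • EuclideanSpace.single i 1) x - (1 / r ^ 2) * A x (x i • EuclideanSpace.single i 1)
        + x i ^ 2 * (A x x / r ^ 4) := by
      intro i
      simp only [t, map_sub, map_smul, sub_apply, smul_apply, smul_eq_mul]
      field_simp
      ring
    simp only [e]
    rw [Finset.sum_add_distrib, Finset.sum_sub_distrib, Finset.sum_sub_distrib, ← Finset.mul_sum, ← Finset.mul_sum,
      ← map_sum (A x), euc_sum, ← Finset.sum_mul, hsum2]
    have e2 : ∑ i : Fin N, (A (x i • EuclideanSpace.single i 1)) x = A x x := by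
      rw [← sum_apply, ← map_sum A, euc_sum]
    rw [e2]
    unfold trH
    field_simp; ring
  have h3 : ∑ i, ‖t i‖ ^ 2 * φ' x x ≤ ∑ i, r ^ 2 * A (t i) (t i) :=
    Finset.sum_le_sum fun i _ => sphere_min h1 h2 hm (t i) (ht i)
  rw [← Finset.sum_mul, ← Finset.mul_sum, hsumn, hsumA] at h3
  have : r ^ 2 * (trH A - A x x / r ^ 2) = r ^ 2 * trH A - A x x := by field_simp
  linarith
end

lemma two_point_lap {a b : Euc N → ℝ} {a' b' : Euc N → Euc N →L[ℝ] ℝ} {a'' b'' : Euc N → Euc N →L[ℝ] Euc N →L[ℝ] ℝ}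
    (ha1 : ∀ x, HasFDerivAt a (a' x) x) (ha2 : ∀ x, HasFDerivAt a' (a'' x) x)
    (hb1 : ∀ x, HasFDerivAt b (b' x) x) (hb2 : ∀ x, HasFDerivAt b' (b'' x) x)
    {x₁ x₂ : Euc N} (hx : x₁ ≠ 0) (hn : ‖x₁‖ = ‖x₂‖)
    (hm1 : ∀ᶠ y in nhds x₁, ‖y‖ = ‖x₁‖ → a y ≤ a x₁)
    (hm2 : ∀ᶠ y in nhds x₂, ‖y‖ = ‖x₂‖ → b x₂ ≤ b y)
    (hr : IsLocalMin (fun h : ℝ => b ((1 + h) • x₂) - a ((1 + h) • x₁)) 0) :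
    trH (a'' x₁) ≤ trH (b'' x₂) := by
  have hx2 : x₂ ≠ 0 := by rw [← norm_ne_zero_iff, ← hn, norm_ne_zero_iff]; exact hx
  have k2 := sphere_min_tr hb1 hb2 hx2 hm2
  have k1 := sphere_min_tr (φ := fun x => -a x) (φ' := fun x => -a' x) (φ'' := fun x => -a'' x)
    (fun x => (ha1 x).neg) (fun x => (ha2 x).neg) hx (by filter_upwards [hm1] with y h hy; linarith [h hy])
  have hc : ∀ x : Euc N, ∀ t : ℝ, HasDerivAt (fun h : ℝ => (1 + h) • x) x t := by
    intro x t
    have := ((hasDerivAt_id t).const_add 1).smul_const x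
    simpa using this
  have hc' : ∀ x : Euc N, HasDerivAt (fun _ : ℝ => x) 0 0 := fun x => hasDerivAt_const _ _
  obtain ⟨d1, d2⟩ := curve_deriv2 hb1 (hc x₂) (hc' x₂) (hb2 _)
  obtain ⟨e1, e2⟩ := curve_deriv2 ha1 (hc x₁) (hc' x₁) (ha2 _)
  obtain ⟨g1, g2⟩ := second_test (fun t => (d1 t).sub (e1 t)) (d2.sub e2) hr
  simp only [add_zero, one_smul, map_zero] at g1 g2
  have htr : trH (-a'' x₁) = -trH (a'' x₁) := by simp [trH]
  rw [htr] at k1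
  simp only [neg_apply] at k1
  rw [← hn] at k2
  have hpos : 0 < ‖x₁‖ ^ 2 := by have := norm_pos_iff.2 hx; positivity
  have g1' : b' x₂ x₂ = a' x₁ x₁ := by linarith
  rw [g1'] at k2
  have : ‖x₁‖ ^ 2 * trH (a'' x₁) ≤ ‖x₁‖ ^ 2 * trH (b'' x₂) := by linarith
  exact le_of_mul_le_mul_left this hpos

lemma XV_of_t {x y : Euc N} (h1 : ‖x‖ = ‖y‖) (h : ∀ j : Fin N, n ≤ (j:ℕ) → x j = y j) : XV n x = XV n y := by
  have e : tVar n x = tVar n y := by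
    unfold tVar; congr 1; refine Finset.sum_congr rfl fun j _ => ?_
    split_ifs with hj
    · rw [h j hj]
    · rfl
  have a := st_norm n x; have b := st_norm n y; have c := st_XV n x; have d := st_XV n y
  rw [h1] at a; rw [e] at a c; linarith

lemma XV_of_s {x y : Euc N} (h1 : ‖x‖ = ‖y‖) (h : ∀ j : Fin N, (j:ℕ) < n → x j = y j) : XV n x = XV n y := by
  have e : sVar n x = sVar n y := by
    unfold sVar; congr 1; refine Finset.sum_congr rfl fun j _ => ?_
    split_ifs with hj
    · rw [h j hj]
    · rfl
  have a := st_norm n x; have b := st_norm n y; have c := st_XV n x; have d := st_XV n y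
  rw [h1] at a; rw [e] at a c; linarith

lemma refl_coord (d z : Euc N) (j : Fin N) (hj : d j = 0) : ((ℝ ∙ d)ᗮ.reflection z) j = z j := by
  have : (ℝ ∙ d)ᗮ.reflection z = -((ℝ ∙ d).reflection z) := by
    rw [Submodule.reflection_orthogonal_apply]
  rw [this, Submodule.reflection_singleton_apply]
  simp [hj]

def blk (n : ℕ) (y x : Euc N) : Euc N := WithLp.toLp 2 fun j => if (j:ℕ) < n then y j else x j

lemma isom_same {x y : Euc N} (h1 : ‖x‖ = ‖y‖) (h2 : XV n x = XV n y) :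
    ∃ L : Euc N ≃ₗᵢ[ℝ] Euc N, L x = y ∧ ∀ z, XV n (L z) = XV n z := by
  have hb1 : ∀ j : Fin N, (j:ℕ) < n → blk n y x j = y j := fun j hj => by simp [blk, hj]
  have hb2 : ∀ j : Fin N, n ≤ (j:ℕ) → blk n y x j = x j := fun j hj => by simp [blk, not_lt.2 hj]
  have hs : sVar n (blk n y x) = sVar n y := by
    unfold sVar; congr 1; refine Finset.sum_congr rfl fun j _ => ?_
    split_ifs with hj
    · rw [hb1 j hj]
    · rfl
  have ht : tVar n (blk n y x) = tVar n x := by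
    unfold tVar; congr 1; refine Finset.sum_congr rfl fun j _ => ?_
    split_ifs with hj
    · rw [hb2 j hj]
    · rfl
  have hn : ‖blk n y x‖ = ‖y‖ := by
    have a := st_norm n x; have b := st_norm n y; have c := st_XV n x; have d := st_XV n y
    have e := st_norm n (blk n y x)
    rw [hs, ht] at e
    rw [h1] at a
    exact (sq_eq_sq₀ (norm_nonneg _) (norm_nonneg _)).1 (by linarith)
  refine ⟨((ℝ ∙ (x - blk n y x))ᗮ.reflection).trans ((ℝ ∙ (blk n y x - y))ᗮ.reflection), ?_, fun z => ?_⟩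
  · rw [LinearIsometryEquiv.trans_apply, Submodule.reflection_sub (by rw [h1, hn]), Submodule.reflection_sub hn]
  · rw [LinearIsometryEquiv.trans_apply]
    refine (XV_of_s (y := (ℝ ∙ (x - blk n y x))ᗮ.reflection z) ?_ fun j hj => ?_).trans (XV_of_t ?_ fun j hj => ?_)
    · simp
    · exact refl_coord _ _ _ (by simp [hb1 j hj])
    · simp
    · exact refl_coord _ _ _ (by simp [hb2 j hj])

lemma exists_swapL (hN : N = 2 * n) : ∃ L : Euc N ≃ₗᵢ[ℝ] Euc N, ∀ z, XV n (L z) = - XV n z := by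
  subst hN
  let σ : Fin (2 * n) ≃ Fin (2 * n) := 
    { toFun := fun j => if h : (j:ℕ) < n then ⟨j + n, by omega⟩ else ⟨j - n, by omega⟩
      invFun := fun j => if h : (j:ℕ) < n then ⟨j + n, by omega⟩ else ⟨j - n, by omega⟩
      left_inv := by
        intro j
        by_cases h : (j:ℕ) < n
        · simp [h]
        · have h2 : (j:ℕ) - n < n := by omega
          ext; simp [h, h2]; omega
      right_inv := by
        intro j
        by_cases h : (j:ℕ) < n
        · simp [h]
        · have h2 : (j:ℕ) - n < n := by omega
          ext; simp [h, h2]; omega }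
  have hσ : ∀ j, ((σ j : ℕ) < n) ↔ ¬ ((j:ℕ) < n) := by
    intro j; by_cases h : (j:ℕ) < n <;> simp [σ, h] <;> omega
  refine ⟨LinearIsometryEquiv.piLpCongrLeft 2 ℝ ℝ σ.symm, fun z => ?_⟩
  unfold XV
  have e : ∀ j, (LinearIsometryEquiv.piLpCongrLeft 2 ℝ ℝ σ.symm z) j = z (σ j) := by
    intro j; rfl
  simp only [e]
  rw [← Finset.sum_neg_distrib]
  refine Finset.sum_equiv σ (by simp) fun j _ => ?_
  by_cases h : (j:ℕ) < n
  · rw [if_pos h, if_neg ((hσ j).not.2 (by simpa using h))]; ring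
  · rw [if_neg h, if_pos ((hσ j).2 h)]

lemma exists_isom (hN : N = 2 * n) {x y : Euc N} (h1 : ‖x‖ = ‖y‖) (h2 : |XV n x| = |XV n y|) :
    ∃ L : Euc N ≃ₗᵢ[ℝ] Euc N, L x = y ∧ ∀ z, |XV n (L z)| = |XV n z| := by
  rcases abs_eq_abs.1 h2 with h | h
  · obtain ⟨L, a, b⟩ := isom_same h1 h
    exact ⟨L, a, fun z => by rw [b]⟩
  · obtain ⟨S, hS⟩ := exists_swapL hN
    obtain ⟨L, a, b⟩ := isom_same (n := n) (x := S x) (y := y) (by simp [h1]) (by rw [hS, h]; ring)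
    exact ⟨S.trans L, a, fun z => by rw [LinearIsometryEquiv.trans_apply, b, hS, abs_neg]⟩

lemma PP_isom (hN : N = 2 * n) (τ : ℝ) (hf : KC n f) {x y : Euc N} (h1 : ‖x‖ = ‖y‖)
    (h2 : |XV n x| = |XV n y|) : PP τ f x = PP τ f y := by
  obtain ⟨L, rfl, hL⟩ := exists_isom hN h1 h2
  unfold PP
  rw [← (L.measurePreserving).integral_comp L.toHomeomorph.measurableEmbedding (fun y => f y * gk τ (L x - y))]
  refine integral_congr_ae (Eventually.of_forall fun z => ?_)
  simp only
  have e1 : f (L z) = f z := hf.eq_of (by simp) (hL z)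
  have e2 : gk τ (L x - L z) = gk τ (x - z) := by
    rw [← map_sub]; unfold gk; rw [L.norm_map]
  rw [e1, e2]

lemma left_deriv_nonpos {g : ℝ → ℝ} {c t : ℝ} (hg : HasDerivAt g c t) (h : ∀ᶠ s in nhdsWithin t (Iio t), g t ≤ g s) : c ≤ 0 := by
  have h1 := hasDerivAt_iff_tendsto_slope.1 hg
  have h2 := h1.mono_left (nhdsWithin_mono t (fun s (hs : s < t) => ne_of_lt hs) : nhdsWithin t (Iio t) ≤ _)
  refine le_of_tendsto h2 ?_
  filter_upwards [h, self_mem_nhdsWithin] with s hs hst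
  rw [slope_def_field]
  exact div_nonpos_of_nonneg_of_nonpos (by linarith) (by simp only [mem_Iio] at hst; linarith)

lemma XV_smul (n : ℕ) (c : ℝ) (x : Euc N) : XV n (c • x) = c ^ 2 * XV n x := by
  unfold XV; rw [Finset.mul_sum]; refine Finset.sum_congr rfl fun j _ => ?_
  split_ifs <;> simp <;> ring

lemma nsq_deriv (δ : ℝ) (x : Euc N) : HasFDerivAt (fun x : Euc N => δ * ‖x‖ ^ 2) ((2 * δ) • innL x) x := by
  refine (((hasStrictFDerivAt_norm_sq x).hasFDerivAt).const_mul δ).congr_fderiv ?_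
  ext v
  simp only [smul_apply, innL_apply, innerSL_apply_apply, smul_eq_mul, nsmul_eq_mul]
  push_cast; ring

lemma trH_add_innL (A : Euc N →L[ℝ] Euc N →L[ℝ] ℝ) (c : ℝ) : trH (A + c • innL) = trH A + c * N := by
  unfold trH
  simp only [add_apply, smul_apply, Finset.sum_add_distrib, innL_apply]
  simp
  ring

lemma WW_eq (hτ : 0 < τ) (f : Euc N → ℝ) (x : Euc N) : WW f (τ, x) = PP τ f x := (PP_scaled hτ f x).symm

lemma KC_PP_bdd (hN : N = 2 * n) (hf : Continuous f) (hB : ∀ x, |f x| ≤ B)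
    (hK : KC n f) {T : ℝ} (hT : 0 < T) : KC n (PP T f) := by
  refine ⟨PP_nonneg hT hK.1, fun x₁ x₂ hn hX => ?_⟩
  by_contra hcon
  push Not at hcon
  have hG : GInt f := GInt.of_bdd hf.aestronglyMeasurable hB
  have hB0 : 0 ≤ B := (abs_nonneg _).trans (hB 0)
  have hWB : ∀ τ, 0 < τ → ∀ x, |WW f (τ, x)| ≤ B := fun τ hτ x => by
    rw [WW_eq hτ]; exact (PP_abs_le hτ x).trans (PP_bdd hτ hf.aestronglyMeasurable hB x)
  set η := PP T f x₁ - PP T f x₂ with hη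
  have hη0 : 0 < η := by linarith
  set A := ‖x₂‖ ^ 2 + (2 * N + 1) * T with hA
  have hA0 : 0 < A := by positivity
  set δ := η / (2 * A) with hδ
  have hδ0 : 0 < δ := by positivity
  have hδA : δ * A < η := by
    rw [hδ]; field_simp; linarith
  set R := ‖x₂‖ + √(2 * B / δ) + 1 with hR
  have hRb : 2 * B ≤ δ * R ^ 2 := by
    have h1 : √(2 * B / δ) ^ 2 = 2 * B / δ := Real.sq_sqrt (by positivity)
    have h2 : √(2 * B / δ) ^ 2 ≤ R ^ 2 := by
      refine pow_le_pow_left₀ (Real.sqrt_nonneg _) ?_ 2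
      have := norm_nonneg x₂; rw [hR]; linarith
    rw [h1, div_le_iff₀ hδ0] at h2; linarith
  let D : ℝ × Euc N × Euc N → ℝ := fun z => WW f (z.1, z.2.2) - WW f (z.1, z.2.1) + δ * (‖z.2.2‖ ^ 2 + (2 * N + 1) * z.1)
  have hWc := WW_continuous hf hB
  have hDc : Continuous D := by
    have c1 : Continuous fun z : ℝ × Euc N × Euc N => WW f (z.1, z.2.2) := hWc.comp (by fun_prop)
    have c2 : Continuous fun z : ℝ × Euc N × Euc N => WW f (z.1, z.2.1) := hWc.comp (by fun_prop)
    exact (c1.sub c2).add (by fun_prop)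
  let S : Set (ℝ × Euc N × Euc N) := {z | z.1 ∈ Icc 0 T ∧ ‖z.2.1‖ = ‖z.2.2‖ ∧ |XV n z.2.2| ≤ |XV n z.2.1| ∧ ‖z.2.2‖ ≤ R}
  have hXc := continuous_XV (N := N) n
  have hSc : IsCompact S := by
    have hsub : S ⊆ Icc 0 T ×ˢ (Metric.closedBall 0 R ×ˢ Metric.closedBall 0 R) := by
      rintro ⟨τ, y1, y2⟩ ⟨h1, h2, _, h4⟩
      simp only at h1 h2 h4
      exact ⟨h1, by simpa [h2] using h4, by simpa using h4⟩
    refine IsCompact.of_isClosed_subset (isCompact_Icc.prod ((isCompact_closedBall _ _).prod (isCompact_closedBall _ _))) ?_ hsub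
    refine (isClosed_Icc.preimage continuous_fst).inter (IsClosed.inter ?_ (IsClosed.inter ?_ ?_))
    · exact isClosed_eq (f := fun z : ℝ × Euc N × Euc N => ‖z.2.1‖) (g := fun z => ‖z.2.2‖) (by fun_prop) (by fun_prop)
    · exact isClosed_le ((hXc.comp (by fun_prop)).abs) ((hXc.comp (by fun_prop)).abs)
    · exact isClosed_le (f := fun z : ℝ × Euc N × Euc N => ‖z.2.2‖) (g := fun _ => R) (by fun_prop) (by fun_prop)
  have hmem : (T, x₁, x₂) ∈ S := ⟨⟨hT.le, le_rfl⟩, hn, hX, by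
    have := Real.sqrt_nonneg (2 * B / δ); simp only; rw [hR]; linarith⟩
  obtain ⟨⟨τ₀, z₁, z₂⟩, hz, hmin⟩ := hSc.exists_isMinOn ⟨_, hmem⟩ hDc.continuousOn
  have hmin' : ∀ τ y1 y2, (τ, y1, y2) ∈ S → D (τ₀, z₁, z₂) ≤ D (τ, y1, y2) := fun τ y1 y2 h => hmin h
  have hneg : D (τ₀, z₁, z₂) < 0 := by
    refine (hmin' _ _ _ hmem).trans_lt ?_
    simp only [D]
    rw [WW_eq hT, WW_eq hT, ← hA]
    linarith
  obtain ⟨⟨ht0, htT⟩, hzn, hzX, hzR⟩ := hz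
  simp only at ht0 htT hzn hzX hzR
  have hτ0 : 0 < τ₀ := by
    rcases ht0.lt_or_eq with h | h
    · exact h
    · exfalso
      simp only [D, ← h, WW_zero] at hneg
      have := hK.2 z₁ z₂ hzn hzX
      have : 0 ≤ δ * (‖z₂‖ ^ 2 + (2 * N + 1) * 0) := by positivity
      linarith
  have hextra : 0 ≤ δ * ((2 * N + 1) * τ₀) := by positivity
  have hzR' : ‖z₂‖ < R := by
    rcases hzR.lt_or_eq with h | h
    · exact h
    · exfalso
      simp only [D, h] at hneg
      have a := abs_le.1 (hWB τ₀ hτ0 z₁); have b := abs_le.1 (hWB τ₀ hτ0 z₂)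
      linarith [a.2, b.1, mul_add δ (R ^ 2) ((2 * N + 1) * τ₀)]
  have hzX' : |XV n z₂| < |XV n z₁| := by
    rcases hzX.lt_or_eq with h | h
    · exact h
    · exfalso
      simp only [D] at hneg
      rw [WW_eq hτ0, WW_eq hτ0, PP_isom hN τ₀ hK hzn.symm h] at hneg
      have : 0 ≤ δ * (‖z₂‖ ^ 2 + (2 * N + 1) * τ₀) := by positivity
      linarith
  have hz1 : z₁ ≠ 0 := by
    rintro rfl
    have : XV n (0 : Euc N) = 0 := by simp [XV]
    rw [this, abs_zero] at hzX'
    exact absurd hzX' (not_lt.2 (abs_nonneg _))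
  have key : ∀ y1 y2, (τ₀, y1, y2) ∈ S → PP τ₀ f z₂ - PP τ₀ f z₁ + δ * ‖z₂‖ ^ 2 ≤ PP τ₀ f y2 - PP τ₀ f y1 + δ * ‖y2‖ ^ 2 := by
    intro y1 y2 h
    have := hmin' _ _ _ h
    simp only [D] at this
    rw [WW_eq hτ0, WW_eq hτ0, WW_eq hτ0, WW_eq hτ0] at this
    linarith
  have hb1 : ∀ x, HasFDerivAt (fun x => PP τ₀ f x + δ * ‖x‖ ^ 2) (PP1 τ₀ f x + (2 * δ) • innL x) x := by
    intro x
    exact (PP_hasFDerivAt hτ0 hG x).add (nsq_deriv δ x)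
  have hb2 : ∀ x, HasFDerivAt (fun x => PP1 τ₀ f x + (2 * δ) • innL x) (PP2 τ₀ f x + (2 * δ) • innL) x := by
    intro x
    exact (PP1_hasFDerivAt hτ0 hG x).add (innL.hasFDerivAt.const_smul (2 * δ))
  have hlap := two_point_lap (PP_hasFDerivAt hτ0 hG) (PP1_hasFDerivAt hτ0 hG) hb1 hb2 hz1 hzn ?_ ?_ ?_
  · have htr := trH_add_innL (PP2 τ₀ f z₂) (2 * δ)
    rw [htr] at hlap
    have hd := ((PP_hasDerivAt_time hτ0 hG z₂).sub (PP_hasDerivAt_time hτ0 hG z₁)).add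
      ((hasDerivAt_id τ₀).const_mul (δ * (2 * N + 1)))
    have := left_deriv_nonpos hd (by
      filter_upwards [Ioo_mem_nhdsLT hτ0] with τ hτ
      have := hmin' τ z₁ z₂ ⟨⟨hτ.1.le, hτ.2.le.trans htT⟩, hzn, hzX, hzR⟩
      simp only [D] at this
      rw [WW_eq hτ0, WW_eq hτ0, WW_eq hτ.1, WW_eq hτ.1] at this
      simp
      linarith)
    change trH (PP2 τ₀ f z₂) - trH (PP2 τ₀ f z₁) + δ * (2 * N + 1) * 1 ≤ 0 at this
    linarith
  · have : ∀ᶠ y in nhds z₁, |XV n z₂| < |XV n y| := (hXc.abs.continuousAt).eventually_const_lt hzX'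
    filter_upwards [this] with y hy hyn
    have := key y z₂ ⟨⟨ht0, htT⟩, hyn.trans hzn, hy.le, hzR⟩
    linarith
  · have : ∀ᶠ y in nhds z₂, |XV n y| < |XV n z₁| := (hXc.abs.continuousAt).eventually_lt_const hzX'
    filter_upwards [this] with y hy hyn
    have := key z₁ y ⟨⟨ht0, htT⟩, hzn.trans hyn.symm, hy.le, hyn.le.trans hzR⟩
    linarith
  · have hc : Continuous fun h : ℝ => ‖(1 + h) • z₂‖ := by fun_prop
    have : ∀ᶠ h in nhds (0:ℝ), ‖(1 + h) • z₂‖ < R := hc.continuousAt.eventually_lt_const (by simpa using hzR')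
    filter_upwards [this] with h hh
    have := key ((1 + h) • z₁) ((1 + h) • z₂) ⟨⟨ht0, htT⟩, by simp only [norm_smul, hzn], by
      simp only [XV_smul, abs_mul]; exact mul_le_mul_of_nonneg_left hzX (abs_nonneg _), hh.le⟩
    simp only [add_zero, one_smul]
    linarith

lemma PP_min_tendsto (hτ : 0 < τ) (hG : GInt f) (h0 : ∀ x, 0 ≤ f x) (x : Euc N) :
    Tendsto (fun j : ℕ => PP τ (fun y => min (f y) j) x) atTop (nhds (PP τ f x)) := by
  unfold PP
  refine tendsto_integral_of_dominated_convergence (fun y => f y * gk τ (x - y)) ?_ (hG.2 τ hτ x) ?_ ?_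
  · intro j
    exact (hG.1.inf aestronglyMeasurable_const).mul (((gk_continuous τ).comp (by fun_prop)).aestronglyMeasurable)
  · refine fun j => .of_forall fun y => ?_
    rw [norm_mul, Real.norm_of_nonneg (gk_nonneg hτ _), Real.norm_of_nonneg (le_min (h0 y) (by positivity))]
    exact mul_le_mul_of_nonneg_right (min_le_left _ _) (gk_nonneg hτ _)
  · refine .of_forall fun y => ?_
    refine tendsto_const_nhds.congr' ?_
    filter_upwards [eventually_ge_atTop ⌈f y⌉₊] with j hj
    rw [min_eq_left ((Nat.le_ceil _).trans (by exact_mod_cast hj))]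

lemma KC.min (hK : KC n f) (j : ℕ) : KC n (fun y => min (f y) (j:ℝ)) :=
  ⟨fun x => le_min (hK.1 x) (by positivity), fun x₁ x₂ h1 h2 => min_le_min_right _ (hK.2 x₁ x₂ h1 h2)⟩

lemma min_bdd (h0 : ∀ x, 0 ≤ f x) (j : ℕ) (x : Euc N) : |min (f x) (j:ℝ)| ≤ j := by
  rw [abs_of_nonneg (le_min (h0 x) (by positivity))]; exact min_le_right _ _

lemma KC_PP (hN : N = 2 * n) (hf : Continuous f) (hG : GInt f)
    (hK : KC n f) {T : ℝ} (hT : 0 < T) : KC n (PP T f) := by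
  refine ⟨PP_nonneg hT hK.1, fun x₁ x₂ hn hX => ?_⟩
  refine le_of_tendsto_of_tendsto' (PP_min_tendsto hT hG hK.1 x₁) (PP_min_tendsto hT hG hK.1 x₂) fun j => ?_
  exact (KC_PP_bdd hN (hf.min continuous_const) (min_bdd hK.1 j) (hK.min j) hT).2 x₁ x₂ hn hX

lemma gk_meas : Measurable (fun z : ℝ × Euc N => gk z.1 z.2) := by
  unfold gk; fun_prop

lemma gk1_meas : StronglyMeasurable (fun z : ℝ × Euc N => gk1 z.1 z.2) := by
  unfold gk1
  have h1 : Measurable fun z : ℝ × Euc N => -(1 / (2 * z.1)) * gk z.1 z.2 := by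
    have := gk_meas (N := N); fun_prop
  have h2 : Continuous fun z : ℝ × Euc N => innL z.2 := innL.continuous.comp continuous_snd
  exact h1.stronglyMeasurable.smul h2.stronglyMeasurable

lemma PP_meas (hf : Continuous f) : StronglyMeasurable (fun z : ℝ × Euc N => PP z.1 f z.2) := by
  have h : StronglyMeasurable (fun q : (ℝ × Euc N) × Euc N => f q.2 * gk q.1.1 (q.1.2 - q.2)) := by
    have h1 : Measurable (fun q : (ℝ × Euc N) × Euc N => (q.1.1, q.1.2 - q.2)) := by fun_prop
    have h2 : StronglyMeasurable fun q : (ℝ × Euc N) × Euc N => gk q.1.1 (q.1.2 - q.2) := (gk_meas.comp h1).stronglyMeasurable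
    exact ((hf.comp continuous_snd).stronglyMeasurable).mul h2
  exact h.integral_prod_right

lemma PP1_meas (hf : Continuous f) : StronglyMeasurable (fun z : ℝ × Euc N => PP1 z.1 f z.2) := by
  have h : StronglyMeasurable (fun q : (ℝ × Euc N) × Euc N => f q.2 • gk1 q.1.1 (q.1.2 - q.2)) := by
    have h1 : Measurable (fun q : (ℝ × Euc N) × Euc N => (q.1.1, q.1.2 - q.2)) := by fun_prop
    have h2 : StronglyMeasurable fun q : (ℝ × Euc N) × Euc N => gk1 q.1.1 (q.1.2 - q.2) := gk1_meas.comp_measurable h1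
    exact ((hf.comp continuous_snd).stronglyMeasurable).smul h2
  exact h.integral_prod_right

abbrev mu0 : Measure ℝ := volume.restrict (Ioi 0)

lemma ae_pos : ∀ᵐ τ ∂mu0, (0:ℝ) < τ := ae_restrict_mem measurableSet_Ioi

lemma wexp_int {a : ℝ} (ha : a < 1) : Integrable (fun τ : ℝ => rexp (-τ) * τ ^ (-a)) mu0 := by
  have := Real.GammaIntegral_convergent (s := 1 - a) (by linarith)
  simpa [IntegrableOn, sub_sub_cancel_left, show 1 - a - 1 = -a by ring] using this

section
variable {f : Euc N → ℝ} (hf : Continuous f) (hf2 : Integrable (fun x => f x ^ 2)) {w : ℝ → ℝ} (hw : Integrable w mu0)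
  (hw0 : ∀ τ, 0 < τ → 0 ≤ w τ) {c : ℝ} (hc : 0 < c)
include hf hf2 hw hw0 hc

lemma prodL2 : Integrable (fun z : ℝ × Euc N => w z.1 * PP (c * z.1) f z.2 ^ 2) (mu0.prod volume) := by
  have hm : StronglyMeasurable (fun z : ℝ × Euc N => PP (c * z.1) f z.2 ^ 2) := by
    have h1 : Measurable (fun z : ℝ × Euc N => (c * z.1, z.2)) := by fun_prop
    exact ((PP_meas hf).comp_measurable h1).pow 2
  have hM : AEStronglyMeasurable (fun z : ℝ × Euc N => w z.1 * PP (c * z.1) f z.2 ^ 2) (mu0.prod volume) :=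
    (hw.1.comp_fst).mul hm.aestronglyMeasurable
  rw [integrable_prod_iff hM]
  have hp : ∀ τ : ℝ, 0 < τ → Integrable (fun x => PP (c * τ) f x ^ 2) ∧ ∫ x, PP (c * τ) f x ^ 2 ≤ ∫ x, f x ^ 2 :=
    fun τ hτ => PP_l2 (by positivity) hf.aestronglyMeasurable hf2
  constructor
  · filter_upwards [ae_pos] with τ hτ
    exact (hp τ hτ).1.const_mul _
  · have hm2 : AEStronglyMeasurable (fun τ => ∫ x, ‖w τ * PP (c * τ) f x ^ 2‖) mu0 := by
      have : AEStronglyMeasurable (fun z : ℝ × Euc N => ‖w z.1 * PP (c * z.1) f z.2 ^ 2‖) (mu0.prod volume) :=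
        ((hw.1.comp_fst).mul hm.aestronglyMeasurable).norm
      exact this.integral_prod_right'
    refine (hw.mul_const (∫ x, f x ^ 2)).mono' hm2 ?_
    filter_upwards [ae_pos] with τ hτ
    have e : ∀ x, ‖w τ * PP (c * τ) f x ^ 2‖ = w τ * PP (c * τ) f x ^ 2 := fun x =>
      Real.norm_of_nonneg (mul_nonneg (hw0 τ hτ) (sq_nonneg _))
    simp only [e]
    rw [integral_const_mul, Real.norm_of_nonneg (mul_nonneg (hw0 τ hτ) (integral_nonneg fun x => sq_nonneg _))]
    exact mul_le_mul_of_nonneg_left (hp τ hτ).2 (hw0 τ hτ)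

lemma prodMul {g : Euc N → ℝ} (hg : AEStronglyMeasurable g volume) (hg2 : Integrable (fun x => g x ^ 2)) :
    Integrable (fun z : ℝ × Euc N => w z.1 * (PP (c * z.1) f z.2 * g z.2)) (mu0.prod volume) := by
  have hm : StronglyMeasurable (fun z : ℝ × Euc N => PP (c * z.1) f z.2) := by
    have h1 : Measurable (fun z : ℝ × Euc N => (c * z.1, z.2)) := by fun_prop
    exact ((PP_meas hf).comp_measurable h1)
  refine ((prodL2 hf hf2 hw hw0 hc).add (hw.mul_prod hg2)).mono' ((hw.1.comp_fst).mul (hm.aestronglyMeasurable.mul hg.comp_snd)) ?_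
  have h0 : ∀ᵐ z : ℝ × Euc N ∂(mu0.prod volume), 0 < z.1 := Measure.quasiMeasurePreserving_fst.ae ae_pos
  filter_upwards [h0] with z hz
  simp only [Pi.add_apply, Real.norm_eq_abs, abs_mul, abs_of_nonneg (hw0 _ hz)]
  rw [← mul_add]
  refine mul_le_mul_of_nonneg_left ?_ (hw0 _ hz)
  nlinarith [sq_abs (PP (c * z.1) f z.2), sq_abs (g z.2), sq_nonneg (|PP (c * z.1) f z.2| - |g z.2|), sq_nonneg (PP (c * z.1) f z.2), sq_nonneg (g z.2)]

lemma VL2 : Integrable (fun x => (∫ τ, w τ * PP (c * τ) f x ∂mu0) ^ 2) := by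
  have hP := prodL2 hf hf2 hw hw0 hc
  have hm : StronglyMeasurable (fun z : ℝ × Euc N => PP (c * z.1) f z.2) := by
    have h1 : Measurable (fun z : ℝ × Euc N => (c * z.1, z.2)) := by fun_prop
    exact ((PP_meas hf).comp_measurable h1)
  have hVm : AEStronglyMeasurable (fun x => (∫ τ, w τ * PP (c * τ) f x ∂mu0)) volume := by
    have : AEStronglyMeasurable (fun z : ℝ × Euc N => w z.1 * PP (c * z.1) f z.2) (mu0.prod volume) :=
      (hw.1.comp_fst).mul hm.aestronglyMeasurable
    exact this.prod_swap.integral_prod_right'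
  refine (hP.swap.integral_prod_left.const_mul (∫ τ, w τ ∂mu0)).mono' (hVm.pow 2) ?_
  filter_upwards [hP.swap.prod_right_ae] with x hx
  simp only [Function.comp_apply, Prod.swap_prod_mk] at hx
  rw [Real.norm_of_nonneg (sq_nonneg _)]
  simp only [Function.comp_apply, Prod.swap_prod_mk]
  have e1 : ∫ τ, w τ ∂mu0 = ∫ τ, (√(w τ)) ^ 2 ∂mu0 := integral_congr_ae (by
    filter_upwards [ae_pos] with τ hτ; rw [Real.sq_sqrt (hw0 τ hτ)])
  have e2 : ∫ τ, w τ * PP (c * τ) f x ^ 2 ∂mu0 = ∫ τ, (√(w τ) * PP (c * τ) f x) ^ 2 ∂mu0 := integral_congr_ae (by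
    filter_upwards [ae_pos] with τ hτ; rw [mul_pow, Real.sq_sqrt (hw0 τ hτ)])
  have e3 : ∫ τ, w τ * PP (c * τ) f x ∂mu0 = ∫ τ, √(w τ) * (√(w τ) * PP (c * τ) f x) ∂mu0 := integral_congr_ae (by
    filter_upwards [ae_pos] with τ hτ; rw [← mul_assoc, Real.mul_self_sqrt (hw0 τ hτ)])
  have hs : AEStronglyMeasurable (fun τ => √(w τ)) mu0 := hw.1.aemeasurable.sqrt.aestronglyMeasurable
  have hPm : AEStronglyMeasurable (fun τ => PP (c * τ) f x) mu0 :=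
    ((PP_meas hf).comp_measurable (g := fun τ : ℝ => (c * τ, x)) (by fun_prop)).aestronglyMeasurable
  rw [e1, e2, e3]
  refine cs_sq hs (hs.mul hPm) ?_ ?_
  · refine hw.congr ?_
    filter_upwards [ae_pos] with τ hτ; rw [Real.sq_sqrt (hw0 τ hτ)]
  · refine hx.congr ?_
    filter_upwards [ae_pos] with τ hτ; rw [mul_pow, Real.sq_sqrt (hw0 τ hτ)]
end

structure RG (f : Euc N → ℝ) (Q : ℝ) : Prop where
  cont : Continuous f
  nn : ∀ x, 0 ≤ f x
  sq : Integrable (fun x => f x ^ 2)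
  sup : ∀ τ : ℝ, 0 < τ → ∀ x, PP τ f x ≤ Q * τ ^ (-(1 / 4) : ℝ)

def TT (f : Euc N → ℝ) (x : Euc N) : ℝ := ∫ τ, rexp (-τ) * PP τ f x ∂mu0
def TT1 (f : Euc N → ℝ) (x : Euc N) : Euc N →L[ℝ] ℝ := ∫ τ, rexp (-τ) • PP1 τ f x ∂mu0
def wI (a : ℝ) : ℝ := ∫ τ, rexp (-τ) * τ ^ (-a) ∂mu0

lemma wI_nonneg (a : ℝ) : 0 ≤ wI a := integral_nonneg_of_ae (by
  filter_upwards [ae_pos] with τ hτ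
  have := rpow_nonneg hτ.le (-a)
  simp only [Pi.zero_apply]
  positivity)

lemma RG.gint (h : RG f Q) : GInt f := GInt.of_sq h.cont.aestronglyMeasurable h.sq

lemma RG.Q0 (h : RG f Q) : 0 ≤ Q := by
  have := h.sup 1 one_pos 0
  have := PP_nonneg one_pos h.nn (0 : Euc N)
  simp at *
  linarith

lemma tmeas (hf : Continuous f) (x : Euc N) : AEStronglyMeasurable (fun τ => rexp (-τ) * PP τ f x) mu0 := by
  have h1 : Continuous fun τ : ℝ => rexp (-τ) := by fun_prop
  exact h1.aestronglyMeasurable.mul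
    ((PP_meas hf).comp_measurable (g := fun τ : ℝ => (τ, x)) (by fun_prop)).aestronglyMeasurable

lemma tmeas1 (hf : Continuous f) (x : Euc N) : AEStronglyMeasurable (fun τ => rexp (-τ) • PP1 τ f x) mu0 := by
  have h1 : Continuous fun τ : ℝ => rexp (-τ) := by fun_prop
  exact h1.aestronglyMeasurable.smul
    ((PP1_meas hf).comp_measurable (g := fun τ : ℝ => (τ, x)) (by fun_prop)).aestronglyMeasurable

lemma tint (hf : Continuous f) (h0 : ∀ x, 0 ≤ f x) {Q a : ℝ} (ha : a < 1) {x : Euc N}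
    (h : ∀ τ : ℝ, 0 < τ → PP τ f x ≤ Q * τ ^ (-a)) :
    Integrable (fun τ => rexp (-τ) * PP τ f x) mu0 ∧ TT f x ≤ Q * wI a := by
  have hi : Integrable (fun τ => rexp (-τ) * PP τ f x) mu0 := by
    refine ((wexp_int ha).const_mul Q).mono' (tmeas hf x) ?_
    filter_upwards [ae_pos] with τ hτ
    rw [Real.norm_of_nonneg (mul_nonneg (exp_pos _).le (PP_nonneg hτ h0 x))]
    have := mul_le_mul_of_nonneg_left (h τ hτ) (exp_pos (-τ)).le
    linarith
  refine ⟨hi, ?_⟩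
  unfold TT wI
  rw [← integral_const_mul]
  refine integral_mono_ae hi ((wexp_int ha).const_mul Q) ?_
  filter_upwards [ae_pos] with τ hτ
  have := mul_le_mul_of_nonneg_left (h τ hτ) (exp_pos (-τ)).le
  linarith

lemma TT_nonneg (h0 : ∀ x, 0 ≤ f x) (x : Euc N) : 0 ≤ TT f x :=
  integral_nonneg_of_ae (by
    filter_upwards [ae_pos] with τ hτ
    exact mul_nonneg (exp_pos _).le (PP_nonneg hτ h0 x))

lemma RG.tint (h : RG f Q) (x : Euc N) :
    Integrable (fun τ => rexp (-τ) * PP τ f x) mu0 := (_root_.tint h.cont h.nn (by norm_num) fun τ hτ => h.sup τ hτ x).1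

lemma RG_PP1 : ∃ C : ℝ, 0 < C ∧ ∀ (f : Euc N → ℝ) (Q : ℝ), RG f Q → ∀ τ, 0 < τ → ∀ x,
    ‖PP1 τ f x‖ ≤ C * τ ^ (-(1 / 2) : ℝ) * PP (2 * τ) f x ∧ ‖rexp (-τ) • PP1 τ f x‖ ≤ (C * Q) * (rexp (-τ) * τ ^ (-(3 / 4) : ℝ)) := by
  obtain ⟨C, hC, h⟩ := PP1_bound (N := N)
  refine ⟨C, hC, fun f Q hf τ hτ x => ?_⟩
  have h1 := h τ hτ f hf.gint x
  have e : (fun y => |f y|) = f := by ext y; exact abs_of_nonneg (hf.nn y)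
  rw [e] at h1
  refine ⟨h1, ?_⟩
  rw [norm_smul, Real.norm_of_nonneg (exp_pos _).le]
  have h2 := hf.sup (2 * τ) (by positivity) x
  have h3 : (2 * τ) ^ (-(1 / 4) : ℝ) ≤ τ ^ (-(1 / 4) : ℝ) :=
    rpow_le_rpow_of_nonpos hτ (by linarith) (by norm_num)
  have h4 : τ ^ (-(1 / 2) : ℝ) * τ ^ (-(1 / 4) : ℝ) = τ ^ (-(3 / 4) : ℝ) := by
    rw [← rpow_add hτ]; norm_num
  have h5 : PP (2 * τ) f x ≤ Q * τ ^ (-(1 / 4) : ℝ) := h2.trans (mul_le_mul_of_nonneg_left h3 hf.Q0)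
  have h6 : ‖PP1 τ f x‖ ≤ C * Q * τ ^ (-(3 / 4) : ℝ) := by
    refine h1.trans ?_
    rw [← h4]
    have : 0 ≤ C * τ ^ (-(1 / 2) : ℝ) := by positivity
    nlinarith [mul_le_mul_of_nonneg_left h5 this]
  nlinarith [mul_le_mul_of_nonneg_left h6 (exp_pos (-τ)).le]

lemma RG.tint1 (h : RG f Q) (x : Euc N) :
    Integrable (fun τ => rexp (-τ) • PP1 τ f x) mu0 := by
  obtain ⟨C, hC, hb⟩ := RG_PP1 (N := N)
  refine ((wexp_int (a := 3 / 4) (by norm_num)).const_mul (C * Q)).mono' (tmeas1 h.cont x) ?_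
  filter_upwards [ae_pos] with τ hτ
  exact (hb f Q h τ hτ x).2

lemma TT1_bound : ∃ C : ℝ, 0 < C ∧ ∀ (f : Euc N → ℝ) (Q : ℝ), RG f Q → ∀ x, ‖TT1 f x‖ ≤ C * Q := by
  obtain ⟨C, hC, hb⟩ := RG_PP1 (N := N)
  refine ⟨C * (wI (3/4) + 1), by have := wI_nonneg (3/4); positivity, fun f Q hf x => ?_⟩
  have h1 : ‖TT1 f x‖ ≤ ∫ τ, (C * Q) * (rexp (-τ) * τ ^ (-(3 / 4) : ℝ)) ∂mu0 := by
    refine norm_integral_le_of_norm_le ((wexp_int (by norm_num)).const_mul _) ?_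
    filter_upwards [ae_pos] with τ hτ
    exact (hb f Q hf τ hτ x).2
  rw [integral_const_mul] at h1
  change _ ≤ C * Q * wI (3/4) at h1
  have := mul_nonneg hC.le hf.Q0
  nlinarith

lemma TT_hasFDerivAt (h : RG f Q) (x : Euc N) : HasFDerivAt (TT f) (TT1 f x) x := by
  obtain ⟨C, hC, hb⟩ := RG_PP1 (N := N)
  refine hasFDerivAt_integral_of_dominated_of_fderiv_le (F' := fun x τ => rexp (-τ) • PP1 τ f x) (s := univ)
    (bound := fun τ => (C * Q) * (rexp (-τ) * τ ^ (-(3 / 4) : ℝ))) univ_mem (.of_forall fun x => tmeas h.cont x)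
    (h.tint x) (tmeas1 h.cont x) ?_ ((wexp_int (by norm_num)).const_mul _) ?_
  · filter_upwards [ae_pos] with τ hτ y _
    exact (hb f Q h τ hτ y).2
  · filter_upwards [ae_pos] with τ hτ y _
    exact (PP_hasFDerivAt hτ h.gint y).const_smul (rexp (-τ))

lemma norm_grad (u : Euc N → ℝ) (x : Euc N) : ‖gradient u x‖ = ‖fderiv ℝ u x‖ := by
  unfold gradient; exact LinearIsometryEquiv.norm_map _ _

lemma inner_grad (u : Euc N → ℝ) (x v : Euc N) : inner ℝ (gradient u x) v = fderiv ℝ u x v := by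
  unfold gradient; exact InnerProductSpace.toDual_symm_apply

lemma TT_fderiv (h : RG f Q) (x : Euc N) : fderiv ℝ (TT f) x = TT1 f x := (TT_hasFDerivAt h x).fderiv

lemma TT_MemH1 (h : RG f Q) : MemH1 (TT f) := by
  obtain ⟨C, hC, hb⟩ := RG_PP1 (N := N)
  have hd : Differentiable ℝ (TT f) := fun x => (TT_hasFDerivAt h x).differentiableAt
  refine ⟨hd.continuous, hd, ?_, ?_⟩
  · have hm : Measurable (fderiv ℝ (TT f)) := measurable_fderiv ℝ _
    simp only [norm_grad]
    have hw := wexp_int (a := 1/2) (by norm_num)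
    have hV := VL2 h.cont h.sq (hw.const_mul C) (fun τ hτ => by have := rpow_nonneg hτ.le (-(1/2):ℝ); positivity) (two_pos)
    have hV1 := prodL2 h.cont h.sq (hw.const_mul C) (fun τ hτ => by have := rpow_nonneg hτ.le (-(1/2):ℝ); positivity) (two_pos)
    refine hV.mono' (hm.norm.pow_const 2).aestronglyMeasurable ?_
    refine .of_forall fun x => ?_
    rw [Real.norm_of_nonneg (sq_nonneg _), TT_fderiv h]
    refine pow_le_pow_left₀ (norm_nonneg _) ?_ 2
    refine norm_integral_le_of_norm_le ?_ ?_
    · refine ((wexp_int (a := 3/4) (by norm_num)).const_mul (C * Q)).mono' ?_ ?_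
      · exact (hw.const_mul C).1.mul 
          ((PP_meas h.cont).comp_measurable (g := fun τ : ℝ => (2 * τ, x)) (by fun_prop)).aestronglyMeasurable
      · filter_upwards [ae_pos] with τ hτ
        rw [Real.norm_of_nonneg (by have := PP_nonneg (τ := 2 * τ) (by positivity) h.nn x; positivity)]
        have h2 := h.sup (2 * τ) (by positivity) x
        have h3 : (2 * τ) ^ (-(1 / 4) : ℝ) ≤ τ ^ (-(1 / 4) : ℝ) :=
          rpow_le_rpow_of_nonpos hτ (by linarith) (by norm_num)
        have h4 : τ ^ (-(1 / 2) : ℝ) * τ ^ (-(1 / 4) : ℝ) = τ ^ (-(3 / 4) : ℝ) := by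
          rw [← rpow_add hτ]; norm_num
        have h5 : PP (2 * τ) f x ≤ Q * τ ^ (-(1 / 4) : ℝ) := h2.trans (mul_le_mul_of_nonneg_left h3 h.Q0)
        rw [← h4]
        have : 0 ≤ C * (rexp (-τ) * τ ^ (-(1 / 2) : ℝ)) := by positivity
        nlinarith [mul_le_mul_of_nonneg_left h5 this]
    · filter_upwards [ae_pos] with τ hτ
      rw [norm_smul, Real.norm_of_nonneg (exp_pos _).le]
      have := mul_le_mul_of_nonneg_left (hb f Q h τ hτ x).1 (exp_pos (-τ)).le
      linarith
  · have hw := wexp_int (a := 0) (by norm_num)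
    have hV := VL2 h.cont h.sq hw (fun τ hτ => by have := rpow_nonneg hτ.le (-0:ℝ); positivity) (one_pos)
    simpa [TT] using hV

lemma TT_KC (hN : N = 2 * n) (h : RG f Q) (hK : KC n f) : KC n (TT f) := by
  refine ⟨TT_nonneg h.nn, fun x₁ x₂ h1 h2 => ?_⟩
  refine integral_mono_ae (h.tint x₁) (h.tint x₂) ?_
  filter_upwards [ae_pos] with τ hτ
  exact mul_le_mul_of_nonneg_left ((KC_PP hN h.cont h.gint hK hτ).2 x₁ x₂ h1 h2) (exp_pos _).le

lemma MemH1.aesm {φ : Euc N → ℝ} (h : MemH1 φ) : AEStronglyMeasurable φ volume := h.1.aestronglyMeasurable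
lemma meas_fderiv_apply (φ : Euc N → ℝ) (v : Euc N) : AEStronglyMeasurable (fun x => fderiv ℝ φ x v) volume :=
  (measurable_fderiv_apply_const ℝ φ v).aestronglyMeasurable
lemma meas_grad (φ : Euc N → ℝ) : Measurable (gradient φ) := by
  unfold gradient
  exact (LinearIsometryEquiv.continuous _).measurable.comp (measurable_fderiv ℝ φ)
lemma meas_ngrad (φ : Euc N → ℝ) : AEStronglyMeasurable (fun x => ‖gradient φ x‖) volume :=
  (meas_grad φ).norm.aestronglyMeasurable
lemma MemH1.dsq {φ : Euc N → ℝ} (h : MemH1 φ) (i : Fin N) : Integrable (fun x => fderiv ℝ φ x (EuclideanSpace.single i 1) ^ 2) := by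
  refine h.2.2.1.mono' ((meas_fderiv_apply φ _).pow 2) (.of_forall fun x => ?_)
  rw [Real.norm_of_nonneg (sq_nonneg _), norm_grad, ← sq_abs]
  refine pow_le_pow_left₀ (abs_nonneg _) ?_ 2
  simpa using (fderiv ℝ φ x).le_opNorm (EuclideanSpace.single i 1)

section
variable {f : Euc N → ℝ} (hf : Continuous f) (h0 : ∀ x, 0 ≤ f x) (hf2 : Integrable (fun x => f x ^ 2))
include hf h0 hf2

lemma PP2_sq (hτ : 0 < τ) (v : Euc N) : Integrable (fun x => PP2 τ f x v v ^ 2) := by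
  obtain ⟨C, hC, hb⟩ := PP2_bound (N := N)
  have hG := GInt.of_sq hf.aestronglyMeasurable hf2
  have e : (fun y => |f y|) = f := by ext y; exact abs_of_nonneg (h0 y)
  have h2 := (PP_l2 (τ := 2 * τ) (by positivity) hf.aestronglyMeasurable hf2).1
  have hc : Continuous fun x => PP2 τ f x v v := ((PP2_continuous hτ hG).clm_apply continuous_const).clm_apply continuous_const
  refine (h2.const_mul ((C * τ ^ (-1:ℝ) * ‖v‖ * ‖v‖) ^ 2)).mono' (hc.pow 2).aestronglyMeasurable (.of_forall fun x => ?_)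
  rw [Real.norm_of_nonneg (sq_nonneg _), ← sq_abs, ← mul_pow]
  refine pow_le_pow_left₀ (abs_nonneg _) ?_ 2
  have h3 := hb τ hτ f hG x
  rw [e] at h3
  have h4 := (PP2 τ f x).le_opNorm₂ v v
  rw [Real.norm_eq_abs] at h4
  refine h4.trans ?_
  calc _ ≤ (C * τ ^ (-1:ℝ) * PP (2 * τ) f x) * ‖v‖ * ‖v‖ := by gcongr
    _ = _ := by ring

lemma PP1_sq (hτ : 0 < τ) (v : Euc N) : Integrable (fun x => PP1 τ f x v ^ 2) := by
  obtain ⟨C, hC, hb⟩ := PP1_bound (N := N)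
  have hG := GInt.of_sq hf.aestronglyMeasurable hf2
  have e : (fun y => |f y|) = f := by ext y; exact abs_of_nonneg (h0 y)
  have h2 := (PP_l2 (τ := 2 * τ) (by positivity) hf.aestronglyMeasurable hf2).1
  have hc : Continuous fun x => PP1 τ f x v := (PP1_continuous hτ hG).clm_apply continuous_const
  refine (h2.const_mul ((C * τ ^ (-(1/2):ℝ) * ‖v‖) ^ 2)).mono' (hc.pow 2).aestronglyMeasurable (.of_forall fun x => ?_)
  rw [Real.norm_of_nonneg (sq_nonneg _), ← sq_abs, ← mul_pow]
  refine pow_le_pow_left₀ (abs_nonneg _) ?_ 2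
  have h3 := hb τ hτ f hG x
  rw [e] at h3
  have h4 := (PP1 τ f x).le_opNorm v
  rw [Real.norm_eq_abs] at h4
  refine h4.trans ?_
  calc _ ≤ (C * τ ^ (-(1/2):ℝ) * PP (2 * τ) f x) * ‖v‖ := by gcongr
    _ = _ := by ring

lemma PP_ibp (hτ : 0 < τ) {φ : Euc N → ℝ} (hφ : MemH1 φ) :
    ∫ x, trH (PP2 τ f x) * φ x = - ∫ x, PP1 τ f x (gradient φ x) := by
  have hG := GInt.of_sq hf.aestronglyMeasurable hf2
  let e : Fin N → Euc N := fun i => EuclideanSpace.single i 1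
  have hd : ∀ i x, HasFDerivAt (fun x => PP1 τ f x (e i)) ((PP2 τ f x).flip (e i)) x := by
    intro i x
    refine ((PP1_hasFDerivAt hτ hG x).clm_apply (hasFDerivAt_const (e i) x)).congr_fderiv ?_
    ext v; simp
  have hfd : ∀ i x, fderiv ℝ (fun x => PP1 τ f x (e i)) x (e i) = PP2 τ f x (e i) (e i) := by
    intro i x; rw [(hd i x).fderiv]; rfl
  have m1 : ∀ i, AEStronglyMeasurable (fun x => PP1 τ f x (e i)) volume := fun i =>
    ((PP1_continuous hτ hG).clm_apply continuous_const).aestronglyMeasurable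
  have m2 : ∀ i, AEStronglyMeasurable (fun x => PP2 τ f x (e i) (e i)) volume := fun i =>
    (((PP2_continuous hτ hG).clm_apply continuous_const).clm_apply continuous_const).aestronglyMeasurable
  have i1 : ∀ i, Integrable (fun x => fderiv ℝ φ x (e i) * PP1 τ f x (e i)) := fun i =>
    int_mul_of_sq (meas_fderiv_apply φ _) (m1 i) (hφ.dsq i) (PP1_sq hf h0 hf2 hτ _)
  have i2 : ∀ i, Integrable (fun x => φ x * PP2 τ f x (e i) (e i)) := fun i =>
    int_mul_of_sq hφ.aesm (m2 i) hφ.2.2.2 (PP2_sq hf h0 hf2 hτ _)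
  have i3 : ∀ i, Integrable (fun x => φ x * PP1 τ f x (e i)) := fun i =>
    int_mul_of_sq hφ.aesm (m1 i) hφ.2.2.2 (PP1_sq hf h0 hf2 hτ _)
  have key : ∀ i, ∫ x, φ x * PP2 τ f x (e i) (e i) = - ∫ x, fderiv ℝ φ x (e i) * PP1 τ f x (e i) := by
    intro i
    have := integral_mul_fderiv_eq_neg_fderiv_mul_of_integrable (μ := (volume : Measure (Euc N))) (f := φ)
      (g := fun x => PP1 τ f x (e i)) (v := e i) (i1 i) (by simpa only [hfd] using i2 i) (i3 i) (fun x _ => hφ.2.1 x)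
      (fun x _ => (hd i x).differentiableAt)
    simpa only [hfd] using this
  have s1 : ∀ x, trH (PP2 τ f x) * φ x = ∑ i, φ x * PP2 τ f x (e i) (e i) := by
    intro x; rw [trH, Finset.sum_mul]; exact Finset.sum_congr rfl fun i _ => mul_comm _ _
  have s2 : ∀ x, PP1 τ f x (gradient φ x) = ∑ i, fderiv ℝ φ x (e i) * PP1 τ f x (e i) := by
    intro x
    conv_lhs => rw [← euc_sum (gradient φ x)]
    rw [map_sum]
    refine Finset.sum_congr rfl fun i _ => ?_
    have h3 : fderiv ℝ φ x (e i) = (gradient φ x) i := by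
      rw [← inner_grad]; simp only [e]; rw [EuclideanSpace.inner_single_right]; simp
    rw [map_smul, smul_eq_mul, h3]
  simp only [s1, s2]
  rw [integral_finsetSum _ fun i _ => i2 i, integral_finsetSum _ fun i _ => i1 i, ← Finset.sum_neg_distrib]
  exact Finset.sum_congr rfl fun i _ => key i

lemma h_deriv (hτ : 0 < τ) {φ : Euc N → ℝ} (hφ : MemH1 φ) :
    HasDerivAt (fun τ => ∫ x, PP τ f x * φ x) (- ∫ x, PP1 τ f x (gradient φ x)) τ := by
  rw [← PP_ibp hf h0 hf2 hτ hφ]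
  have hG := GInt.of_sq hf.aestronglyMeasurable hf2
  have e : (fun y => |f y|) = f := by ext y; exact abs_of_nonneg (h0 y)
  obtain ⟨C, hC, hb⟩ := PP2_bound (N := N)
  have trb : ∀ A : Euc N →L[ℝ] Euc N →L[ℝ] ℝ, |trH A| ≤ N * ‖A‖ := by
    intro A
    unfold trH
    refine (Finset.abs_sum_le_sum_abs _ _).trans ?_
    refine (Finset.sum_le_sum (g := fun _ => ‖A‖) fun i _ => ?_).trans (by simp)
    have := A.le_opNorm₂ (EuclideanSpace.single i 1) (EuclideanSpace.single i 1)
    simpa using this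
  have hcomp : ∀ σ ∈ Ioo (τ/2) (2*τ), ∀ x, PP (2 * σ) f x ≤ 4 ^ ((N:ℝ)/2) * PP (4 * τ) f x := by
    intro σ hσ x
    have hσ0 : 0 < σ := by linarith [hσ.1]
    unfold PP
    rw [← integral_const_mul]
    refine integral_mono (hG.2 _ (by positivity) x) ((hG.2 _ (by positivity) x).const_mul _) fun y => ?_
    have h1 := gk_le (N := N) (show 0 < 2 * σ by positivity) (show 2 * σ ≤ 4 * τ by linarith [hσ.2]) (x - y)
    have h2 : (4 * τ / (2 * σ)) ^ ((N:ℝ)/2) ≤ 4 ^ ((N:ℝ)/2) := by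
      refine rpow_le_rpow (by positivity) ?_ (by positivity)
      rw [div_le_iff₀ (by positivity)]; linarith [hσ.1]
    have h3 : gk (2 * σ) (x - y) ≤ 4 ^ ((N:ℝ)/2) * gk (4 * τ) (x - y) :=
      h1.trans (mul_le_mul_of_nonneg_right h2 (gk_nonneg (by positivity) _))
    have := mul_le_mul_of_nonneg_left h3 (h0 y)
    simp only; linarith
  have mPP : ∀ σ, 0 < σ → AEStronglyMeasurable (fun x => PP σ f x * φ x) volume := fun σ hσ =>
    ((PP_continuous hσ hG).mul hφ.1).aestronglyMeasurable
  have hI : ∀ σ, 0 < σ → Integrable (fun x => PP σ f x * φ x) := fun σ hσ =>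
    int_mul_of_sq (PP_continuous hσ hG).aestronglyMeasurable hφ.aesm (PP_l2 hσ hf.aestronglyMeasurable hf2).1 hφ.2.2.2
  have hnhd : Ioo (τ/2) (2*τ) ∈ nhds τ := Ioo_mem_nhds (by linarith) (by linarith)
  refine (hasDerivAt_integral_of_dominated_loc_of_deriv_le (s := Ioo (τ/2) (2*τ)) (F' := fun τ x => trH (PP2 τ f x) * φ x)
    (bound := fun x => (N * (C * (τ/2) ^ (-1:ℝ) * 4 ^ ((N:ℝ)/2))) * |PP (4 * τ) f x * φ x|) hnhd ?_ (hI τ hτ) ?_ ?_ ?_ ?_).2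
  · filter_upwards [hnhd] with σ hσ
    exact mPP σ (by linarith [hσ.1])
  · have : Continuous fun x => trH (PP2 τ f x) := by
      unfold trH
      exact continuous_finsetSum _ fun i _ => ((PP2_continuous hτ hG).clm_apply continuous_const).clm_apply continuous_const
    exact (this.mul hφ.1).aestronglyMeasurable
  · refine .of_forall fun x σ hσ => ?_
    have hσ0 : 0 < σ := by linarith [hσ.1]
    have h1 := hb σ hσ0 f hG x
    rw [e] at h1
    have h2 : σ ^ (-1:ℝ) ≤ (τ/2) ^ (-1:ℝ) := rpow_le_rpow_of_nonpos (by positivity) hσ.1.le (by norm_num)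
    have h3 := hcomp σ hσ x
    have h4 := PP_nonneg (τ := 2 * σ) (by positivity) h0 x
    have h5 := PP_nonneg (τ := 4 * τ) (by positivity) h0 x
    rw [norm_mul, abs_mul, abs_of_nonneg h5, Real.norm_eq_abs, Real.norm_eq_abs]
    have h6 : |trH (PP2 σ f x)| ≤ (N * (C * (τ/2) ^ (-1:ℝ) * 4 ^ ((N:ℝ)/2))) * PP (4 * τ) f x := by
      refine (trb _).trans ?_
      calc (N:ℝ) * ‖PP2 σ f x‖ ≤ N * (C * σ ^ (-1:ℝ) * PP (2 * σ) f x) := by gcongr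
        _ ≤ N * (C * (τ/2) ^ (-1:ℝ) * (4 ^ ((N:ℝ)/2) * PP (4 * τ) f x)) := by gcongr
        _ = _ := by ring
    calc _ ≤ ((N * (C * (τ/2) ^ (-1:ℝ) * 4 ^ ((N:ℝ)/2))) * PP (4 * τ) f x) * |φ x| := by gcongr
      _ = _ := by ring
  · exact (hI (4 * τ) (by positivity)).abs.const_mul _
  · refine .of_forall fun x σ hσ => ?_
    have hσ0 : 0 < σ := by linarith [hσ.1]
    exact (PP_hasDerivAt_time hσ0 hG x).mul_const (φ x)

lemma PP_l2_tendsto : Tendsto (fun τ => ∫ x, (PP τ f x - f x) ^ 2) (nhdsWithin 0 (Ioi 0)) (nhds 0) := by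
  have hG := GInt.of_sq hf.aestronglyMeasurable hf2
  have hfm := hf.aestronglyMeasurable (μ := (volume : Measure (Euc N)))
  have h1 : ∀ τ, 0 < τ → ∫ x, (PP τ f x - f x) ^ 2 ≤ 2 * (∫ x, f x ^ 2) - 2 * ∫ x, PP τ f x * f x := by
    intro τ hτ
    have hc := (PP_continuous hτ hG).aestronglyMeasurable (μ := (volume : Measure (Euc N)))
    obtain ⟨a, b⟩ := PP_l2 hτ hfm hf2
    have e : ∀ x, (PP τ f x - f x) ^ 2 = PP τ f x ^ 2 + f x ^ 2 - 2 * (PP τ f x * f x) := fun x => by ring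
    simp only [e]
    rw [integral_sub (iadd a hf2) ((int_mul_of_sq hc hfm a hf2).const_mul 2), integral_add a hf2, integral_const_mul]
    linarith
  let g : ℕ → Euc N → ℝ := fun j x => min (f x) (j:ℝ)
  let G : ℕ → Euc N → ℝ := fun j => (Metric.closedBall (0 : Euc N) j).indicator (g j)
  have hGm : ∀ j, AEStronglyMeasurable (G j) volume := fun j =>
    ((hf.min continuous_const).aestronglyMeasurable).indicator measurableSet_closedBall
  have hgn : ∀ j x, 0 ≤ g j x := fun j x => le_min (h0 x) (by positivity)
  have hGn : ∀ j x, 0 ≤ G j x := fun j x => indicator_nonneg (fun y _ => hgn j y) x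
  have hGg : ∀ j x, G j x ≤ g j x := fun j x => indicator_le_self' (fun y _ => hgn j y) x
  have hgf : ∀ j x, g j x ≤ f x := fun j x => min_le_left _ _
  have hgj : ∀ j x, |g j x| ≤ j := fun j x => min_bdd h0 j x
  have hgl : ∀ x, ∀ᶠ j in atTop, G j x = f x := by
    intro x
    filter_upwards [eventually_ge_atTop ⌈f x⌉₊, eventually_ge_atTop ⌈‖x‖⌉₊] with j hj hj2
    have a : f x ≤ j := (Nat.le_ceil _).trans (by exact_mod_cast hj)
    have b : ‖x‖ ≤ j := (Nat.le_ceil _).trans (by exact_mod_cast hj2)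
    simp only [G]
    rw [indicator_of_mem (by simpa using b)]
    exact min_eq_left a
  have hGint : ∀ j, Integrable (G j) := by
    intro j
    refine (integrable_indicator_iff measurableSet_closedBall).2 ?_
    exact (hf.min continuous_const).continuousOn.integrableOn_compact (isCompact_closedBall _ _)
  have hj : Tendsto (fun j => ∫ x, g j x * G j x) atTop (nhds (∫ x, f x ^ 2)) := by
    refine tendsto_integral_of_dominated_convergence (fun x => f x ^ 2) (fun j => (hf.min continuous_const).aestronglyMeasurable.mul (hGm j)) hf2 ?_ ?_
    · refine fun j => .of_forall fun x => ?_
      rw [Real.norm_of_nonneg (mul_nonneg (hgn j x) (hGn j x)), sq]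
      exact mul_le_mul (hgf j x) ((hGg j x).trans (hgf j x)) (hGn j x) (h0 x)
    · refine .of_forall fun x => ?_
      refine tendsto_const_nhds.congr' ?_
      filter_upwards [hgl x] with j hj
      have : g j x = f x := le_antisymm (hgf j x) (hj ▸ hGg j x)
      rw [hj, this, sq]
  have ht : ∀ j, Tendsto (fun τ => ∫ x, PP τ (g j) x * G j x) (nhdsWithin 0 (Ioi 0)) (nhds (∫ x, g j x * G j x)) := by
    intro j
    have hgG : GInt (g j) := GInt.of_bdd (hf.min continuous_const).aestronglyMeasurable (hgj j)
    refine tendsto_integral_filter_of_dominated_convergence (fun x => j * G j x) ?_ ?_ ((hGint j).const_mul _) ?_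
    · filter_upwards [self_mem_nhdsWithin] with τ hτ
      exact (PP_continuous hτ hgG).aestronglyMeasurable.mul (hGm j)
    · filter_upwards [self_mem_nhdsWithin] with τ hτ
      refine .of_forall fun x => ?_
      rw [norm_mul, Real.norm_of_nonneg (hGn j x)]
      exact mul_le_mul_of_nonneg_right ((PP_abs_le hτ x).trans (PP_bdd hτ hgG.1 (hgj j) x)) (hGn j x)
    · refine .of_forall fun x => ?_
      exact (PP_tendsto (hf.min continuous_const) (hgj j) x).mul_const _
  have hle : ∀ j τ, 0 < τ → ∫ x, PP τ (g j) x * G j x ≤ ∫ x, PP τ f x * f x := by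
    intro j τ hτ
    have hgG : GInt (g j) := GInt.of_bdd (hf.min continuous_const).aestronglyMeasurable (hgj j)
    have hc := (PP_continuous hτ hG).aestronglyMeasurable (μ := (volume : Measure (Euc N)))
    refine integral_mono_of_nonneg (.of_forall fun x => mul_nonneg (PP_nonneg hτ (hgn j) x) (hGn j x))
      (int_mul_of_sq hc hfm (PP_l2 hτ hfm hf2).1 hf2) (.of_forall fun x => ?_)
    exact mul_le_mul (PP_mono hτ hgG hG (hgf j) x) ((hGg j x).trans (hgf j x)) (hGn j x) (PP_nonneg hτ h0 x)
  rw [Metric.tendsto_nhds]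
  intro ε hε
  obtain ⟨j, hj'⟩ := ((hj.eventually_const_lt (show (∫ x, f x ^ 2) - ε / 4 < ∫ x, f x ^ 2 by linarith))).exists
  have := (ht j).eventually_const_lt (show (∫ x, g j x * G j x) - ε / 4 < _ by linarith)
  filter_upwards [this, self_mem_nhdsWithin] with τ h3 hτ
  have h4 := hle j τ hτ
  have h5 := h1 τ hτ
  have h6 : 0 ≤ ∫ x, (PP τ f x - f x) ^ 2 := integral_nonneg fun x => sq_nonneg _
  rw [Real.dist_eq, sub_zero, abs_of_nonneg h6]
  linarith

lemma h_tendsto {φ : Euc N → ℝ} (hφ : MemH1 φ) :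
    Tendsto (fun τ => ∫ x, PP τ f x * φ x) (nhdsWithin 0 (Ioi 0)) (nhds (∫ x, f x * φ x)) := by
  have hG := GInt.of_sq hf.aestronglyMeasurable hf2
  have hfm := hf.aestronglyMeasurable (μ := (volume : Measure (Euc N)))
  have h1 := PP_l2_tendsto hf h0 hf2
  have h2 : Tendsto (fun τ => √((∫ x, (PP τ f x - f x) ^ 2) * ∫ x, φ x ^ 2)) (nhdsWithin 0 (Ioi 0)) (nhds 0) := by
    have := (h1.mul_const (∫ x, φ x ^ 2)).sqrt
    simpa using this
  rw [tendsto_iff_dist_tendsto_zero]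
  refine squeeze_zero' (.of_forall fun τ => dist_nonneg) ?_ h2
  filter_upwards [self_mem_nhdsWithin] with τ hτ
  have hc := (PP_continuous hτ hG).aestronglyMeasurable (μ := (volume : Measure (Euc N)))
  have a := (PP_l2 hτ hfm hf2).1
  rw [Real.dist_eq, ← integral_sub (int_mul_of_sq hc hφ.aesm a hφ.2.2.2) (int_mul_of_sq hfm hφ.aesm hf2 hφ.2.2.2)]
  refine Real.abs_le_sqrt ?_
  have e : ∀ x, PP τ f x * φ x - f x * φ x = (PP τ f x - f x) * φ x := fun x => by ring
  simp only [e]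
  refine cs_sq (hc.sub hfm) hφ.aesm ?_ hφ.2.2.2
  have e : ∀ x, (PP τ f x - f x) ^ 2 = PP τ f x ^ 2 + f x ^ 2 - 2 * (PP τ f x * f x) := fun x => by ring
  simp only [e]
  exact isub (iadd a hf2) ((int_mul_of_sq hc hfm a hf2).const_mul 2)
end

lemma TT_weak {f φ : Euc N → ℝ} (h : RG f Q) (hφ : MemH1 φ) :
    ∫ x, (inner ℝ (gradient (TT f) x) (gradient φ x) + TT f x * φ x) = ∫ x, f x * φ x := by
  obtain ⟨hf, h0, hf2, hsup⟩ := id h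
  have hG := h.gint
  obtain ⟨C, hC, hb⟩ := RG_PP1 (N := N)
  have hfm := hf.aestronglyMeasurable (μ := (volume : Measure (Euc N)))
  have p1 : Integrable (fun z : ℝ × Euc N => rexp (-z.1) * (PP z.1 f z.2 * φ z.2)) (mu0.prod volume) := by
    have := prodMul hf hf2 (wexp_int (a := 0) (by norm_num)) (fun τ hτ => by have := rpow_nonneg hτ.le (-0:ℝ); positivity)
      one_pos hφ.aesm hφ.2.2.2
    simpa using this
  have hpos : ∀ᵐ z : ℝ × Euc N ∂(mu0.prod volume), 0 < z.1 := Measure.quasiMeasurePreserving_fst.ae ae_pos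
  have p2 : Integrable (fun z : ℝ × Euc N => rexp (-z.1) * PP1 z.1 f z.2 (gradient φ z.2)) (mu0.prod volume) := by
    have hp := prodMul hf hf2 ((wexp_int (a := 1/2) (by norm_num)).const_mul C)
      (fun τ hτ => by have := rpow_nonneg hτ.le (-(1/2):ℝ); positivity) two_pos (meas_ngrad φ) hφ.2.2.1
    refine hp.mono' ?_ ?_
    · have h1 : Continuous fun z : ℝ × Euc N => rexp (-z.1) := by fun_prop
      have h2 : StronglyMeasurable fun z : ℝ × Euc N => gradient φ z.2 :=
        (meas_grad φ).stronglyMeasurable.comp_measurable measurable_snd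
      have h3 : StronglyMeasurable fun z : ℝ × Euc N => PP1 z.1 f z.2 (gradient φ z.2) := by
        have hc : Continuous fun q : (Euc N →L[ℝ] ℝ) × Euc N => q.1 q.2 := by fun_prop
        exact hc.comp_stronglyMeasurable ((PP1_meas hf).prodMk h2)
      exact (h1.stronglyMeasurable.mul h3).aestronglyMeasurable
    · filter_upwards [hpos] with z hz
      rw [norm_mul, Real.norm_of_nonneg (exp_pos _).le]
      have h1 := (PP1 z.1 f z.2).le_opNorm (gradient φ z.2)
      have h2 := (hb f Q h z.1 hz z.2).1
      calc _ ≤ rexp (-z.1) * ((C * z.1 ^ (-(1/2):ℝ) * PP (2 * z.1) f z.2) * ‖gradient φ z.2‖) := by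
            refine mul_le_mul_of_nonneg_left (h1.trans ?_) (exp_pos _).le
            exact mul_le_mul_of_nonneg_right h2 (norm_nonneg _)
        _ = _ := by ring
  have q1 : ∫ x, TT f x * φ x = ∫ τ, rexp (-τ) * (∫ x, PP τ f x * φ x) ∂mu0 := by
    have := integral_integral_swap (f := fun τ x => rexp (-τ) * (PP τ f x * φ x)) p1
    simp only [integral_const_mul] at this
    rw [this]
    congr 1; ext x
    unfold TT
    rw [← integral_mul_const]
    congr 1; ext τ; ring
  have hTg : ∀ x, inner ℝ (gradient (TT f) x) (gradient φ x) = ∫ τ, rexp (-τ) * PP1 τ f x (gradient φ x) ∂mu0 := by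
    intro x
    rw [inner_grad, TT_fderiv h, TT1, ContinuousLinearMap.integral_apply (h.tint1 x)]
    rfl
  have q2 : ∫ x, inner ℝ (gradient (TT f) x) (gradient φ x) = ∫ τ, rexp (-τ) * (∫ x, PP1 τ f x (gradient φ x)) ∂mu0 := by
    have := integral_integral_swap (f := fun τ x => rexp (-τ) * PP1 τ f x (gradient φ x)) p2
    simp only [integral_const_mul] at this
    rw [this]
    congr 1; ext x
    exact hTg x
  have i1 : Integrable (fun x => TT f x * φ x) :=
    int_mul_of_sq (TT_MemH1 h).aesm hφ.aesm (TT_MemH1 h).2.2.2 hφ.2.2.2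
  have i2 : Integrable (fun x => inner ℝ (gradient (TT f) x) (gradient φ x)) := by
    have := p2.swap.integral_prod_left
    refine this.congr (.of_forall fun x => ?_)
    simp only [Function.comp_apply, Prod.swap_prod_mk]
    exact (hTg x).symm
  have j1 : Integrable (fun τ => rexp (-τ) * (∫ x, PP τ f x * φ x)) mu0 := by
    have := p1.integral_prod_left
    simpa only [integral_const_mul] using this
  have j2 : Integrable (fun τ => rexp (-τ) * (∫ x, PP1 τ f x (gradient φ x))) mu0 := by
    have := p2.integral_prod_left
    simpa only [integral_const_mul] using this
  rw [integral_add i2 i1, q1, q2, ← integral_add j2 j1]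
  let hh : ℝ → ℝ := fun τ => ∫ x, PP τ f x * φ x
  let H : ℝ → ℝ := fun τ => if τ ≤ 0 then ∫ x, f x * φ x else rexp (-τ) * hh τ
  have hH : ∀ τ, 0 < τ → H τ = rexp (-τ) * hh τ := fun τ hτ => by simp [H, not_le.2 hτ]
  have hcont : ContinuousWithinAt H (Ici 0) 0 := by
    rw [← continuousWithinAt_Ioi_iff_Ici]
    unfold ContinuousWithinAt
    have : H 0 = ∫ x, f x * φ x := by simp [H]
    rw [this]
    have he : Tendsto (fun τ : ℝ => rexp (-τ)) (nhdsWithin 0 (Ioi 0)) (nhds 1) := by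
      have : Continuous fun τ : ℝ => rexp (-τ) := by fun_prop
      have := (this.tendsto 0).mono_left (nhdsWithin_le_nhds (s := Ioi 0))
      simpa using this
    have := he.mul (h_tendsto hf h0 hf2 hφ)
    rw [one_mul] at this
    refine this.congr' ?_
    filter_upwards [self_mem_nhdsWithin] with τ hτ
    exact (hH τ hτ).symm
  have hder : ∀ τ ∈ Ioi (0:ℝ), HasDerivAt H (-(rexp (-τ) * (∫ x, PP1 τ f x (gradient φ x)) + rexp (-τ) * ∫ x, PP τ f x * φ x)) τ := by
    intro τ hτ
    have h1 : HasDerivAt (fun τ : ℝ => rexp (-τ)) (-rexp (-τ)) τ := by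
      simpa using (hasDerivAt_id τ).neg.exp
    have h2 := h1.mul (h_deriv hf h0 hf2 hτ hφ)
    refine (h2.congr_of_eventuallyEq ?_).congr_deriv (by ring)
    filter_upwards [Ioi_mem_nhds hτ] with σ hσ
    exact hH σ hσ
  have hlim : Tendsto H atTop (nhds 0) := by
    have hbd : ∀ τ, 0 < τ → |hh τ| ≤ √((∫ x, f x ^ 2) * ∫ x, φ x ^ 2) := by
      intro τ hτ
      have hc := (PP_continuous hτ hG).aestronglyMeasurable (μ := (volume : Measure (Euc N)))
      obtain ⟨a, b⟩ := PP_l2 hτ hfm hf2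
      refine Real.abs_le_sqrt ((cs_sq hc hφ.aesm a hφ.2.2.2).trans ?_)
      exact mul_le_mul_of_nonneg_right b (integral_nonneg fun x => sq_nonneg _)
    have h1 : Tendsto (fun τ : ℝ => rexp (-τ) * √((∫ x, f x ^ 2) * ∫ x, φ x ^ 2)) atTop (nhds 0) := by
      have := (tendsto_exp_neg_atTop_nhds_zero).mul_const √((∫ x, f x ^ 2) * ∫ x, φ x ^ 2)
      simpa using this
    refine squeeze_zero_norm' ?_ h1
    filter_upwards [eventually_gt_atTop 0] with τ hτ
    rw [hH τ hτ, norm_mul, Real.norm_of_nonneg (exp_pos _).le]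
    exact mul_le_mul_of_nonneg_left (hbd τ hτ) (exp_pos _).le
  have hfin := integral_Ioi_of_hasDerivAt_of_tendsto hcont hder (iadd j2 j1).neg hlim
  rw [integral_neg] at hfin
  have h00 : H 0 = ∫ x, f x * φ x := by simp [H]
  rw [h00] at hfin
  linarith

lemma gk2_meas : StronglyMeasurable (fun z : ℝ × Euc N => gk2 z.1 z.2) := by
  have hg := (gk_meas (N := N)).stronglyMeasurable
  have h1 : StronglyMeasurable (fun z : ℝ × Euc N => -(1 / (2 * z.1))) := (by fun_prop : Measurable _).stronglyMeasurable
  have h2 : StronglyMeasurable (fun z : ℝ × Euc N => innL z.2) := (by fun_prop : Continuous fun z : ℝ × Euc N => innL z.2).stronglyMeasurable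
  have hc : Continuous fun q : (Euc N →L[ℝ] ℝ) × (Euc N →L[ℝ] ℝ) => ContinuousLinearMap.smulRight q.1 q.2 := by fun_prop
  have h3 := hc.comp_stronglyMeasurable ((h1.smul gk1_meas).prodMk h2)
  have h4 := ((h1.mul hg).smul (stronglyMeasurable_const (b := (innL : Euc N →L[ℝ] Euc N →L[ℝ] ℝ)))).add h3
  exact h4

lemma PP2_meas (hf : Continuous f) : StronglyMeasurable (fun z : ℝ × Euc N => PP2 z.1 f z.2) := by
  have h : StronglyMeasurable (fun q : (ℝ × Euc N) × Euc N => f q.2 • gk2 q.1.1 (q.1.2 - q.2)) := by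
    have h1 : Measurable (fun q : (ℝ × Euc N) × Euc N => (q.1.1, q.1.2 - q.2)) := by fun_prop
    have h2 : StronglyMeasurable fun q : (ℝ × Euc N) × Euc N => gk2 q.1.1 (q.1.2 - q.2) := gk2_meas.comp_measurable h1
    exact ((hf.comp continuous_snd).stronglyMeasurable).smul h2
  exact h.integral_prod_right

lemma tmeas2 (hf : Continuous f) (x : Euc N) : AEStronglyMeasurable (fun τ => rexp (-τ) • PP2 τ f x) mu0 := by
  have h1 : Continuous fun τ : ℝ => rexp (-τ) := by fun_prop
  exact h1.aestronglyMeasurable.smul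
    ((PP2_meas hf).comp_measurable (g := fun τ : ℝ => (τ, x)) (by fun_prop)).aestronglyMeasurable

def TT2 (f : Euc N → ℝ) (x : Euc N) : Euc N →L[ℝ] Euc N →L[ℝ] ℝ := ∫ τ, rexp (-τ) • PP2 τ f x ∂mu0

lemma TT_C2 {Q B H γ : ℝ} (h : RG f Q) (hB : ∀ x, |f x| ≤ B) (hγ : 0 < γ) (hH0 : 0 ≤ H)
    (hH : ∀ x y, |f x - f y| ≤ H * ‖x - y‖ ^ γ) :
    ContDiff ℝ 2 (TT f) ∧ ∀ x, -lap (TT f) x + TT f x = f x := by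
  obtain ⟨C, hC, hb⟩ := PP2_holder (N := N) γ hγ.le
  have hG := h.gint
  have hbd : ∀ τ, 0 < τ → ∀ x, ‖rexp (-τ) • PP2 τ f x‖ ≤ (C * H) * (rexp (-τ) * τ ^ (-(1 - γ / 2))) := by
    intro τ hτ x
    rw [norm_smul, Real.norm_of_nonneg (exp_pos _).le]
    have := mul_le_mul_of_nonneg_left (hb τ hτ f hG H hH0 hH x) (exp_pos (-τ)).le
    rw [show -(1 - γ / 2) = -1 + γ / 2 by ring]
    linarith
  have hbi : Integrable (fun τ : ℝ => (C * H) * (rexp (-τ) * τ ^ (-(1 - γ / 2)))) mu0 :=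
    (wexp_int (by linarith)).const_mul _
  have i2 : ∀ x, Integrable (fun τ => rexp (-τ) • PP2 τ f x) mu0 := fun x =>
    hbi.mono' (tmeas2 h.cont x) (by filter_upwards [ae_pos] with τ hτ using hbd τ hτ x)
  have hd2 : ∀ x, HasFDerivAt (TT1 f) (TT2 f x) x := by
    intro x
    refine hasFDerivAt_integral_of_dominated_of_fderiv_le (F' := fun x τ => rexp (-τ) • PP2 τ f x) (s := univ)
      (bound := fun τ => (C * H) * (rexp (-τ) * τ ^ (-(1 - γ / 2)))) univ_mem (.of_forall fun x => tmeas1 h.cont x)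
      (h.tint1 x) (tmeas2 h.cont x) ?_ hbi ?_
    · filter_upwards [ae_pos] with τ hτ y _
      exact hbd τ hτ y
    · filter_upwards [ae_pos] with τ hτ y _
      exact (PP1_hasFDerivAt hτ hG y).const_smul (rexp (-τ))
  have e1 : fderiv ℝ (TT f) = TT1 f := by ext1 x; exact TT_fderiv h x
  have e2 : fderiv ℝ (TT1 f) = TT2 f := by ext1 x; exact (hd2 x).fderiv
  have hc2 : Continuous (TT2 f) := by
    refine continuous_of_dominated (fun x => tmeas2 h.cont x)
      (bound := fun τ => (C * H) * (rexp (-τ) * τ ^ (-(1 - γ / 2)))) (fun x => ?_) hbi ?_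
    · filter_upwards [ae_pos] with τ hτ using hbd τ hτ x
    · filter_upwards [ae_pos] with τ hτ
      have h1 := PP2_continuous hτ hG
      have h2 : Continuous fun x => rexp (-τ) • PP2 τ f x := by fun_prop
      exact h2
  refine ⟨?_, fun x => ?_⟩
  · have : ContDiff ℝ 1 (fderiv ℝ (TT f)) := by
      rw [e1, contDiff_one_iff_fderiv, e2]
      exact ⟨fun x => (hd2 x).differentiableAt, hc2⟩
    rw [show (2 : WithTop ℕ∞) = 1 + 1 from rfl, contDiff_succ_iff_fderiv]
    exact ⟨fun x => (TT_hasFDerivAt h x).differentiableAt, by simp, this⟩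
  · have el : lap (TT f) x = ∫ τ, rexp (-τ) * trH (PP2 τ f x) ∂mu0 := by
      have : ∀ v : Euc N, TT2 f x v v = ∫ τ, rexp (-τ) * PP2 τ f x v v ∂mu0 := by
        intro v
        unfold TT2
        rw [ContinuousLinearMap.integral_apply (i2 x), ContinuousLinearMap.integral_apply ((i2 x).apply_continuousLinearMap v)]
        rfl
      unfold lap trH
      simp only [iteratedFDeriv_two_apply, e1, e2, Matrix.cons_val_zero, Matrix.cons_val_one, this, Finset.mul_sum]
      rw [integral_finsetSum]
      intro i _
      exact ((i2 x).apply_continuousLinearMap _).apply_continuousLinearMap _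
    have j2 : Integrable (fun τ => rexp (-τ) * trH (PP2 τ f x)) mu0 := by
      unfold trH
      simp only [Finset.mul_sum]
      refine integrable_finsetSum _ fun i _ => ?_
      exact ((i2 x).apply_continuousLinearMap _).apply_continuousLinearMap _
    have j1 := h.tint x
    let F : ℝ → ℝ := fun τ => if τ ≤ 0 then f x else rexp (-τ) * PP τ f x
    have hF : ∀ τ, 0 < τ → F τ = rexp (-τ) * PP τ f x := fun τ hτ => by simp [F, not_le.2 hτ]
    have hF0 : F 0 = f x := by simp [F]
    have hcont : ContinuousWithinAt F (Ici 0) 0 := by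
      rw [← continuousWithinAt_Ioi_iff_Ici]
      unfold ContinuousWithinAt
      rw [hF0]
      have he : Tendsto (fun τ : ℝ => rexp (-τ)) (nhdsWithin 0 (Ioi 0)) (nhds 1) := by
        have : Continuous fun τ : ℝ => rexp (-τ) := by fun_prop
        have := (this.tendsto 0).mono_left (nhdsWithin_le_nhds (s := Ioi 0))
        simpa using this
      have := he.mul (PP_tendsto h.cont hB x)
      rw [one_mul] at this
      refine this.congr' ?_
      filter_upwards [self_mem_nhdsWithin] with τ hτ
      exact (hF τ hτ).symm
    have hder : ∀ τ ∈ Ioi (0:ℝ), HasDerivAt F (rexp (-τ) * trH (PP2 τ f x) - rexp (-τ) * PP τ f x) τ := by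
      intro τ hτ
      have h1 : HasDerivAt (fun τ : ℝ => rexp (-τ)) (-rexp (-τ)) τ := by
        simpa using (hasDerivAt_id τ).neg.exp
      have h2 := h1.mul (PP_hasDerivAt_time hτ hG x)
      refine (h2.congr_of_eventuallyEq ?_).congr_deriv (by unfold trH; ring)
      filter_upwards [Ioi_mem_nhds hτ] with σ hσ
      exact hF σ hσ
    have hlim : Tendsto F atTop (nhds 0) := by
      have h1 : Tendsto (fun τ : ℝ => rexp (-τ) * B) atTop (nhds 0) := by
        simpa using (tendsto_exp_neg_atTop_nhds_zero).mul_const B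
      refine squeeze_zero_norm' ?_ h1
      filter_upwards [eventually_gt_atTop 0] with τ hτ
      rw [hF τ hτ, norm_mul, Real.norm_of_nonneg (exp_pos _).le]
      refine mul_le_mul_of_nonneg_left ?_ (exp_pos _).le
      exact (PP_abs_le hτ x).trans (PP_bdd hτ h.cont.aestronglyMeasurable hB x)
    have hfin := integral_Ioi_of_hasDerivAt_of_tendsto hcont hder (isub j2 j1) hlim
    rw [hF0, integral_sub j2 j1, ← el] at hfin
    change _ - TT f x = _ at hfin
    linarith

lemma TT_pos (h : RG f Q) (hne : ∃ x, f x ≠ 0) (x : Euc N) : 0 < TT f x := by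
  obtain ⟨x0, hx0⟩ := hne
  have hp : ∀ τ, 0 < τ → 0 < PP τ f x := by
    intro τ hτ
    unfold PP
    have hi : Integrable (fun y => f y * gk τ (x - y)) := h.gint.2 τ hτ x
    have hc : Continuous fun y => f y * gk τ (x - y) := h.cont.mul ((gk_continuous τ).comp (by fun_prop))
    rw [integral_pos_iff_support_of_nonneg (fun y => mul_nonneg (h.nn y) (gk_nonneg hτ _)) hi]
    exact hc.isOpen_support.measure_pos _ ⟨x0, mul_ne_zero hx0 (gk_pos hτ _).ne'⟩
  unfold TT
  rw [integral_pos_iff_support_of_nonneg_ae]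
  · refine lt_of_lt_of_le ?_ (measure_mono (s := Ioi 0) fun τ hτ => (mul_pos (exp_pos _) (hp τ hτ)).ne')
    simp
  · filter_upwards [ae_pos] with τ hτ
    exact mul_nonneg (exp_pos _).le (hp τ hτ).le
  · exact h.tint x

lemma TT_lim {fk : ℕ → Euc N → ℝ} (hc : ∀ k, Continuous (fk k))
    (hb : ∀ k x, |fk k x| ≤ B) (hl : ∀ x, Tendsto (fun k => fk k x) atTop (nhds (f x))) (x : Euc N) :
    Tendsto (fun k => TT (fk k) x) atTop (nhds (TT f x)) := by
  have hB0 : 0 ≤ B := (abs_nonneg _).trans (hb 0 x)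
  refine tendsto_integral_filter_of_dominated_convergence (fun τ => B * (rexp (-τ) * τ ^ (-0 : ℝ)))
    (.of_forall fun k => tmeas (hc k) x) (.of_forall fun k => ?_) ((wexp_int (by norm_num)).const_mul _) ?_
  · filter_upwards [ae_pos] with τ hτ
    rw [norm_mul, Real.norm_of_nonneg (exp_pos _).le]
    have := (PP_abs_le hτ x).trans (PP_bdd hτ (hc k).aestronglyMeasurable (hb k) x)
    have := mul_le_mul_of_nonneg_left this (exp_pos (-τ)).le
    simpa [mul_comm] using this
  · filter_upwards [ae_pos] with τ hτ
    refine Tendsto.const_mul _ ?_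
    unfold PP
    refine tendsto_integral_of_dominated_convergence (fun y => B * gk τ (x - y)) (fun k => ?_)
      ((gk_integrable_sub hτ x).const_mul _) (fun k => .of_forall fun y => ?_) (.of_forall fun y => (hl y).mul_const _)
    · exact ((hc k).mul ((gk_continuous τ).comp (by fun_prop))).aestronglyMeasurable
    · rw [norm_mul, Real.norm_of_nonneg (gk_nonneg hτ _)]
      exact mul_le_mul_of_nonneg_right (hb k y) (gk_nonneg hτ _)

lemma exists_jn (hN : N = 2 * n) : ∃ J : (Euc n × Euc n) ≃L[ℝ] Euc N,
    ∀ a b, ‖J (a, b)‖ ^ 2 = ‖a‖ ^ 2 + ‖b‖ ^ 2 ∧ XV n (J (a, b)) = ‖a‖ ^ 2 - ‖b‖ ^ 2 := by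
  obtain rfl : N = n + n := by omega
  let J : (Euc n × Euc n) ≃ₗ[ℝ] Euc (n + n) :=
    { toFun := fun z => WithLp.toLp 2 (Fin.append (fun i => z.1 i) (fun i => z.2 i))
      invFun := fun x => (WithLp.toLp 2 fun i => x (Fin.castAdd n i), WithLp.toLp 2 fun i => x (Fin.natAdd n i))
      map_add' := by
        intro z w; ext j; refine Fin.addCases (fun i => ?_) (fun i => ?_) j <;> simp [-Fin.natAdd_eq_addNat]
      map_smul' := by
        intro c w; ext j; refine Fin.addCases (fun i => ?_) (fun i => ?_) j <;> simp [-Fin.natAdd_eq_addNat]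
      left_inv := by intro z; ext i <;> simp [-Fin.natAdd_eq_addNat]
      right_inv := by
        intro x; ext j; refine Fin.addCases (fun i => ?_) (fun i => ?_) j <;> simp [-Fin.natAdd_eq_addNat] }
  refine ⟨J.toContinuousLinearEquiv, fun a b => ?_⟩
  have e1 : ∀ i, (J (a, b)) (Fin.castAdd n i) = a i := fun i => by simp [J, -Fin.natAdd_eq_addNat]
  have e2 : ∀ i, (J (a, b)) (Fin.natAdd n i) = b i := fun i => by simp [J, -Fin.natAdd_eq_addNat]
  simp only [LinearEquiv.coe_toContinuousLinearEquiv']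
  constructor
  · simp only [EuclideanSpace.norm_sq_eq, Real.norm_eq_abs, sq_abs]
    rw [Fin.sum_univ_add]
    simp only [e1, e2]
  · simp only [EuclideanSpace.norm_sq_eq, Real.norm_eq_abs, sq_abs, XV]
    rw [Fin.sum_univ_add]
    simp [e1, e2, sub_eq_add_neg, -Fin.natAdd_eq_addNat]

lemma exists_rot (hN : N = 2 * n) : ∃ R : Euc N ≃ₗᵢ[ℝ] Euc N, ∀ x, XV n (R x) ^ 2 + XV n x ^ 2 ≤ ‖x‖ ^ 4 := by
  obtain ⟨J, hJ⟩ := exists_jn hN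
  let c : ℝ := √2 / 2
  have hc : c ^ 2 = 1 / 2 := by simp [c, div_pow]; norm_num
  let r0 : (Euc n × Euc n) →ₗ[ℝ] Euc n × Euc n :=
    LinearMap.prod (c • (LinearMap.fst ℝ _ _ + LinearMap.snd ℝ _ _)) (c • (LinearMap.fst ℝ _ _ - LinearMap.snd ℝ _ _))
  have hr0 : ∀ a b, r0 (a, b) = (c • (a + b), c • (a - b)) := fun a b => by simp [r0]
  have key : ∀ a b : Euc n, ‖c • (a + b)‖ ^ 2 = (‖a‖ ^ 2 + 2 * inner ℝ a b + ‖b‖ ^ 2) / 2 ∧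
      ‖c • (a - b)‖ ^ 2 = (‖a‖ ^ 2 - 2 * inner ℝ a b + ‖b‖ ^ 2) / 2 := by
    intro a b
    rw [norm_smul, norm_smul, mul_pow, mul_pow, Real.norm_eq_abs, sq_abs, hc, norm_add_sq_real, norm_sub_sq_real]
    constructor <;> ring
  let R : Euc N →ₗᵢ[ℝ] Euc N :=
    { toLinearMap := J.toLinearEquiv.toLinearMap ∘ₗ r0 ∘ₗ J.symm.toLinearEquiv.toLinearMap
      norm_map' := by
        intro x
        obtain ⟨⟨a, b⟩, rfl⟩ := J.surjective x
        have h1 : (J.toLinearEquiv.toLinearMap ∘ₗ r0 ∘ₗ J.symm.toLinearEquiv.toLinearMap) (J (a, b)) = J (c • (a + b), c • (a - b)) := by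
          rw [← hr0]; simp
        rw [h1, ← sq_eq_sq₀ (norm_nonneg _) (norm_nonneg _), (hJ _ _).1, (hJ _ _).1, (key a b).1, (key a b).2]
        ring }
  refine ⟨R.toLinearIsometryEquiv rfl, fun x => ?_⟩
  obtain ⟨⟨a, b⟩, rfl⟩ := J.surjective x
  have h1 : (R.toLinearIsometryEquiv rfl) (J (a, b)) = J (c • (a + b), c • (a - b)) := by
    rw [← hr0]; simp [R]
  rw [h1, (hJ _ _).2, (hJ _ _).2, (key a b).1, (key a b).2, show ‖J (a, b)‖ ^ 4 = (‖J (a, b)‖ ^ 2) ^ 2 by ring, (hJ _ _).1]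
  have := abs_real_inner_le_norm a b
  have h2 : (inner ℝ a b) ^ 2 ≤ (‖a‖ * ‖b‖) ^ 2 := by
    rw [← sq_abs]; gcongr
  nlinarith

lemma radial_slice (hn : 2 ≤ n) : ∃ C : ℝ, 0 < C ∧ ∀ (g : Euc n → ℝ), (∀ x y, ‖x‖ = ‖y‖ → g x = g y) →
    Differentiable ℝ g → (∃ R, ∀ y, R ≤ ‖y‖ → g y = 0) → ∀ x,
    ENNReal.ofReal (‖x‖ ^ (n - 1) * |g x|) ≤ ENNReal.ofReal C * ∫⁻ y, ‖fderiv ℝ g y‖ₑ := by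
  have hv : 0 < (volume : Measure (Euc n)).real (Metric.ball 0 1) :=
    ENNReal.toReal_pos (Metric.measure_ball_pos _ _ one_pos).ne' measure_ball_lt_top.ne
  have hn0 : (0:ℝ) < n := by positivity
  refine ⟨(n * (volume : Measure (Euc n)).real (Metric.ball 0 1))⁻¹, by positivity, fun g hg hd ⟨R, hR⟩ x => ?_⟩
  set V := (volume : Measure (Euc n)).real (Metric.ball 0 1)
  by_cases hx : x = 0
  · subst hx
    simp [show n - 1 ≠ 0 by omega]
  by_cases hfin : ∫⁻ y, ‖fderiv ℝ g y‖ₑ = ⊤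
  · rw [hfin, ENNReal.mul_top (by simp; positivity)]; exact le_top
  have hint : Integrable (fderiv ℝ g) := ⟨(measurable_fderiv ℝ g).aestronglyMeasurable, lt_top_iff_ne_top.2 hfin⟩
  let e : Euc n := EuclideanSpace.single ⟨0, by omega⟩ 1
  have he : ‖e‖ = 1 := by simp [e]
  let φ : ℝ → ℝ := fun ρ => g (ρ • e)
  have hφ : ∀ ρ, HasDerivAt φ (deriv φ ρ) ρ := by
    intro ρ
    have : DifferentiableAt ℝ φ ρ := by
      have := hd (ρ • e)
      exact DifferentiableAt.comp ρ this (by fun_prop)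
    exact this.hasDerivAt
  have hle : ∀ y : Euc n, y ≠ 0 → |deriv φ ‖y‖| ≤ ‖fderiv ℝ g y‖ := by
    intro y hy
    have hy' : 0 < ‖y‖ := norm_pos_iff.2 hy
    have h1 : HasDerivAt (fun ρ : ℝ => g ((ρ / ‖y‖) • y)) (fderiv ℝ g y (‖y‖⁻¹ • y)) ‖y‖ := by
      have h2 : HasFDerivAt g (fderiv ℝ g y) ((‖y‖ / ‖y‖) • y) := by
        rw [div_self hy'.ne', one_smul]; exact (hd y).hasFDerivAt
      have h3 : HasDerivAt (fun ρ : ℝ => (ρ / ‖y‖) • y) (‖y‖⁻¹ • y) ‖y‖ := by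
        simpa [one_div] using ((hasDerivAt_id ‖y‖).div_const ‖y‖).smul_const y
      exact h2.comp_hasDerivAt _ h3
    have h4 : φ =ᶠ[nhds ‖y‖] fun ρ : ℝ => g ((ρ / ‖y‖) • y) := by
      filter_upwards [Ioi_mem_nhds hy'] with ρ hρ
      have : (0:ℝ) < ρ := hρ
      apply hg
      rw [norm_smul, norm_smul, he, norm_div, norm_norm]; field_simp
    rw [(h1.congr_of_eventuallyEq h4).deriv]
    refine ((fderiv ℝ g y).le_opNorm _).trans ?_
    rw [norm_smul, norm_inv, norm_norm, inv_mul_cancel₀ hy'.ne', mul_one]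
  have : Nontrivial (Euc n) := ⟨e, 0, by intro h; simp [h] at he⟩
  have hae : ∀ᵐ y : Euc n, |deriv φ ‖y‖| ≤ ‖fderiv ℝ g y‖ := by
    have h0 : ∀ᵐ y : Euc n, y ≠ 0 := by simp [ae_iff]
    filter_upwards [h0] with y hy using hle y hy
  have hI : Integrable (fun y : Euc n => |deriv φ ‖y‖|) := by
    refine hint.norm.mono' ?_ (by filter_upwards [hae] with y hy; simpa using hy)
    exact ((measurable_deriv φ).comp measurable_norm).norm.aestronglyMeasurable
  have hI2 := (integrable_fun_norm_addHaar (volume : Measure (Euc n)) (f := fun ρ => |deriv φ ρ|)).1 hI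
  have hI3 := integral_fun_norm_addHaar (volume : Measure (Euc n)) (fun ρ => |deriv φ ρ|)
  simp only [finrank_euclideanSpace, Fintype.card_fin, smul_eq_mul, nsmul_eq_mul] at hI2 hI3
  set s := ‖x‖ with hs
  have hs0 : 0 < s := norm_pos_iff.2 hx
  have hmain : s ^ (n - 1) * |g x| ≤ ∫ ρ in Ioi 0, ρ ^ (n - 1) * |deriv φ ρ| := by
    have hgx : g x = φ s := hg _ _ (by simp [norm_smul, he, hs])
    let R' := max R s
    have hR' : φ R' = 0 := hR _ (by rw [norm_smul, he, mul_one]; exact (le_max_left _ _).trans (le_abs_self _))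
    have hsR : s ≤ R' := le_max_right _ _
    have hsub : Ioc s R' ⊆ Ioi 0 := fun ρ hρ => hs0.trans hρ.1
    have hi1 : IntegrableOn (fun ρ => s ^ (n - 1) * |deriv φ ρ|) (Ioc s R') := by
      refine (hI2.mono_set hsub).mono' ?_ ?_
      · exact (((measurable_deriv φ).norm).const_mul _).aestronglyMeasurable
      · filter_upwards [ae_restrict_mem measurableSet_Ioc] with ρ hρ
        rw [Real.norm_of_nonneg (by positivity)]
        have := hρ.1.le
        gcongr
    have hi2 : IntervalIntegrable (deriv φ) volume s R' := by
      rw [intervalIntegrable_iff_integrableOn_Ioc_of_le hsR]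
      have := hi1.const_mul (s ^ (n - 1))⁻¹
      simp only [← mul_assoc] at this
      rw [inv_mul_cancel₀ (by positivity)] at this
      simp only [one_mul] at this
      exact (integrable_norm_iff (measurable_deriv φ).aestronglyMeasurable).1 this
    have h1 := intervalIntegral.integral_eq_sub_of_hasDerivAt (fun ρ _ => hφ ρ) hi2
    rw [hR', zero_sub, ← hgx] at h1
    have h2 : |g x| ≤ ∫ ρ in Ioc s R', |deriv φ ρ| := by
      rw [← abs_neg, ← h1, intervalIntegral.integral_of_le hsR]
      exact abs_integral_le_integral_abs
    calc s ^ (n - 1) * |g x| ≤ s ^ (n - 1) * ∫ ρ in Ioc s R', |deriv φ ρ| := by gcongr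
      _ = ∫ ρ in Ioc s R', s ^ (n - 1) * |deriv φ ρ| := by rw [integral_const_mul]
      _ ≤ ∫ ρ in Ioc s R', ρ ^ (n - 1) * |deriv φ ρ| := by
          refine setIntegral_mono_on hi1 (hI2.mono_set hsub) measurableSet_Ioc fun ρ hρ => ?_
          have := hρ.1.le
          gcongr
      _ ≤ _ := by
          refine setIntegral_mono_set hI2 ?_ hsub.eventuallyLE
          filter_upwards [ae_restrict_mem measurableSet_Ioi] with ρ hρ
          have : (0:ℝ) < ρ := hρ
          simp only [Pi.zero_apply]; positivity
  have h5 : ∫ y : Euc n, |deriv φ ‖y‖| ≤ ∫ y, ‖fderiv ℝ g y‖ := integral_mono_ae hI hint.norm hae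
  rw [← ofReal_integral_norm_eq_lintegral_enorm hint, ← ENNReal.ofReal_mul (by positivity)]
  refine ENNReal.ofReal_le_ofReal ?_
  rw [inv_mul_eq_div, le_div_iff₀ (by positivity)]
  calc _ ≤ (∫ ρ in Ioi 0, ρ ^ (n - 1) * |deriv φ ρ|) * (n * V) := by gcongr
    _ = ∫ y : Euc n, |deriv φ ‖y‖| := by rw [hI3]; ring
    _ ≤ _ := h5

lemma st_meas (n : ℕ) : Measurable (sVar n : Euc N → ℝ) ∧ Measurable (tVar n : Euc N → ℝ) := by
  constructor
  · refine (Finset.measurable_sum _ fun i _ => ?_).sqrt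
    split_ifs <;> fun_prop
  · refine (Finset.measurable_sum _ fun i _ => ?_).sqrt
    split_ifs <;> fun_prop

lemma prod_ineq (hn : 2 ≤ n) (hN : N = 2 * n) : ∃ C : ENNReal, C ≠ ⊤ ∧ ∀ F : Euc N → ℝ, KC n F →
    Differentiable ℝ F → (∃ R, ∀ x, R ≤ ‖x‖ → F x = 0) →
    ∫⁻ x, ENNReal.ofReal ((sVar n x * tVar n x) ^ (n - 1) * F x ^ 2) ≤ C * (∫⁻ x, ‖fderiv ℝ F x‖ₑ) ^ 2 := by
  obtain ⟨J, hJ⟩ := exists_jn hN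
  obtain ⟨C0, hC0, hs⟩ := radial_slice hn
  let ν : Measure (Euc N) := Measure.map J (volume.prod volume)
  have hν : ν.IsAddHaarMeasure := J.isAddHaarMeasure_map (volume.prod volume)
  let c : NNReal := ν.addHaarScalarFactor (volume : Measure (Euc N))
  have hc : ν = c • (volume : Measure (Euc N)) := Measure.isAddLeftInvariant_eq_smul ν volume
  have hc0 : (c : ENNReal) ≠ 0 := by
    have := Measure.addHaarScalarFactor_pos_of_isAddHaarMeasure ν (volume : Measure (Euc N))
    exact_mod_cast this.ne'
  have hch : ∀ h : Euc N → ENNReal, Measurable h → ∫⁻ z, h (J z) ∂(volume.prod volume) = c * ∫⁻ x, h x := by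
    intro h hh
    rw [← lintegral_map hh J.continuous.measurable]
    change ∫⁻ a, h a ∂ν = _
    rw [hc, lintegral_smul_measure]; rfl
  have hst : ∀ a b, sVar n (J (a, b)) = ‖a‖ ∧ tVar n (J (a, b)) = ‖b‖ := by
    intro a b
    have h1 := st_norm n (J (a, b))
    have h2 := st_XV n (J (a, b))
    rw [(hJ a b).1] at h1
    rw [(hJ a b).2] at h2
    constructor
    · rw [← sq_eq_sq₀ (sVar_nonneg _ _) (norm_nonneg _)]; linarith
    · rw [← sq_eq_sq₀ (tVar_nonneg _ _) (norm_nonneg _)]; linarith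
  have hn1 : ∀ a, ‖J (a, 0)‖ = ‖a‖ := fun a => by
    rw [← sq_eq_sq₀ (norm_nonneg _) (norm_nonneg _), (hJ a 0).1]; simp
  have hn2 : ∀ b, ‖J (0, b)‖ = ‖b‖ := fun a => by
    rw [← sq_eq_sq₀ (norm_nonneg _) (norm_nonneg _), (hJ 0 a).1]; simp
  refine ⟨ENNReal.ofReal C0 * ENNReal.ofReal C0 * c, by finiteness, fun F hK hd ⟨R, hR⟩ => ?_⟩
  have heq : ∀ a b a' b', ‖a‖ = ‖a'‖ → ‖b‖ = ‖b'‖ → F (J (a, b)) = F (J (a', b')) := by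
    intro a b a' b' h1 h2
    apply hK.eq_of
    · rw [← sq_eq_sq₀ (norm_nonneg _) (norm_nonneg _), (hJ _ _).1, (hJ _ _).1, h1, h2]
    · rw [(hJ _ _).2, (hJ _ _).2, h1, h2]
  set D : Euc N → ENNReal := fun x => ‖fderiv ℝ F x‖ₑ with hD
  have hDm : Measurable D := (measurable_fderiv ℝ F).enorm
  have hDJ : Measurable fun z => D (J z) := hDm.comp J.continuous.measurable
  have hA : ∀ a b, ENNReal.ofReal (‖a‖ ^ (n - 1) * |F (J (a, b))|) ≤ ENNReal.ofReal C0 * ∫⁻ a, D (J (a, b)) := by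
    intro a b
    have hdg : ∀ a, HasFDerivAt (fun a => F (J (a, b))) ((fderiv ℝ F (J (a, b))).comp ((J : (Euc n × Euc n) →L[ℝ] Euc N).comp (ContinuousLinearMap.inl ℝ _ _))) a := by
      intro a
      refine HasFDerivAt.comp a (hd _).hasFDerivAt ?_
      exact J.hasFDerivAt.comp a (hasFDerivAt_prodMk_left a b)
    refine (hs (fun a => F (J (a, b))) (fun x y h => heq _ _ _ _ h rfl) (fun a => (hdg a).differentiableAt)
      ⟨R, fun y hy => hR _ (hy.trans ?_)⟩ a).trans ?_
    · rw [← sq_le_sq₀ (norm_nonneg _) (norm_nonneg _), (hJ _ _).1]; nlinarith [sq_nonneg ‖b‖]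
    · gcongr with y
      rw [(hdg y).fderiv, hD]
      apply enorm_le_iff_norm_le.2
      refine ContinuousLinearMap.opNorm_le_bound _ (norm_nonneg _) fun v => ?_
      refine ((fderiv ℝ F _).le_opNorm _).trans ?_
      simp [hn1]
  have hB : ∀ a b, ENNReal.ofReal (‖b‖ ^ (n - 1) * |F (J (a, b))|) ≤ ENNReal.ofReal C0 * ∫⁻ b, D (J (a, b)) := by
    intro a b
    have hdg : ∀ b, HasFDerivAt (fun b => F (J (a, b))) ((fderiv ℝ F (J (a, b))).comp ((J : (Euc n × Euc n) →L[ℝ] Euc N).comp (ContinuousLinearMap.inr ℝ _ _))) b := by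
      intro b
      refine HasFDerivAt.comp b (hd _).hasFDerivAt ?_
      exact J.hasFDerivAt.comp b (hasFDerivAt_prodMk_right a b)
    refine (hs (fun b => F (J (a, b))) (fun x y h => heq _ _ _ _ rfl h) (fun a => (hdg a).differentiableAt)
      ⟨R, fun y hy => hR _ (hy.trans ?_)⟩ b).trans ?_
    · rw [← sq_le_sq₀ (norm_nonneg _) (norm_nonneg _), (hJ _ _).1]; nlinarith [sq_nonneg ‖a‖]
    · gcongr with y
      rw [(hdg y).fderiv, hD]
      apply enorm_le_iff_norm_le.2
      refine ContinuousLinearMap.opNorm_le_bound _ (norm_nonneg _) fun v => ?_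
      refine ((fderiv ℝ F _).le_opNorm _).trans ?_
      simp [hn2]
  have hm : Measurable fun x => ENNReal.ofReal ((sVar n x * tVar n x) ^ (n - 1) * F x ^ 2) := by
    obtain ⟨h1, h2⟩ := st_meas (N := N) n
    have h3 := hd.continuous.measurable
    exact (((h1.mul h2).pow_const _).mul (h3.pow_const 2)).ennreal_ofReal
  have e0 := hch _ hm
  have key : ∫⁻ z, ENNReal.ofReal ((sVar n (J z) * tVar n (J z)) ^ (n - 1) * F (J z) ^ 2) ∂(volume.prod volume)
      ≤ ENNReal.ofReal C0 * ENNReal.ofReal C0 * ((c * ∫⁻ x, D x) * (c * ∫⁻ x, D x)) := by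
    calc _ ≤ ∫⁻ z : Euc n × Euc n, (ENNReal.ofReal C0 * ENNReal.ofReal C0) * ((∫⁻ b, D (J (z.1, b))) * ∫⁻ a, D (J (a, z.2))) ∂(volume.prod volume) := by
          refine lintegral_mono fun ⟨a, b⟩ => ?_
          simp only [(hst a b).1, (hst a b).2]
          rw [show (‖a‖ * ‖b‖) ^ (n - 1) * F (J (a, b)) ^ 2 = (‖b‖ ^ (n - 1) * |F (J (a, b))|) * (‖a‖ ^ (n - 1) * |F (J (a, b))|) by
            rw [← sq_abs, mul_pow]; ring, ENNReal.ofReal_mul (by positivity)]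
          refine (mul_le_mul' (hB a b) (hA a b)).trans (le_of_eq (by ring))
      _ = _ := by
          rw [lintegral_const_mul' _ _ (by finiteness)]
          congr 1
          rw [lintegral_prod_mul (μ := volume) (ν := volume) (f := fun a => ∫⁻ b, D (J (a, b))) (g := fun b => ∫⁻ a, D (J (a, b)))
            hDJ.lintegral_prod_right'.aemeasurable hDJ.lintegral_prod_left'.aemeasurable]
          rw [← hch D hDm]
          congr 1
          · rw [lintegral_prod _ hDJ.aemeasurable]
          · rw [lintegral_prod_symm _ hDJ.aemeasurable]
  rw [e0] at key
  have h9 : (c:ENNReal) * ∫⁻ x, ENNReal.ofReal ((sVar n x * tVar n x) ^ (n - 1) * F x ^ 2) ≤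
      c * (ENNReal.ofReal C0 * ENNReal.ofReal C0 * c * (∫⁻ x, D x) ^ 2) := key.trans (le_of_eq (by ring))
  exact (ENNReal.mul_le_mul_iff_right hc0 (by finiteness)).1 h9

lemma rad_ineq (hn : 2 ≤ n) (hN : N = 2 * n) : ∃ C : ENNReal, C ≠ ⊤ ∧ ∀ F : Euc N → ℝ, KC n F →
    Differentiable ℝ F → (∃ R, ∀ x, R ≤ ‖x‖ → F x = 0) →
    ∫⁻ x, ENNReal.ofReal (‖x‖ ^ (N - 2) * F x ^ 2) ≤ C * (∫⁻ x, ‖fderiv ℝ F x‖ₑ) ^ 2 := by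
  obtain ⟨C, hC, h⟩ := prod_ineq hn hN
  obtain ⟨R, hR⟩ := exists_rot (N := N) hN
  refine ⟨3 ^ (n - 1) * 2 * C, by finiteness, fun F hK hd hz => ?_⟩
  set k : Euc N → ENNReal := fun x => ENNReal.ofReal ((sVar n x * tVar n x) ^ (n - 1) * F x ^ 2) with hk
  have hm : Measurable k := by
    obtain ⟨h1, h2⟩ := st_meas (N := N) n
    have h3 := hd.continuous.measurable
    exact (((h1.mul h2).pow_const _).mul (h3.pow_const 2)).ennreal_ofReal
  have h0 : ∀ x, XV n x ^ 2 ≤ ‖x‖ ^ 4 / 2 → ENNReal.ofReal (‖x‖ ^ (N - 2) * F x ^ 2) ≤ 3 ^ (n - 1) * k x := by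
    intro x hx
    have e3 : (3 ^ (n - 1) : ENNReal) = ENNReal.ofReal (3 ^ (n - 1)) := by
      rw [ENNReal.ofReal_pow (by norm_num)]; norm_num
    rw [hk, e3, ← ENNReal.ofReal_mul (by positivity)]
    apply ENNReal.ofReal_le_ofReal
    have hs := sVar_nonneg n x
    have ht := tVar_nonneg n x
    have h1 := st_norm n x
    have h2 := st_XV n x
    have h3 : ‖x‖ ^ 2 ≤ 3 * (sVar n x * tVar n x) := by
      rw [← sq_le_sq₀ (by positivity) (by positivity)]
      have : ‖x‖ ^ 4 = (‖x‖ ^ 2) ^ 2 := by ring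
      rw [this, ← h1, ← h2] at hx
      rw [← h1]
      nlinarith
    rw [show N - 2 = 2 * (n - 1) by omega, pow_mul, ← mul_assoc, ← mul_pow]
    gcongr
  have h1 : ∀ x, ENNReal.ofReal (‖x‖ ^ (N - 2) * F x ^ 2) ≤ 3 ^ (n - 1) * (k x + k (R x)) := by
    intro x
    by_cases hx : XV n x ^ 2 ≤ ‖x‖ ^ 4 / 2
    · exact (h0 x hx).trans (by gcongr; exact le_self_add)
    · have h2 := hR x
      have h3 : XV n (R x) ^ 2 ≤ ‖R x‖ ^ 4 / 2 := by rw [R.norm_map]; linarith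
      have h4 : F x ≤ F (R x) := hK.2 _ _ (R.norm_map x).symm (by
        apply sq_le_sq.1; linarith)
      have := h0 _ h3
      rw [R.norm_map] at this
      refine le_trans ?_ (this.trans (by gcongr; exact le_add_self))
      have := hK.1 x
      gcongr
  have hRm := (R.measurePreserving).lintegral_comp hm
  calc _ ≤ ∫⁻ x, 3 ^ (n - 1) * (k x + k (R x)) := lintegral_mono h1
    _ = 3 ^ (n - 1) * ((∫⁻ x, k x) + ∫⁻ x, k x) := by
        rw [lintegral_const_mul' _ _ (by finiteness), lintegral_add_left hm, hRm]
    _ ≤ 3 ^ (n - 1) * (C * (∫⁻ x, ‖fderiv ℝ F x‖ₑ) ^ 2 + C * (∫⁻ x, ‖fderiv ℝ F x‖ₑ) ^ 2) := by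
        gcongr <;> exact h F hK hd hz
    _ = _ := by ring

def N2 (u : Euc N → ℝ) : ℝ := ∫ x, (‖gradient u x‖ ^ 2 + u x ^ 2)

lemma MemH1.n2int (h : MemH1 u) : Integrable (fun x => ‖gradient u x‖ ^ 2 + u x ^ 2) :=
  h.2.2.1.add h.2.2.2

lemma hardy_eps (hN4 : 4 ≤ N) (h : MemH1 u) {ε : ℝ} (hε : 0 < ε) :
    Integrable (fun x => u x ^ 2 / (‖x‖ ^ 2 + ε)) ∧ ∫ x, u x ^ 2 / (‖x‖ ^ 2 + ε) ≤ ∫ x, ‖gradient u x‖ ^ 2 := by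
  have hw : ∀ x : Euc N, 0 < ‖x‖ ^ 2 + ε := fun x => by positivity
  have hu := h.2.2.2
  let e : Fin N → Euc N := fun i => EuclideanSpace.single i 1
  have hxi : ∀ (x : Euc N) i, inner ℝ x (e i) = x i := fun x i => by simp [e, EuclideanSpace.inner_single_right]
  have hxin : ∀ (x : Euc N) i, |x i| ≤ ‖x‖ := fun x i => by simpa using PiLp.norm_apply_le x i
  have hsumx : ∀ x : Euc N, ∑ i, x i ^ 2 = ‖x‖ ^ 2 := fun x => by simp [EuclideanSpace.norm_sq_eq]
  have hwd : ∀ x : Euc N, HasFDerivAt (fun x : Euc N => ‖x‖ ^ 2 + ε) ((2:ℝ) • innL x) x := by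
    intro x; simpa using (nsq_deriv 1 x).add_const ε
  have hgd : ∀ i (x : Euc N), HasFDerivAt (fun x : Euc N => x i * (‖x‖ ^ 2 + ε)⁻¹)
      (x i • (-((‖x‖ ^ 2 + ε) ^ 2)⁻¹ • ((2:ℝ) • innL x)) + (‖x‖ ^ 2 + ε)⁻¹ • (EuclideanSpace.proj i : Euc N →L[ℝ] ℝ)) x := by
    intro i x
    have h1 : HasFDerivAt (fun x : Euc N => x i) (EuclideanSpace.proj i : Euc N →L[ℝ] ℝ) x := (EuclideanSpace.proj i : Euc N →L[ℝ] ℝ).hasFDerivAt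
    have h2 := (hasDerivAt_inv (hw x).ne').comp_hasFDerivAt x (hwd x)
    exact h1.mul h2
  have hfd : ∀ x, HasFDerivAt (fun x => u x ^ 2) ((2 * u x) • fderiv ℝ u x) x := by
    intro x; simpa using (h.2.1 x).hasFDerivAt.pow 2
  have cw : Continuous fun x : Euc N => ‖x‖ ^ 2 + ε := by fun_prop
  have cwi : Continuous fun x : Euc N => (‖x‖ ^ 2 + ε)⁻¹ := cw.inv₀ fun x => (hw x).ne'
  set K := 1 + 1 / ε with hK
  have hK1 : ∀ x : Euc N, (‖x‖ ^ 2 + ε)⁻¹ ≤ K := by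
    intro x
    have : (‖x‖ ^ 2 + ε)⁻¹ ≤ ε⁻¹ := by gcongr; nlinarith [sq_nonneg ‖x‖]
    rw [hK, one_div]; linarith
  have hK2 : ∀ x : Euc N, ‖x‖ * (‖x‖ ^ 2 + ε)⁻¹ ≤ K := by
    intro x
    rw [← div_eq_mul_inv, div_le_iff₀ (hw x), hK]
    have : (1 + 1 / ε) * (‖x‖ ^ 2 + ε) = ‖x‖ ^ 2 + ε + ‖x‖ ^ 2 / ε + 1 := by field_simp; ring
    rw [this]
    have : 0 ≤ ‖x‖ ^ 2 / ε := by positivity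
    nlinarith [sq_nonneg (‖x‖ - 1), norm_nonneg x]
  have bmul : ∀ {g b : Euc N → ℝ} {K : ℝ}, Integrable g → Continuous b → (∀ x, |b x| ≤ K) → Integrable fun x => g x * b x := by
    intro g b K hg hb hbb
    exact hg.mul_bdd (c := K) hb.aestronglyMeasurable (.of_forall hbb)
  have hA : Integrable (fun x => u x ^ 2 / (‖x‖ ^ 2 + ε)) :=
    bmul hu cwi fun x => by rw [abs_of_pos (inv_pos.2 (hw x))]; exact hK1 x
  have hgv : ∀ i (x : Euc N), fderiv ℝ (fun x : Euc N => x i * (‖x‖ ^ 2 + ε)⁻¹) x (e i) = (‖x‖ ^ 2 + ε)⁻¹ - 2 * x i ^ 2 * ((‖x‖ ^ 2 + ε) ^ 2)⁻¹ := by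
    intro i x
    rw [(hgd i x).fderiv]
    simp [e, innL_apply, EuclideanSpace.inner_single_right]
    ring
  have hfv : ∀ i x, fderiv ℝ (fun x => u x ^ 2) x (e i) = 2 * u x * fderiv ℝ u x (e i) := by
    intro i x; rw [(hfd x).fderiv]; simp
  have hgb : ∀ i (x : Euc N), |x i * (‖x‖ ^ 2 + ε)⁻¹| ≤ K := by
    intro i x
    rw [abs_mul, abs_of_pos (inv_pos.2 (hw x))]
    exact (mul_le_mul_of_nonneg_right (hxin x i) (inv_pos.2 (hw x)).le).trans (hK2 x)
  have hgc : ∀ i, Continuous fun x : Euc N => x i * (‖x‖ ^ 2 + ε)⁻¹ := fun i => (by fun_prop : Continuous fun x : Euc N => x i).mul cwi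
  have I1 : ∀ i, Integrable fun x => fderiv ℝ (fun x => u x ^ 2) x (e i) * (x i * (‖x‖ ^ 2 + ε)⁻¹) := by
    intro i
    refine bmul ?_ (hgc i) (hgb i)
    simp only [hfv, mul_assoc]
    exact (int_mul_of_sq h.aesm (meas_fderiv_apply u _) hu (h.dsq i)).const_mul 2
  have I2 : ∀ i, Integrable fun x => u x ^ 2 * fderiv ℝ (fun x : Euc N => x i * (‖x‖ ^ 2 + ε)⁻¹) x (e i) := by
    intro i
    simp only [hgv]
    refine bmul (K := K + 2 * (K * K)) hu ?_ fun x => ?_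
    · have : Continuous fun x : Euc N => x i := by fun_prop
      exact cwi.sub ((continuous_const.mul (this.pow 2)).mul ((cw.pow 2).inv₀ fun x => (pow_pos (hw x) 2).ne'))
    · refine (abs_sub _ _).trans (add_le_add ?_ ?_)
      · rw [abs_of_pos (inv_pos.2 (hw x))]; exact hK1 x
      · have := hgb i x
        rw [show 2 * x i ^ 2 * ((‖x‖ ^ 2 + ε) ^ 2)⁻¹ = 2 * ((x i * (‖x‖ ^ 2 + ε)⁻¹) * (x i * (‖x‖ ^ 2 + ε)⁻¹)) by rw [← inv_pow]; ring,
          abs_mul, abs_mul, abs_two]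
        gcongr
  have I3 : ∀ i, Integrable fun x => u x ^ 2 * (x i * (‖x‖ ^ 2 + ε)⁻¹) := fun i => bmul hu (hgc i) (hgb i)
  have ibp : ∀ i, ∫ x, (u x ^ 2 * fderiv ℝ (fun x : Euc N => x i * (‖x‖ ^ 2 + ε)⁻¹) x (e i) + fderiv ℝ (fun x => u x ^ 2) x (e i) * (x i * (‖x‖ ^ 2 + ε)⁻¹)) = 0 := by
    intro i
    rw [integral_add (I2 i) (I1 i)]
    have := integral_mul_fderiv_eq_neg_fderiv_mul_of_integrable (μ := (volume : Measure (Euc N))) (I1 i) (I2 i) (I3 i)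
      (fun x _ => (hfd x).differentiableAt) (fun x _ => (hgd i x).differentiableAt)
    rw [this]; ring
  have hs : ∫ x, ∑ i, (u x ^ 2 * fderiv ℝ (fun x : Euc N => x i * (‖x‖ ^ 2 + ε)⁻¹) x (e i) + fderiv ℝ (fun x => u x ^ 2) x (e i) * (x i * (‖x‖ ^ 2 + ε)⁻¹)) = 0 := by
    refine (integral_finsetSum _ fun i _ => (I2 i).add (I1 i)).trans ?_
    exact Finset.sum_eq_zero fun i _ => ibp i
  have hle : ∫ x, (u x ^ 2 / (‖x‖ ^ 2 + ε) - ‖gradient u x‖ ^ 2) ≤ 0 := by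
    rw [← hs]
    refine integral_mono (hA.sub h.2.2.1) (integrable_finsetSum _ fun i _ => (I2 i).add (I1 i)) fun x => ?_
    simp only [hgv, hfv]
    have hdx : ∑ i, x i * fderiv ℝ u x (e i) = fderiv ℝ u x x := by
      generalize fderiv ℝ u x = L
      conv_rhs => rw [← (EuclideanSpace.basisFun (Fin N) ℝ).sum_repr x]
      simp [e]
    set W := (‖x‖ ^ 2 + ε)⁻¹ with hW
    have hW0 : 0 < W := inv_pos.2 (hw x)
    have hrW : ‖x‖ ^ 2 * W ≤ 1 := by
      rw [hW, ← div_eq_mul_inv, div_le_one (hw x)]; linarith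
    have e1 : ∑ i, (u x ^ 2 * (W - 2 * x i ^ 2 * ((‖x‖ ^ 2 + ε) ^ 2)⁻¹) + 2 * u x * fderiv ℝ u x (e i) * (x i * W))
        = u x ^ 2 * (N * W - 2 * ‖x‖ ^ 2 * W ^ 2) + 2 * u x * W * fderiv ℝ u x x := by
      rw [← hdx, Finset.sum_add_distrib, ← Finset.mul_sum, Finset.sum_sub_distrib, ← Finset.sum_mul, ← Finset.mul_sum, hsumx, Finset.mul_sum]
      simp only [Finset.sum_const, Finset.card_univ, Fintype.card_fin, nsmul_eq_mul, ← inv_pow]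
      congr 1
      exact Finset.sum_congr rfl fun i _ => by ring
    rw [e1, norm_grad, div_eq_mul_inv]
    have h1 : |fderiv ℝ u x x| ≤ ‖fderiv ℝ u x‖ * ‖x‖ := (fderiv ℝ u x).le_opNorm x
    set d := ‖fderiv ℝ u x‖
    have h2 : -(|u x| * W * (d * ‖x‖)) ≤ u x * W * fderiv ℝ u x x := by
      have : |u x * W * fderiv ℝ u x x| ≤ |u x| * W * (d * ‖x‖) := by
        rw [abs_mul, abs_mul, abs_of_pos hW0]; gcongr
      exact (abs_le.1 this).1
    have h3 := sq_nonneg (|u x| * W * ‖x‖ - d)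
    have h4 : (|u x| * W * ‖x‖) ^ 2 ≤ u x ^ 2 * W := by
      rw [show (|u x| * W * ‖x‖) ^ 2 = (u x ^ 2 * W) * (‖x‖ ^ 2 * W) by rw [mul_pow, mul_pow, sq_abs]; ring]
      exact mul_le_of_le_one_right (by positivity) hrW
    have h5 : u x ^ 2 * (4 * W - 2 * W) ≤ u x ^ 2 * (N * W - 2 * ‖x‖ ^ 2 * W ^ 2) := by
      have h6 : (4:ℝ) ≤ N := by exact_mod_cast hN4
      have : 2 * ‖x‖ ^ 2 * W ^ 2 ≤ 2 * W := by nlinarith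
      have : 4 * W ≤ N * W := by gcongr
      gcongr
    nlinarith
  rw [integral_sub hA h.2.2.1] at hle
  exact ⟨hA, by linarith⟩

lemma hardy (hN4 : 4 ≤ N) (h : MemH1 u) :
    ∫⁻ x, ENNReal.ofReal ((u x / ‖x‖) ^ 2) ≤ ENNReal.ofReal (∫ x, ‖gradient u x‖ ^ 2) := by
  have hj : ∀ j : ℕ, (0:ℝ) < 1 / (j + 1) := fun j => by positivity
  calc _ ≤ ∫⁻ x, liminf (fun j : ℕ => ENNReal.ofReal (u x ^ 2 / (‖x‖ ^ 2 + 1 / (j + 1)))) atTop := by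
        refine lintegral_mono fun x => ?_
        by_cases hx : x = 0
        · simp [hx]
        · refine le_of_eq (Tendsto.liminf_eq ?_).symm
          apply ENNReal.tendsto_ofReal
          rw [div_pow]
          have h1 : Tendsto (fun j : ℕ => ‖x‖ ^ 2 + 1 / ((j:ℝ) + 1)) atTop (nhds (‖x‖ ^ 2 + 0)) :=
            tendsto_const_nhds.add tendsto_one_div_add_atTop_nhds_zero_nat
          rw [add_zero] at h1
          exact tendsto_const_nhds.div h1 (by have := norm_pos_iff.2 hx; positivity)
    _ ≤ liminf (fun j : ℕ => ∫⁻ x, ENNReal.ofReal (u x ^ 2 / (‖x‖ ^ 2 + 1 / (j + 1)))) atTop := by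
        refine lintegral_liminf_le fun j => ?_
        have := h.1.measurable
        fun_prop
    _ ≤ liminf (fun j : ℕ => ENNReal.ofReal (∫ x, ‖gradient u x‖ ^ 2)) atTop := by
        refine liminf_le_liminf (.of_forall fun j => ?_)
        obtain ⟨h1, h2⟩ := hardy_eps hN4 h (hj j)
        rw [← ofReal_integral_eq_lintegral_ofReal h1 (.of_forall fun x => by positivity)]
        exact ENNReal.ofReal_le_ofReal h2
    _ = _ := by simp

lemma exists_rho : ∃ C : ℝ, 0 < C ∧ ∃ ρ : ℝ → ℝ, Differentiable ℝ ρ ∧ (∀ w, 0 ≤ ρ w ∧ ρ w ≤ 1) ∧ (∀ w ≤ 1, ρ w = 0) ∧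
    (∀ w, 2 ≤ w → ρ w = 1) ∧ ∀ w, |deriv ρ w| * |w| ≤ C := by
  have hc : ContDiff ℝ 1 Real.smoothTransition := Real.smoothTransition.contDiff
  have hcd : Continuous (deriv Real.smoothTransition) := hc.continuous_deriv le_rfl
  obtain ⟨B, hB⟩ := (isCompact_Icc (a := (0:ℝ)) (b := 1)).exists_bound_of_continuousOn hcd.continuousOn
  have hdd : Differentiable ℝ Real.smoothTransition := hc.differentiable (by norm_num)
  refine ⟨2 * |B| + 1, by positivity, fun w => Real.smoothTransition (w - 1), ?_, fun w => ⟨Real.smoothTransition.nonneg _, Real.smoothTransition.le_one _⟩,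
    fun w hw => Real.smoothTransition.zero_of_nonpos (by linarith), fun w hw => Real.smoothTransition.one_of_one_le (by linarith), fun w => ?_⟩
  · exact hdd.comp (by fun_prop)
  · rw [deriv_comp_sub_const]
    by_cases h1 : w - 1 < 0
    · have : Real.smoothTransition =ᶠ[nhds (w - 1)] fun _ => 0 := by
        filter_upwards [Iio_mem_nhds h1] with y hy using Real.smoothTransition.zero_of_nonpos (le_of_lt hy)
      rw [this.deriv_eq]; simp; positivity
    by_cases h2 : 1 < w - 1
    · have : Real.smoothTransition =ᶠ[nhds (w - 1)] fun _ => 1 := by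
        filter_upwards [Ioi_mem_nhds h2] with y hy using Real.smoothTransition.one_of_one_le (le_of_lt hy)
      rw [this.deriv_eq]; simp; positivity
    · push Not at h1 h2
      have h3 := hB (w - 1) ⟨h1, h2⟩
      rw [Real.norm_eq_abs] at h3
      have h4 : |w| ≤ 2 := by rw [abs_of_nonneg (by linarith)]; linarith
      calc _ ≤ |B| * 2 := mul_le_mul (h3.trans (le_abs_self B)) h4 (abs_nonneg _) (abs_nonneg _)
        _ ≤ _ := by linarith

lemma exists_cut (k : ℝ) : ∃ C : ℝ, 0 < C ∧ ∃ ζ : ℕ → ℝ → ℝ, ∀ j, Differentiable ℝ (ζ j) ∧ (∀ y, 0 < y → |deriv (ζ j) y| * y ≤ C * y ^ k) ∧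
    (∀ y, 0 ≤ ζ j y) ∧ (∀ y, 0 < y → ζ j y ≤ y ^ k) ∧ (∃ R, ∀ y, R ≤ y → ζ j y = 0) ∧ (∀ y, y ≤ 0 → ζ j y = 0) ∧
    ∀ y, 0 < y → Tendsto (fun j => ζ j y) atTop (nhds (y ^ k)) := by
  obtain ⟨C, hC, ρ, hd, h01, h0, h1, hb⟩ := exists_rho
  refine ⟨C + |k|, by positivity, fun j y => ρ (j * y / (1 + y ^ 2)) * y ^ k, fun j => ?_⟩
  have hden : ∀ y : ℝ, 0 < 1 + y ^ 2 := fun y => by positivity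
  have hz : ∀ y, (j:ℝ) * y / (1 + y ^ 2) ≤ 1 → ρ (j * y / (1 + y ^ 2)) * y ^ k = 0 := fun y hy => by rw [h0 _ hy, zero_mul]
  have hneg : ∀ y : ℝ, y ≤ 0 → (j:ℝ) * y / (1 + y ^ 2) ≤ 1 := by
    intro y hy
    have : (j:ℝ) * y / (1 + y ^ 2) ≤ 0 := div_nonpos_of_nonpos_of_nonneg (mul_nonpos_of_nonneg_of_nonpos (by positivity) hy) (hden y).le
    linarith
  have hpos : ∀ y : ℝ, 0 < y → HasDerivAt (fun y => ρ (j * y / (1 + y ^ 2)) * y ^ k)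
      (deriv ρ (j * y / (1 + y ^ 2)) * ((j * (1 + y ^ 2) - j * y * (2 * y)) / (1 + y ^ 2) ^ 2) * y ^ k + ρ (j * y / (1 + y ^ 2)) * (k * y ^ (k - 1))) y := by
    intro y hy
    have hw : HasDerivAt (fun y : ℝ => (j:ℝ) * y / (1 + y ^ 2)) ((j * (1 + y ^ 2) - j * y * (2 * y)) / (1 + y ^ 2) ^ 2) y := by
      have a1 : HasDerivAt (fun y : ℝ => (j:ℝ) * y) j y := by simpa using (hasDerivAt_id y).const_mul (j:ℝ)
      have a2 : HasDerivAt (fun y : ℝ => 1 + y ^ 2) (2 * y) y := by simpa using (hasDerivAt_pow 2 y).const_add 1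
      exact a1.div a2 (hden y).ne'
    exact ((hd _).hasDerivAt.comp y hw).mul (Real.hasDerivAt_rpow_const (Or.inl hy.ne'))
  refine ⟨?_, ?_, ?_, ?_, ?_, fun y hy => hz y (hneg y hy), ?_⟩
  · intro y
    by_cases hy : 0 < y
    · exact (hpos y hy).differentiableAt
    · push Not at hy
      have : (fun y => ρ (j * y / (1 + y ^ 2)) * y ^ k) =ᶠ[nhds y] fun _ => 0 := by
        have hc : ContinuousAt (fun y : ℝ => (j:ℝ) * y / (1 + y ^ 2)) y := by
          refine ContinuousAt.div (by fun_prop) (by fun_prop) (hden y).ne'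
        have hlt : (j:ℝ) * y / (1 + y ^ 2) < 1 := by
          have : (j:ℝ) * y / (1 + y ^ 2) ≤ 0 := div_nonpos_of_nonpos_of_nonneg (mul_nonpos_of_nonneg_of_nonpos (by positivity) hy) (hden y).le
          linarith
        filter_upwards [hc.eventually (Iio_mem_nhds hlt)] with z hz' using hz z (le_of_lt hz')
      exact (differentiableAt_const 0).congr_of_eventuallyEq this
  · intro y hy
    rw [(hpos y hy).deriv]
    have hyk : 0 < y ^ k := rpow_pos_of_pos hy k
    set w := (j:ℝ) * y / (1 + y ^ 2) with hw
    have e1 : (j * (1 + y ^ 2) - j * y * (2 * y)) / (1 + y ^ 2) ^ 2 * y = w * ((1 - y ^ 2) / (1 + y ^ 2)) := by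
      rw [hw]; field_simp; ring
    have e2 : y ^ (k - 1) * y = y ^ k := by
      rw [← Real.rpow_add_one hy.ne']; congr 1; ring
    have h3 : |(1 - y ^ 2) / (1 + y ^ 2)| ≤ 1 := by
      rw [abs_div, abs_of_pos (hden y), div_le_one (hden y), abs_le]; constructor <;> nlinarith [sq_nonneg y]
    rw [← abs_of_pos hy, ← abs_mul, abs_of_pos hy, add_mul,
      show deriv ρ w * ((j * (1 + y ^ 2) - j * y * (2 * y)) / (1 + y ^ 2) ^ 2) * y ^ k * y = deriv ρ w * ((j * (1 + y ^ 2) - j * y * (2 * y)) / (1 + y ^ 2) ^ 2 * y) * y ^ k by ring,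
      e1, show ρ w * (k * y ^ (k - 1)) * y = ρ w * k * (y ^ (k - 1) * y) by ring, e2]
    refine (abs_add_le _ _).trans ?_
    rw [abs_mul, abs_mul, abs_mul, abs_mul, abs_mul, abs_of_pos hyk, add_mul]
    have h5 : |ρ w| ≤ 1 := abs_le.2 ⟨by linarith [(h01 w).1], (h01 w).2⟩
    gcongr ?_ * _ + ?_ * _
    · calc _ = (|deriv ρ w| * |w|) * |(1 - y ^ 2) / (1 + y ^ 2)| := by ring
        _ ≤ C * 1 := by gcongr; exact hb w
        _ = C := mul_one C
    · exact mul_le_of_le_one_left (abs_nonneg _) h5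
  · intro y
    by_cases hy : 0 < y
    · exact mul_nonneg (h01 _).1 (rpow_pos_of_pos hy k).le
    · exact (hz y (hneg y (not_lt.1 hy))).ge
  · intro y hy
    exact mul_le_of_le_one_left (rpow_pos_of_pos hy k).le (h01 _).2
  · refine ⟨j, fun y hy => hz y ?_⟩
    have : (0:ℝ) ≤ j := by positivity
    rw [div_le_one (hden y)]; nlinarith
  · intro y hy
    refine tendsto_const_nhds.congr' ?_
    have : Tendsto (fun j : ℕ => (j:ℝ) * (y / (1 + y ^ 2))) atTop atTop :=
      tendsto_natCast_atTop_atTop.atTop_mul_const (by positivity)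
    filter_upwards [this.eventually_ge_atTop 2] with j hj
    rw [mul_div_assoc, h1 _ hj, one_mul]

lemma cs_enn {f g : Euc N → ENNReal} (hf : AEMeasurable f) (hg : AEMeasurable g) :
    (∫⁻ x, f x * g x) ^ 2 ≤ (∫⁻ x, f x ^ 2) * ∫⁻ x, g x ^ 2 := by
  have h := ENNReal.lintegral_mul_le_Lp_mul_Lq volume (Real.HolderConjugate.two_two) hf hg
  have h2 : ∀ z : ENNReal, (z ^ (1 / 2 : ℝ)) ^ 2 = z := fun z => by
    rw [← ENNReal.rpow_natCast, ← ENNReal.rpow_mul]; norm_num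
  calc _ ≤ ((∫⁻ x, f x ^ (2:ℝ)) ^ (1 / 2 : ℝ) * (∫⁻ x, g x ^ (2:ℝ)) ^ (1 / 2 : ℝ)) ^ 2 := by gcongr; exact h
    _ = _ := by rw [mul_pow, h2, h2]; simp only [ENNReal.rpow_two]

def DD (u : Euc N → ℝ) : ENNReal := ∫⁻ x, ENNReal.ofReal ((‖fderiv ℝ u x‖ + u x / ‖x‖) ^ 2)

lemma step_ineq (hn : 2 ≤ n) (hN : N = 2 * n) (k : ℝ) (m : ℕ) : ∃ C : ENNReal, C ≠ ⊤ ∧ ∀ u : Euc N → ℝ, KC n u → Differentiable ℝ u →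
    ∫⁻ x, ENNReal.ofReal ((‖x‖ ^ (k + (n - 1)) * u x ^ (m + 1)) ^ 2) ≤ C * (∫⁻ x, ENNReal.ofReal ((‖x‖ ^ k * u x ^ m) ^ 2)) * DD u := by
  obtain ⟨C, hC, hrad⟩ := rad_ineq (N := N) hn hN
  obtain ⟨K, hK, ζ, hζ⟩ := exists_cut (k / 2)
  set A : ℝ := 2 * K + (m + 1) with hA
  refine ⟨C * ENNReal.ofReal A ^ 2, by finiteness, fun u hu hd => ?_⟩
  have h0 : ∀ᵐ x : Euc N, x ≠ 0 := by
    have : Nontrivial (Euc N) := by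
      have : Nonempty (Fin N) := ⟨⟨0, by omega⟩⟩
      infer_instance
    simp [ae_iff]
  have hr2 : ∀ x : Euc N, (‖x‖ ^ 2) ^ (k / 2) = ‖x‖ ^ k := by
    intro x; rw [← Real.rpow_natCast, ← Real.rpow_mul (norm_nonneg x)]; congr 1; push_cast; ring
  have hum := hd.continuous.measurable
  have hm1 : Measurable fun x : Euc N => ENNReal.ofReal (‖x‖ ^ k * u x ^ m) := by fun_prop
  have hm2 : Measurable fun x : Euc N => ENNReal.ofReal (‖fderiv ℝ u x‖ + u x / ‖x‖) := by
    have := (measurable_fderiv ℝ u).norm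
    fun_prop
  let F : ℕ → Euc N → ℝ := fun j x => ζ j (‖x‖ ^ 2) * u x ^ (m + 1)
  have hb : ∀ j, ∫⁻ x, ENNReal.ofReal (‖x‖ ^ (N - 2) * F j x ^ 2) ≤ C * ENNReal.ofReal A ^ 2 * (∫⁻ x, ENNReal.ofReal ((‖x‖ ^ k * u x ^ m) ^ 2)) * DD u := by
    intro j
    obtain ⟨hζd, hζ', hζ0, hζ1, ⟨R, hζR⟩, hζn, -⟩ := hζ j
    have hFd : ∀ x, HasFDerivAt (F j) (ζ j (‖x‖ ^ 2) • (((m + 1 : ℕ) * u x ^ m) • fderiv ℝ u x) + (u x ^ (m + 1)) • (deriv (ζ j) (‖x‖ ^ 2) • ((2:ℝ) • innL x))) x := by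
      intro x
      have e1 : HasFDerivAt (fun x : Euc N => ‖x‖ ^ 2) ((2:ℝ) • innL x) x := by simpa using nsq_deriv 1 x
      have e2 := (hζd (‖x‖ ^ 2)).hasDerivAt.comp_hasFDerivAt x e1
      have e3 : HasFDerivAt (fun x => u x ^ (m + 1)) (((m + 1 : ℕ) * u x ^ m) • fderiv ℝ u x) x := by
        simpa using (hd x).hasFDerivAt.pow (m + 1)
      exact e2.mul e3
    refine (hrad (F j) ⟨fun x => mul_nonneg (hζ0 _) (pow_nonneg (hu.1 x) _), fun x y h1 h2 => ?_⟩ (fun x => (hFd x).differentiableAt)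
      ⟨R + 1, fun x hx => ?_⟩).trans ?_
    · have := hu.2 x y h1 h2
      have := hu.1 x
      have := hζ0 (‖y‖ ^ 2)
      simp only [F]; rw [h1]; gcongr
    · simp only [F]
      rw [hζR, zero_mul]
      nlinarith [sq_nonneg (‖x‖ - 1), norm_nonneg x]
    · have hpt : ∀ᵐ x, ‖fderiv ℝ (F j) x‖ₑ ≤ ENNReal.ofReal A * (ENNReal.ofReal (‖x‖ ^ k * u x ^ m) * ENNReal.ofReal (‖fderiv ℝ u x‖ + u x / ‖x‖)) := by
        filter_upwards [h0] with x hx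
        have hx0 : 0 < ‖x‖ := norm_pos_iff.2 hx
        have hux := hu.1 x
        rw [← ENNReal.ofReal_mul (by positivity), ← ENNReal.ofReal_mul (by positivity), ← ofReal_norm_eq_enorm, (hFd x).fderiv]
        apply ENNReal.ofReal_le_ofReal
        have hy : 0 < ‖x‖ ^ 2 := by positivity
        have i1 := hζ' _ hy
        have i2 := hζ1 _ hy
        rw [hr2] at i1 i2
        have hk0 : 0 < ‖x‖ ^ k := rpow_pos_of_pos hx0 k
        have i3 : ‖(innL x : Euc N →L[ℝ] ℝ)‖ ≤ ‖x‖ := ContinuousLinearMap.opNorm_le_bound _ hx0.le fun v => by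
          rw [innL_apply]; exact norm_inner_le_norm _ _
        have i4 : |deriv (ζ j) (‖x‖ ^ 2)| * ‖x‖ ≤ K * ‖x‖ ^ k / ‖x‖ := by
          rw [le_div_iff₀ hx0]; nlinarith
        refine (norm_add_le _ _).trans ?_
        rw [norm_smul, norm_smul, norm_smul, norm_smul, norm_smul]
        simp only [Real.norm_eq_abs]
        rw [abs_of_nonneg (hζ0 _), abs_of_nonneg (by positivity : (0:ℝ) ≤ (m + 1 : ℕ) * u x ^ m), abs_of_nonneg (by positivity : 0 ≤ u x ^ (m + 1)), abs_two]
        push_cast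
        set d := ‖fderiv ℝ u x‖
        have hd0 : 0 ≤ d := norm_nonneg _
        calc _ ≤ ‖x‖ ^ k * ((m + 1) * u x ^ m * d) + u x ^ (m + 1) * (2 * (K * ‖x‖ ^ k / ‖x‖)) := by
              gcongr ?_ * _ + _ * ?_
              calc _ ≤ |deriv (ζ j) (‖x‖ ^ 2)| * (2 * ‖x‖) := by gcongr
                _ ≤ _ := by linarith
          _ = (‖x‖ ^ k * u x ^ m) * ((m + 1) * d + 2 * K * (u x / ‖x‖)) := by rw [pow_succ]; ring
          _ ≤ (‖x‖ ^ k * u x ^ m) * (A * (d + u x / ‖x‖)) := by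
              have : 0 ≤ u x / ‖x‖ := by positivity
              gcongr
              rw [hA]
              have := mul_nonneg hK.le hd0
              have : 0 ≤ ((m:ℝ) + 1) * (u x / ‖x‖) := by positivity
              nlinarith
          _ = _ := by ring
      calc _ ≤ C * (∫⁻ x, ENNReal.ofReal A * (ENNReal.ofReal (‖x‖ ^ k * u x ^ m) * ENNReal.ofReal (‖fderiv ℝ u x‖ + u x / ‖x‖))) ^ 2 := by
            gcongr C * ?_ ^ 2
            exact lintegral_mono_ae hpt
        _ ≤ C * (ENNReal.ofReal A ^ 2 * ((∫⁻ x, ENNReal.ofReal (‖x‖ ^ k * u x ^ m) ^ 2) * ∫⁻ x, ENNReal.ofReal (‖fderiv ℝ u x‖ + u x / ‖x‖) ^ 2)) := by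
            rw [lintegral_const_mul' _ _ (by finiteness), mul_pow]
            gcongr
            exact cs_enn hm1.aemeasurable hm2.aemeasurable
        _ = _ := by
            have a1 : ∀ x, ENNReal.ofReal (‖x‖ ^ k * u x ^ m) ^ 2 = ENNReal.ofReal ((‖x‖ ^ k * u x ^ m) ^ 2) := fun x => by
              rw [ENNReal.ofReal_pow]; have := hu.1 x; positivity
            have a2 : ∀ x, ENNReal.ofReal (‖fderiv ℝ u x‖ + u x / ‖x‖) ^ 2 = ENNReal.ofReal ((‖fderiv ℝ u x‖ + u x / ‖x‖) ^ 2) := fun x => by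
              rw [ENNReal.ofReal_pow]; have := hu.1 x; positivity
            simp only [a1, a2, DD]; ring
  calc _ ≤ ∫⁻ x, liminf (fun j => ENNReal.ofReal (‖x‖ ^ (N - 2) * F j x ^ 2)) atTop := by
        refine lintegral_mono_ae ?_
        filter_upwards [h0] with x hx
        have hx0 : 0 < ‖x‖ := norm_pos_iff.2 hx
        refine le_of_eq (Tendsto.liminf_eq ?_).symm
        apply ENNReal.tendsto_ofReal
        have := ((((hζ 0).2.2.2.2.2.2 (‖x‖ ^ 2) (by positivity)).mul_const (u x ^ (m + 1))).pow 2).const_mul (‖x‖ ^ (N - 2))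
        convert this using 2
        rw [hr2, Real.rpow_add hx0, show N - 2 = (n - 1) * 2 by omega, pow_mul,
          show ((n:ℝ) - 1) = ((n - 1 : ℕ) : ℝ) by rw [Nat.cast_sub (by omega)]; simp, Real.rpow_natCast]
        ring
    _ ≤ liminf (fun j => ∫⁻ x, ENNReal.ofReal (‖x‖ ^ (N - 2) * F j x ^ 2)) atTop := by
        refine lintegral_liminf_le fun j => ?_
        have := (hζ j).1.continuous.measurable
        simp only [F]
        fun_prop
    _ ≤ liminf (fun j : ℕ => C * ENNReal.ofReal A ^ 2 * (∫⁻ x, ENNReal.ofReal ((‖x‖ ^ k * u x ^ m) ^ 2)) * DD u) atTop :=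
        liminf_le_liminf (.of_forall hb)
    _ = _ := by simp

structure AD (n : ℕ) (u : Euc N → ℝ) : Prop where
  h1 : MemH1 u
  kc : KC n u
  le1 : N2 u ≤ 1

lemma ae_ne0 (hn : 2 ≤ n) (hN : N = 2 * n) : ∀ᵐ x : Euc N, x ≠ 0 := by
  have : Nontrivial (Euc N) := by
    have : Nonempty (Fin N) := ⟨⟨0, by omega⟩⟩
    infer_instance
  simp [ae_iff]

lemma MemH1.le_N2 (h : MemH1 u) : ∫ x, ‖gradient u x‖ ^ 2 ≤ N2 u ∧ ∫ x, u x ^ 2 ≤ N2 u := by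
  constructor
  · exact integral_mono h.2.2.1 h.n2int fun x => by simp; positivity
  · exact integral_mono h.2.2.2 h.n2int fun x => by simp

lemma AD.hrd (hn : 2 ≤ n) (hN : N = 2 * n) (h : AD n u) :
    ∫⁻ x, ENNReal.ofReal ((u x / ‖x‖) ^ 2) ≤ 1 := by
  refine (hardy (by omega) h.h1).trans ?_
  rw [← ENNReal.ofReal_one]
  exact ENNReal.ofReal_le_ofReal (h.h1.le_N2.1.trans h.le1)

lemma AD.DD_le (hn : 2 ≤ n) (hN : N = 2 * n) (h : AD n u) : DD u ≤ 4 := by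
  have h1 : ∫⁻ x, ENNReal.ofReal (‖fderiv ℝ u x‖ ^ 2) ≤ 1 := by
    have := ofReal_integral_eq_lintegral_ofReal h.h1.2.2.1 (.of_forall fun x => by positivity)
    simp only [norm_grad] at this
    rw [← this, ← ENNReal.ofReal_one]
    refine ENNReal.ofReal_le_ofReal ?_
    have := h.h1.le_N2.1.trans h.le1
    simpa only [norm_grad] using this
  have hm := (measurable_fderiv ℝ u).norm
  have hm' := h.h1.1.measurable
  calc DD u ≤ ∫⁻ x, (2 * ENNReal.ofReal (‖fderiv ℝ u x‖ ^ 2) + 2 * ENNReal.ofReal ((u x / ‖x‖) ^ 2)) := by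
        refine lintegral_mono fun x => ?_
        have e2 : ∀ z : ℝ, 2 * ENNReal.ofReal z = ENNReal.ofReal (2 * z) := fun z => by
          rw [ENNReal.ofReal_mul (by norm_num)]; norm_num
        rw [e2, e2, ← ENNReal.ofReal_add (by positivity) (by positivity)]
        apply ENNReal.ofReal_le_ofReal
        nlinarith [sq_nonneg (‖fderiv ℝ u x‖ - u x / ‖x‖)]
    _ = 2 * (∫⁻ x, ENNReal.ofReal (‖fderiv ℝ u x‖ ^ 2)) + 2 * ∫⁻ x, ENNReal.ofReal ((u x / ‖x‖) ^ 2) := by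
        rw [lintegral_add_left (by fun_prop), lintegral_const_mul' _ _ (by finiteness), lintegral_const_mul' _ _ (by finiteness)]
    _ ≤ 2 * 1 + 2 * 1 := by gcongr; exact h.hrd hn hN
    _ = 4 := by norm_num

lemma iter_ineq (hn : 2 ≤ n) (hN : N = 2 * n) (m : ℕ) : ∃ C : ENNReal, C ≠ ⊤ ∧ ∀ u : Euc N → ℝ, AD n u →
    ∫⁻ x, ENNReal.ofReal ((‖x‖ ^ ((m:ℝ) * (n - 1)) * u x ^ (m + 1)) ^ 2) ≤ C ∧
    ∫⁻ x, ENNReal.ofReal ((‖x‖ ^ (-1 + (m:ℝ) * (n - 1)) * u x ^ (m + 1)) ^ 2) ≤ C := by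
  induction m with
  | zero =>
    refine ⟨1, by finiteness, fun u h => ⟨?_, ?_⟩⟩
    · have := ofReal_integral_eq_lintegral_ofReal h.h1.2.2.2 (.of_forall fun x => by positivity)
      simp only [Nat.cast_zero, zero_mul, rpow_zero, one_mul, zero_add, pow_one]
      rw [← this, ← ENNReal.ofReal_one]
      exact ENNReal.ofReal_le_ofReal (h.h1.le_N2.2.trans h.le1)
    · refine le_trans (le_of_eq ?_) (h.hrd hn hN)
      refine lintegral_congr fun x => ?_
      simp [rpow_neg_one, div_eq_inv_mul]
  | succ m ih =>
    obtain ⟨C, hC, h⟩ := ih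
    obtain ⟨C1, hC1, h1⟩ := step_ineq (N := N) hn hN ((m:ℝ) * (n - 1)) (m + 1)
    obtain ⟨C2, hC2, h2⟩ := step_ineq (N := N) hn hN (-1 + (m:ℝ) * (n - 1)) (m + 1)
    refine ⟨(C1 + C2) * C * 4, by finiteness, fun u hu => ⟨?_, ?_⟩⟩
    · have := h1 u hu.kc hu.h1.2.1
      rw [show ((m + 1 : ℕ):ℝ) * (n - 1) = (m:ℝ) * (n - 1) + (n - 1) by push_cast; ring]
      refine this.trans ?_
      gcongr
      · exact le_self_add
      · exact (h u hu).1
      · exact hu.DD_le hn hN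
    · have := h2 u hu.kc hu.h1.2.1
      rw [show -1 + ((m + 1 : ℕ):ℝ) * (n - 1) = -1 + (m:ℝ) * (n - 1) + (n - 1) by push_cast; ring]
      refine this.trans ?_
      gcongr
      · exact le_add_self
      · exact (h u hu).2
      · exact hu.DD_le hn hN

lemma rpow_le_add {x a b c : ℝ} (hx : 0 < x) (h1 : a ≤ b) (h2 : b ≤ c) : x ^ b ≤ x ^ a + x ^ c := by
  have ha := rpow_pos_of_pos hx a
  have hc := rpow_pos_of_pos hx c
  rcases le_total x 1 with h | h
  · linarith [rpow_le_rpow_of_exponent_ge hx h h1]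
  · linarith [rpow_le_rpow_of_exponent_le h h2]

lemma EE (hn : 2 ≤ n) (hN : N = 2 * n) {q e : ℝ} (hq : 2 ≤ q) (he1 : (n - 1) * q - N ≤ e) (he2 : e ≤ (n - 1) * q - N + 2) :
    ∃ C : ℝ, 0 < C ∧ ∀ u : Euc N → ℝ, AD n u → Integrable (fun x => ‖x‖ ^ e * u x ^ q) ∧ ∫ x, ‖x‖ ^ e * u x ^ q ≤ C := by
  obtain ⟨m, hm⟩ : ∃ m : ℕ, ⌊q / 2⌋₊ = m + 1 := ⟨⌊q / 2⌋₊ - 1, by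
    have : 1 ≤ ⌊q / 2⌋₊ := Nat.one_le_floor_iff _ |>.2 (by linarith)
    omega⟩
  have hm1 : 2 * ((m:ℝ) + 1) ≤ q := by
    have := Nat.floor_le (by linarith : 0 ≤ q / 2)
    rw [hm] at this; push_cast at this; linarith
  have hm2 : q ≤ 2 * ((m:ℝ) + 2) := by
    have := Nat.lt_floor_add_one (q / 2)
    rw [hm] at this; push_cast at this; linarith
  obtain ⟨C1, hC1, h1⟩ := iter_ineq (N := N) hn hN m
  obtain ⟨C2, hC2, h2⟩ := iter_ineq (N := N) hn hN (m + 1)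
  have hnN : (N:ℝ) = 2 * n := by rw [hN]; push_cast; ring
  refine ⟨(C1 + C1 + C2 + C2).toReal + 1, by positivity, fun u hu => ?_⟩
  have hum := hu.h1.1.measurable
  have key : ∫⁻ x, ENNReal.ofReal (‖x‖ ^ e * u x ^ q) ≤ C1 + C1 + C2 + C2 := by
    calc _ ≤ ∫⁻ x, (ENNReal.ofReal ((‖x‖ ^ ((m:ℝ) * (n - 1)) * u x ^ (m + 1)) ^ 2) + ENNReal.ofReal ((‖x‖ ^ (-1 + (m:ℝ) * (n - 1)) * u x ^ (m + 1)) ^ 2)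
          + ENNReal.ofReal ((‖x‖ ^ (((m + 1:ℕ):ℝ) * (n - 1)) * u x ^ (m + 1 + 1)) ^ 2) + ENNReal.ofReal ((‖x‖ ^ (-1 + ((m + 1:ℕ):ℝ) * (n - 1)) * u x ^ (m + 1 + 1)) ^ 2)) := by
          refine lintegral_mono_ae ?_
          filter_upwards [ae_ne0 hn hN] with x hx
          have hr : 0 < ‖x‖ := norm_pos_iff.2 hx
          rw [← ENNReal.ofReal_add (by positivity) (by positivity), ← ENNReal.ofReal_add (by positivity) (by positivity), ← ENNReal.ofReal_add (by positivity) (by positivity)]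
          apply ENNReal.ofReal_le_ofReal
          rcases (hu.kc.1 x).eq_or_lt with h0 | h0
          · rw [← h0, zero_rpow (by linarith)]; simp
          set r := ‖x‖
          set a := r ^ ((n:ℝ) - 1) * u x with ha
          have ha0 : 0 < a := by positivity
          have e0 : r ^ e * u x ^ q = r ^ (e - (n - 1) * q) * a ^ q := by
            rw [ha, mul_rpow (by positivity) h0.le, ← mul_assoc, ← rpow_mul hr.le, ← rpow_add hr]; congr 2; ring
          have eg : ∀ (k : ℝ) (i : ℕ), (r ^ (k + (i:ℝ) * (n - 1)) * u x ^ (i + 1)) ^ 2 = r ^ (2 * k - 2 * (n - 1)) * a ^ (2 * ((i:ℝ) + 1)) := by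
            intro k i
            rw [ha, mul_rpow (by positivity) h0.le, ← mul_assoc, ← rpow_mul hr.le, ← rpow_add hr, mul_pow, ← rpow_natCast (r ^ _) 2, ← rpow_mul hr.le,
              ← pow_mul, ← rpow_natCast (u x)]
            congr 2 <;> push_cast <;> ring
          have eg0 : ∀ (i : ℕ), (r ^ ((i:ℝ) * (n - 1)) * u x ^ (i + 1)) ^ 2 = r ^ (2 * 0 - 2 * ((n:ℝ) - 1)) * a ^ (2 * ((i:ℝ) + 1)) := by
            intro i; rw [← eg 0 i, zero_add]
          rw [e0, eg0, eg, eg0, eg]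
          have i1 := rpow_le_add hr (a := 2 * (-1) - 2 * ((n:ℝ) - 1)) (b := e - (n - 1) * q) (c := 2 * 0 - 2 * ((n:ℝ) - 1)) (by linarith) (by linarith)
          have i2 := rpow_le_add ha0 (a := 2 * ((m:ℝ) + 1)) (b := q) (c := 2 * (((m + 1 : ℕ):ℝ) + 1)) hm1 (by push_cast; linarith)
          refine (mul_le_mul i1 i2 (by positivity) (by positivity)).trans (le_of_eq (by ring))
      _ ≤ _ := by
          rw [lintegral_add_left (by fun_prop), lintegral_add_left (by fun_prop), lintegral_add_left (by fun_prop)]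
          gcongr
          · exact (h1 u hu).1
          · exact (h1 u hu).2
          · exact (h2 u hu).1
          · exact (h2 u hu).2
  have hnn : ∀ x, 0 ≤ ‖x‖ ^ e * u x ^ q := fun x => mul_nonneg (rpow_nonneg (norm_nonneg _) _) (rpow_nonneg (hu.kc.1 x) _)
  have hms : AEStronglyMeasurable (fun x : Euc N => ‖x‖ ^ e * u x ^ q) volume := by
    have : Measurable (fun x : Euc N => ‖x‖ ^ e * u x ^ q) := by fun_prop
    exact this.aestronglyMeasurable
  have hfin : C1 + C1 + C2 + C2 ≠ ⊤ := by finiteness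
  have hint : Integrable (fun x => ‖x‖ ^ e * u x ^ q) :=
    ⟨hms, (hasFiniteIntegral_iff_ofReal (.of_forall hnn)).2 (key.trans_lt (lt_top_iff_ne_top.2 hfin))⟩
  refine ⟨hint, ?_⟩
  rw [integral_eq_lintegral_of_nonneg_ae (.of_forall hnn) hms]
  exact (ENNReal.toReal_mono hfin key).trans (by linarith)

structure PR (n N : ℕ) (α p : ℝ) : Prop where
  hn : 2 ≤ n
  hN : N = 2 * n
  hα : 0 < α
  hp1 : 2 * (n:ℝ) - 2 + α < (n - 1) * p
  hp2 : (n - 1) * p < 2 * (n:ℝ) + α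

lemma PR.n2 (P : PR n N α p) : (2:ℝ) ≤ n := by exact_mod_cast P.hn
lemma PR.N2 (P : PR n N α p) : (N:ℝ) = 2 * n := by rw [P.hN]; push_cast; ring
lemma PR.p2 (P : PR n N α p) : 2 < p := by
  have := P.n2; have := P.hα; have := P.hp1
  by_contra h
  push Not at h
  nlinarith
lemma PR.ae0 (P : PR n N α p) : ∀ᵐ x : Euc N, x ≠ 0 := ae_ne0 P.hn P.hN

def ff (α p : ℝ) (u : Euc N → ℝ) (x : Euc N) : ℝ := ‖x‖ ^ α * u x ^ (p - 1)

lemma ff_cont (P : PR n N α p) (hu : Continuous u) : Continuous (ff α p u) := by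
  have := P.p2; have := P.hα
  exact (continuous_norm.rpow_const fun x => Or.inr (by linarith)).mul (hu.rpow_const fun x => Or.inr (by linarith))

lemma ff_nn (hu : ∀ x, 0 ≤ u x) (x : Euc N) : 0 ≤ ff α p u x :=
  mul_nonneg (rpow_nonneg (norm_nonneg _) _) (rpow_nonneg (hu x) _)

lemma ff_KC (P : PR n N α p) (hu : KC n u) : KC n (ff α p u) := by
  refine ⟨ff_nn hu.1, fun x y h1 h2 => ?_⟩
  have := hu.2 x y h1 h2; have := hu.1 x; have := P.p2
  unfold ff; rw [h1]; gcongr; linarith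

lemma ff_pow {α p ℓ : ℝ} (hu : ∀ x, 0 ≤ u x) (x : Euc N) : ff α p u x ^ ℓ = ‖x‖ ^ (α * ℓ) * u x ^ ((p - 1) * ℓ) := by
  rw [ff, mul_rpow (rpow_nonneg (norm_nonneg _) _) (rpow_nonneg (hu x) _), ← rpow_mul (norm_nonneg _), ← rpow_mul (hu x)]

lemma JJ_bd (P : PR n N α p) : ∃ C : ℝ, 0 < C ∧ ∀ u : Euc N → ℝ, AD n u →
    Integrable (fun x => ‖x‖ ^ α * u x ^ p) ∧ ∫ x, ‖x‖ ^ α * u x ^ p ≤ C := by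
  have := P.N2; have := P.hp1; have := P.hp2
  exact EE P.hn P.hN P.p2.le (by linarith) (by linarith)

lemma ff_Ll (P : PR n N α p) {ℓ : ℝ} (hℓ : 2 ≤ ℓ) (hB : 0 ≤ B) : ∃ C : ℝ, 0 < C ∧ ∀ u : Euc N → ℝ, AD n u → (∀ x, u x ≤ B) →
    Integrable (fun x => ff α p u x ^ ℓ) ∧ ∫ x, ff α p u x ^ ℓ ≤ C := by
  have h0 := P.N2; have h1 := P.hp1; have h2 := P.p2; have h3 := P.n2; have h4 := P.hα
  have hq : 2 ≤ (p - 1) * ℓ := by nlinarith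
  obtain ⟨C, hC, h⟩ := EE (N := N) P.hn P.hN (q := (p - 1) * ℓ) (e := (n - 1) * ((p - 1) * ℓ) - N + 2) hq (by linarith) le_rfl
  have hb : IntegrableOn (fun _ : Euc N => B ^ ((p - 1) * ℓ)) (Metric.closedBall 0 1) := by
    refine integrableOn_const ?_
    exact measure_closedBall_lt_top.ne
  have hb' : Integrable ((Metric.closedBall (0 : Euc N) 1).indicator fun _ => B ^ ((p - 1) * ℓ)) :=
    hb.integrable_indicator measurableSet_closedBall
  refine ⟨C + |∫ x, (Metric.closedBall (0 : Euc N) 1).indicator (fun _ => B ^ ((p - 1) * ℓ)) x|, by positivity, fun u hu huB => ?_⟩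
  obtain ⟨hi, hle⟩ := h u hu
  have hpt : ∀ x, ff α p u x ^ ℓ ≤ ‖x‖ ^ ((n - 1) * ((p - 1) * ℓ) - N + 2 : ℝ) * u x ^ ((p - 1) * ℓ) + (Metric.closedBall (0 : Euc N) 1).indicator (fun _ => B ^ ((p - 1) * ℓ)) x := by
    intro x
    have hux := hu.kc.1 x
    rw [ff_pow hu.kc.1]
    have hu0 : 0 ≤ u x ^ ((p - 1) * ℓ) := rpow_nonneg hux _
    have hr0 : 0 ≤ ‖x‖ ^ ((n - 1) * ((p - 1) * ℓ) - N + 2 : ℝ) := rpow_nonneg (norm_nonneg _) _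
    by_cases hx : ‖x‖ ≤ 1
    · rw [indicator_of_mem (by simpa using hx)]
      have : ‖x‖ ^ (α * ℓ) * u x ^ ((p - 1) * ℓ) ≤ 1 * B ^ ((p - 1) * ℓ) := by
        gcongr
        · exact rpow_le_one (norm_nonneg _) hx (by positivity)
        · exact huB x
      nlinarith [mul_nonneg hr0 hu0]
    · rw [indicator_of_notMem (by simpa using hx), add_zero]
      push Not at hx
      gcongr
      · exact hx.le
      · nlinarith
  have hc : AEStronglyMeasurable (fun x => ff α p u x ^ ℓ) volume :=
    ((ff_cont P hu.h1.1).rpow_const fun x => Or.inr (by linarith)).aestronglyMeasurable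
  have hint : Integrable (fun x => ff α p u x ^ ℓ) := (hi.add hb').mono' hc (.of_forall fun x => by
    rw [Real.norm_of_nonneg (rpow_nonneg (ff_nn hu.kc.1 x) _)]; exact hpt x)
  refine ⟨hint, (integral_mono hint (hi.add hb') hpt).trans ?_⟩
  rw [integral_add' hi hb']
  exact add_le_add hle (le_abs_self _)

lemma ff_RG (P : PR n N α p) (hB : 0 ≤ B) : ∃ Q : ℝ, 0 < Q ∧ ∀ u : Euc N → ℝ, AD n u → (∀ x, u x ≤ B) →
    RG (ff α p u) Q ∧ ∫ x, ff α p u x ^ 2 ≤ Q := by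
  have hN4 : (4:ℝ) ≤ N := by have := P.N2; have := P.n2; linarith
  obtain ⟨C, hC, h⟩ := ff_Ll P (ℓ := 2 * N) (by linarith) hB
  obtain ⟨C2, hC2, h2⟩ := ff_Ll P (ℓ := 2) le_rfl hB
  refine ⟨2 * C ^ (1 / (2 * N) : ℝ) + C2, by positivity, fun u hu huB => ?_⟩
  obtain ⟨i1, l1⟩ := h u hu huB
  obtain ⟨i2, l2⟩ := h2 u hu huB
  simp only [Real.rpow_two] at i2 l2
  have hC0 : 0 ≤ C ^ (1 / (2 * N) : ℝ) := by positivity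
  refine ⟨⟨ff_cont P hu.h1.1, ff_nn hu.kc.1, i2, fun τ hτ x => ?_⟩, by linarith⟩
  have := (PP_sup (q := 2 * N) (by linarith) (ff_cont P hu.h1.1).aestronglyMeasurable (ff_nn hu.kc.1) i1 (Q := C ^ (1 / (2 * N) : ℝ)) (by positivity)
    (by rw [← rpow_mul hC.le]; rw [one_div_mul_cancel (by positivity), rpow_one]; exact l1)).2 τ hτ x
  rw [show -(N:ℝ) / (2 * (2 * N)) = -(1 / 4) by field_simp; norm_num] at this
  have h5 : 0 < τ ^ (-(1 / 4) : ℝ) := by positivity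
  nlinarith

lemma sup_improve (P : PR n N α p) : ∃ σ C : ℝ, 0 ≤ σ ∧ σ < 1 ∧ 0 < C ∧ ∀ u : Euc N → ℝ, AD n u → ∀ B, 1 ≤ B → (∀ x, u x ≤ B) →
    ∀ x, TT (ff α p u) x ≤ C * B ^ σ := by
  have h0 := P.N2; have h1 := P.hp1; have h2 := P.p2; have h3 := P.n2; have h4 := P.hα; have h5 := P.hp2
  obtain ⟨σ, hσ0, hσ1, hσ2⟩ : ∃ σ : ℝ, 0 ≤ σ ∧ σ < 1 ∧ (n - 1) * (p - 1 - σ) - α < 2 := by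
    have hn1 : (0:ℝ) < n - 1 := by linarith
    refine ⟨max 0 (1 - (2 * n + α - (n - 1) * p) / (2 * (n - 1))), le_max_left _ _, max_lt one_pos ?_, ?_⟩
    · have : 0 < (2 * n + α - (n - 1) * p) / (2 * (n - 1)) := div_pos (by linarith) (by linarith)
      linarith
    · have := le_max_right 0 (1 - (2 * n + α - (n - 1) * p) / (2 * (n - 1)))
      have h6 := mul_le_mul_of_nonneg_left this hn1.le
      have h7 : (n - 1) * (1 - (2 * n + α - (n - 1) * p) / (2 * (n - 1))) = (n - 1) - (2 * n + α - (n - 1) * p) / 2 := by field_simp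
      rw [h7] at h6
      nlinarith
  set κ := (n - 1) * (p - 1 - σ) - α with hκ
  have hκ0 : 0 < κ := by rw [hκ]; nlinarith
  set ℓ := (N:ℝ) / κ with hl
  have hκl : κ * ℓ = N := by rw [hl]; field_simp
  have hln : (n:ℝ) < ℓ := by rw [hl, lt_div_iff₀ hκ0, h0]; nlinarith
  have hℓ2 : 2 ≤ ℓ := by linarith
  have hq : 2 ≤ (p - 1 - σ) * ℓ := by
    have h6 : (N:ℝ) ≤ (n - 1) * ((p - 1 - σ) * ℓ) := by rw [← hκl, hκ]; nlinarith
    by_contra h7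
    push Not at h7
    nlinarith
  have hq' : 2 ≤ (p - 1) * ℓ := by nlinarith
  obtain ⟨C1, hC1, H1⟩ := EE (N := N) P.hn P.hN (q := (p - 1) * ℓ) (e := (n - 1) * ((p - 1) * ℓ) - N + 2) hq' (by linarith) le_rfl
  obtain ⟨C2, hC2, H2⟩ := EE (N := N) P.hn P.hN (q := (p - 1 - σ) * ℓ) (e := (n - 1) * ((p - 1 - σ) * ℓ) - N) hq le_rfl (by linarith)
  have ha : (N:ℝ) / (2 * ℓ) < 1 := by rw [div_lt_one (by linarith)]; linarith
  have hw := wI_nonneg ((N:ℝ) / (2 * ℓ))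
  refine ⟨σ, 2 * (C1 + C2) ^ (1 / ℓ) * wI ((N:ℝ) / (2 * ℓ)) + 1, hσ0, hσ1, by positivity, fun u hu B hB huB x => ?_⟩
  have hB0 : 0 < B := by linarith
  obtain ⟨i1, l1⟩ := H1 u hu
  obtain ⟨i2, l2⟩ := H2 u hu
  have hpt : ∀ᵐ x, ff α p u x ^ ℓ ≤ ‖x‖ ^ ((n - 1) * ((p - 1) * ℓ) - N + 2 : ℝ) * u x ^ ((p - 1) * ℓ) +
      B ^ (σ * ℓ) * (‖x‖ ^ ((n - 1) * ((p - 1 - σ) * ℓ) - N : ℝ) * u x ^ ((p - 1 - σ) * ℓ)) := by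
    filter_upwards [P.ae0] with x hx
    have hx0 : 0 < ‖x‖ := norm_pos_iff.2 hx
    have hux := hu.kc.1 x
    rw [ff_pow hu.kc.1]
    by_cases hx : ‖x‖ ≤ 1
    · have e1 : u x ^ ((p - 1) * ℓ) ≤ B ^ (σ * ℓ) * u x ^ ((p - 1 - σ) * ℓ) := by
        have : u x ^ ((p - 1) * ℓ) = u x ^ (σ * ℓ) * u x ^ ((p - 1 - σ) * ℓ) := by
          rw [← rpow_add_of_nonneg hux (by positivity) (by linarith)]; congr 1; ring
        rw [this]
        gcongr
        exact huB x
      have e2 : ‖x‖ ^ (α * ℓ) ≤ ‖x‖ ^ ((n - 1) * ((p - 1 - σ) * ℓ) - N : ℝ) := by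
        apply rpow_le_rpow_of_exponent_ge hx0 hx
        rw [← hκl, hκ]; linarith
      have e3 : 0 ≤ ‖x‖ ^ ((n - 1) * ((p - 1) * ℓ) - N + 2 : ℝ) * u x ^ ((p - 1) * ℓ) := by positivity
      have e4 : ‖x‖ ^ (α * ℓ) * u x ^ ((p - 1) * ℓ) ≤ ‖x‖ ^ ((n - 1) * ((p - 1 - σ) * ℓ) - N : ℝ) * (B ^ (σ * ℓ) * u x ^ ((p - 1 - σ) * ℓ)) := by gcongr
      linarith
    · push Not at hx
      have e3 : 0 ≤ B ^ (σ * ℓ) * (‖x‖ ^ ((n - 1) * ((p - 1 - σ) * ℓ) - N : ℝ) * u x ^ ((p - 1 - σ) * ℓ)) := by positivity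
      have e4 : ‖x‖ ^ (α * ℓ) * u x ^ ((p - 1) * ℓ) ≤ ‖x‖ ^ ((n - 1) * ((p - 1) * ℓ) - N + 2 : ℝ) * u x ^ ((p - 1) * ℓ) := by
        gcongr
        · exact hx.le
        · nlinarith
      linarith
  have hc : AEStronglyMeasurable (fun x => ff α p u x ^ ℓ) volume :=
    ((ff_cont P hu.h1.1).rpow_const fun x => Or.inr (by linarith)).aestronglyMeasurable
  have hint : Integrable (fun x => ff α p u x ^ ℓ) := (i1.add (i2.const_mul (B ^ (σ * ℓ)))).mono' hc (by
    filter_upwards [hpt] with x hx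
    rw [Real.norm_of_nonneg (rpow_nonneg (ff_nn hu.kc.1 x) _)]; exact hx)
  have hle : ∫ x, ff α p u x ^ ℓ ≤ ((C1 + C2) ^ (1 / ℓ) * B ^ σ) ^ ℓ := by
    refine (integral_mono_ae hint (i1.add (i2.const_mul (B ^ (σ * ℓ)))) hpt).trans ?_
    rw [integral_add' i1 (i2.const_mul (B ^ (σ * ℓ))), integral_const_mul, mul_rpow (by positivity) (by positivity), ← rpow_mul (by positivity),
      one_div_mul_cancel (by linarith), rpow_one, ← rpow_mul hB0.le]
    have : 1 ≤ B ^ (σ * ℓ) := one_le_rpow hB (by positivity)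
    nlinarith [mul_le_mul_of_nonneg_left l2 (by linarith : 0 ≤ B ^ (σ * ℓ))]
  have hPP := (PP_sup (q := ℓ) (by linarith) (ff_cont P hu.h1.1).aestronglyMeasurable (ff_nn hu.kc.1) hint (Q := (C1 + C2) ^ (1 / ℓ) * B ^ σ) (by positivity) hle).2
  have := (tint (Q := 2 * ((C1 + C2) ^ (1 / ℓ) * B ^ σ)) (ff_cont P hu.h1.1) (ff_nn hu.kc.1) ha (x := x) (fun τ hτ => by
    have := hPP τ hτ x; rwa [neg_div] at this)).2
  have hB3 : 0 < B ^ σ := by positivity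
  nlinarith

lemma fatou {gk : ℕ → Euc N → ℝ} {g : Euc N → ℝ} {C : ℝ} (h0 : ∀ k x, 0 ≤ gk k x) (hi : ∀ k, Integrable (gk k))
    (hC : ∀ k, ∫ x, gk k x ≤ C) (hl : ∀ x, Tendsto (fun k => gk k x) atTop (nhds (g x))) : Integrable g ∧ ∫ x, g x ≤ C := by
  have hm : AEStronglyMeasurable g volume := aestronglyMeasurable_of_tendsto_ae atTop (fun k => (hi k).1) (.of_forall hl)
  have hg0 : ∀ x, 0 ≤ g x := fun x => ge_of_tendsto' (hl x) fun k => h0 k x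
  have hC0 : 0 ≤ C := (integral_nonneg (h0 0)).trans (hC 0)
  have key : ∫⁻ x, ENNReal.ofReal (g x) ≤ ENNReal.ofReal C := by
    calc _ = ∫⁻ x, liminf (fun k => ENNReal.ofReal (gk k x)) atTop := by
          congr 1; ext x
          exact ((ENNReal.tendsto_ofReal (hl x)).liminf_eq).symm
      _ ≤ liminf (fun k => ∫⁻ x, ENNReal.ofReal (gk k x)) atTop :=
          lintegral_liminf_le' fun k => (hi k).1.aemeasurable.ennreal_ofReal
      _ ≤ _ := by
          refine liminf_le_of_le (by isBoundedDefault) fun b hb => ?_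
          obtain ⟨k, hk⟩ := hb.exists
          refine hk.trans ?_
          rw [← ofReal_integral_eq_lintegral_ofReal (hi k) (.of_forall (h0 k))]
          exact ENNReal.ofReal_le_ofReal (hC k)
  refine ⟨⟨hm, ?_⟩, ?_⟩
  · rw [hasFiniteIntegral_iff_ofReal (.of_forall hg0)]
    exact key.trans_lt ENNReal.ofReal_lt_top
  · rw [integral_eq_lintegral_of_nonneg_ae (.of_forall hg0) hm]
    exact ENNReal.toReal_le_of_le_ofReal hC0 key

lemma RG_lim {fk : ℕ → Euc N → ℝ} {B Q : ℝ} (hR : ∀ k, RG (fk k) Q) (hQ : ∀ k, ∫ x, fk k x ^ 2 ≤ Q)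
    (hb : ∀ k x, |fk k x| ≤ B) (hl : ∀ x, Tendsto (fun k => fk k x) atTop (nhds (f x))) (hc : Continuous f) : RG f Q := by
  refine ⟨hc, fun x => ge_of_tendsto' (hl x) fun k => (hR k).nn x, ?_, fun τ hτ x => ?_⟩
  · exact (fatou (fun k x => sq_nonneg _) (fun k => (hR k).sq) hQ fun x => (hl x).pow 2).1
  · refine le_of_tendsto' (?_ : Tendsto (fun k => PP τ (fk k) x) atTop (nhds (PP τ f x))) fun k => (hR k).sup τ hτ x
    refine tendsto_integral_of_dominated_convergence (fun y => B * gk τ (x - y)) (fun k => ?_) ((gk_integrable_sub hτ x).const_mul B) (fun k => ?_) ?_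
    · exact ((hR k).cont.mul ((gk_continuous τ).comp (continuous_const.sub continuous_id))).aestronglyMeasurable
    · refine .of_forall fun y => ?_
      rw [norm_mul, Real.norm_of_nonneg (gk_nonneg hτ _)]
      exact mul_le_mul_of_nonneg_right (hb k y) (gk_nonneg hτ _)
    · exact .of_forall fun y => (hl y).mul_const _

lemma rpow_diff {a b β : ℝ} (ha : 0 ≤ a) (hb : 0 ≤ b) (hβ : 1 ≤ β) : |a ^ β - b ^ β| ≤ β * max a b ^ (β - 1) * |a - b| := by
  wlog h : b ≤ a generalizing a b
  · rw [abs_sub_comm, max_comm, abs_sub_comm a]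
    exact this hb ha (by linarith)
  rw [max_eq_left h, abs_of_nonneg (sub_nonneg.2 h), abs_of_nonneg (sub_nonneg.2 (rpow_le_rpow hb h (by linarith)))]
  rcases ha.eq_or_lt with rfl | ha
  · have : b = 0 := le_antisymm h hb
    subst this; simp
  have hB := one_add_mul_self_le_rpow_one_add (s := b / a - 1) (by have := div_nonneg hb ha.le; linarith) hβ
  rw [show 1 + (b / a - 1) = b / a by ring, div_rpow hb ha.le, le_div_iff₀ (rpow_pos_of_pos ha _)] at hB
  have : a ^ β = a ^ (β - 1) * a := by rw [← rpow_add_one ha.ne']; ring_nf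
  have h2 : (1 + β * (b / a - 1)) * a ^ β = a ^ β - β * a ^ (β - 1) * (a - b) := by
    rw [this]; field_simp; ring
  linarith

lemma decay (P : PR n N α p) {B L : ℝ} (hB : 0 < B) (hL : 2 * B ≤ L) : ∃ C : ℝ, 0 < C ∧ ∀ u : Euc N → ℝ, AD n u →
    (∀ x, u x ≤ B) → (∀ x y, |u x - u y| ≤ L * ‖x - y‖) → ∀ x, ‖x‖ ^ α * u x ^ (p - 2) ≤ C := by
  have h0 := P.N2; have h1 := P.hp1; have h2 := P.p2; have h3 := P.n2; have h4 := P.hα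
  have hk : 0 < (n - 1) * (p - 2) - α := by linarith
  obtain ⟨q, hq1, hq2⟩ : ∃ q : ℝ, 4 ≤ q ∧ N * (α + p - 2) ≤ q * ((n - 1) * (p - 2) - α) :=
    ⟨max 4 (N * (α + p - 2) / ((n - 1) * (p - 2) - α)), le_max_left _ _, (div_le_iff₀ hk).1 (le_max_right _ _)⟩
  obtain ⟨C, hC, hE⟩ := EE (N := N) P.hn P.hN (q := q) (e := (n - 1) * q - N) (by linarith) le_rfl (by linarith)
  set e : ℝ := (n - 1) * q - N with he
  have he0 : 0 ≤ e := by nlinarith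
  have hN0 : (0:ℝ) < N := by linarith
  have hqN : 0 < q + N := by linarith
  have : Nontrivial (Euc N) := by
    have : Nonempty (Fin N) := ⟨⟨0, by have := P.hn; have := P.hN; omega⟩⟩
    infer_instance
  set V : ℝ := (volume (Metric.ball (0 : Euc N) 1)).toReal with hV
  have hV0 : 0 < V := ENNReal.toReal_pos (Metric.measure_ball_pos _ _ one_pos).ne' measure_ball_lt_top.ne
  have hL0 : 0 < L := by linarith
  set C1 : ℝ := C * 2 ^ e * 2 ^ q * (2 * L) ^ N / V with hC1
  have hC10 : 0 < C1 := by positivity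
  refine ⟨B ^ (p - 2) + (C1 ^ (1 / (q + N))) ^ (p - 2), by positivity, fun u hu huB huL x => ?_⟩
  have hB2 : 0 < B ^ (p - 2) := by positivity
  have hC2 : 0 < (C1 ^ (1 / (q + N))) ^ (p - 2) := by positivity
  have hux := hu.kc.1 x
  rcases le_total ‖x‖ 1 with hx | hx
  · have e1 : ‖x‖ ^ α ≤ 1 := rpow_le_one (norm_nonneg _) hx h4.le
    have e2 : u x ^ (p - 2) ≤ B ^ (p - 2) := rpow_le_rpow hux (huB x) (by linarith)
    have := mul_le_mul e1 e2 (by positivity) zero_le_one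
    linarith
  rcases hux.eq_or_lt with hh | hh
  · rw [← hh, zero_rpow (by linarith)]; simp; positivity
  set h := u x with hhdef
  set ρ : ℝ := h / (2 * L) with hρ
  have hρ0 : 0 < ρ := by positivity
  have hρ1 : ρ ≤ 1 / 4 := by
    rw [hρ, div_le_iff₀ (by positivity)]
    have := huB x; linarith
  obtain ⟨hi, hle⟩ := hE u hu
  have hlow : ∀ y ∈ Metric.ball x ρ, (‖x‖ / 2) ^ e * (h / 2) ^ q ≤ ‖y‖ ^ e * u y ^ q := by
    intro y hy
    rw [Metric.mem_ball, dist_eq_norm] at hy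
    have a1 : ‖x‖ - ‖y‖ ≤ ‖y - x‖ := by rw [norm_sub_rev]; exact norm_sub_norm_le _ _
    have a2 : h / 2 ≤ u y := by
      have := (le_abs_self _).trans (huL x y)
      rw [norm_sub_rev] at this
      have h5 : L * ‖y - x‖ ≤ L * ρ := by gcongr
      have h6 : L * ρ = h / 2 := by rw [hρ]; field_simp
      linarith
    gcongr
    linarith
  have hint := setIntegral_ge_of_const_le_real measurableSet_ball measure_ball_lt_top.ne hlow hi.integrableOn
  have hint2 := hint.trans ((setIntegral_le_integral hi (.of_forall fun y => mul_nonneg (rpow_nonneg (norm_nonneg _) _) (rpow_nonneg (hu.kc.1 y) _))).trans hle)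
  rw [Measure.real, Measure.addHaar_ball _ _ hρ0.le, ENNReal.toReal_mul, ENNReal.toReal_ofReal (by positivity), finrank_euclideanSpace_fin, ← hV] at hint2
  have hx0 : 0 < ‖x‖ := by linarith
  have hfin : ‖x‖ ^ e * h ^ (q + N) ≤ C1 := by
    rw [hC1, le_div_iff₀ hV0, rpow_add hh, rpow_natCast]
    rw [hρ, div_pow, div_rpow hx0.le (by norm_num), div_rpow hh.le (by norm_num)] at hint2
    have e3 : ‖x‖ ^ e * (h ^ q * h ^ N) * V = (h ^ N / (2 * L) ^ N * V * (‖x‖ ^ e / 2 ^ e * (h ^ q / 2 ^ q))) * (2 ^ e * 2 ^ q * (2 * L) ^ N) := by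
      field_simp
    rw [e3]
    calc _ ≤ C * (2 ^ e * 2 ^ q * (2 * L) ^ N) := by gcongr; linarith
      _ = _ := by ring
  have hroot : ‖x‖ ^ (e / (q + N)) * h ≤ C1 ^ (1 / (q + N)) := by
    have := rpow_le_rpow (by positivity) hfin (by positivity : 0 ≤ 1 / (q + N))
    rw [mul_rpow (by positivity) (by positivity), ← rpow_mul hx0.le, ← rpow_mul hh.le, mul_one_div, mul_one_div_cancel hqN.ne', rpow_one] at this
    exact this
  have h7 := rpow_le_rpow (by positivity) hroot (by linarith : 0 ≤ p - 2)
  rw [mul_rpow (by positivity) hh.le, ← rpow_mul hx0.le] at h7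
  have h8 : ‖x‖ ^ α ≤ ‖x‖ ^ (e / (q + N) * (p - 2)) := by
    apply rpow_le_rpow_of_exponent_le hx
    rw [div_mul_eq_mul_div, le_div_iff₀ hqN, he]
    linarith
  have h9 : ‖x‖ ^ α * h ^ (p - 2) ≤ ‖x‖ ^ (e / (q + N) * (p - 2)) * h ^ (p - 2) := by gcongr
  linarith

section
variable {n : ℕ} {α p : ℝ} (P : PR n N α p) {u : Euc N → ℝ} {B L C : ℝ} (h0 : ∀ x, 0 ≤ u x) (hB : ∀ x, u x ≤ B)
  (hC : ∀ x, ‖x‖ ^ α * u x ^ (p - 2) ≤ C)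
include P h0 hB hC

lemma ff_le (x : Euc N) : |ff α p u x| ≤ C * B := by
  rw [abs_of_nonneg (ff_nn h0 x), ff]
  have h2 := P.p2
  have : u x ^ (p - 1) = u x ^ (p - 2) * u x := by
    rw [← rpow_add_one' (h0 x) (by linarith)]; ring_nf
  rw [this, ← mul_assoc]
  exact mul_le_mul (hC x) (hB x) (h0 x) ((mul_nonneg (rpow_nonneg (norm_nonneg _) _) (rpow_nonneg (h0 x) _)).trans (hC x))

lemma ff_holder (hL : ∀ x y, |u x - u y| ≤ L * ‖x - y‖) (hL0 : 0 ≤ L) : ∃ H : ℝ, 0 ≤ H ∧ ∀ x y, |ff α p u x - ff α p u y| ≤ H * ‖x - y‖ ^ (min α 1) := by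
  have h2 := P.p2; have h4 := P.hα
  have hB0 : 0 ≤ B := (h0 0).trans (hB 0)
  have hC0 : 0 ≤ C := (mul_nonneg (rpow_nonneg (norm_nonneg _) _) (rpow_nonneg (h0 0) _)).trans (hC 0)
  have hγ : 0 < min α 1 := lt_min h4 one_pos
  set D : ℝ := 2 ^ α * (C + B ^ (p - 2)) with hD
  have hBp : 0 ≤ B ^ (p - 2) := rpow_nonneg hB0 _
  have h2α : 1 ≤ (2:ℝ) ^ α := one_le_rpow (by norm_num) h4.le
  have hCD : C ≤ D := by rw [hD]; nlinarith
  have hD0 : 0 ≤ D := hC0.trans hCD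
  have hmix : ∀ x y : Euc N, ‖x - y‖ ≤ 1 → ‖x‖ ^ α * u y ^ (p - 2) ≤ D := by
    intro x y hxy
    have e1 : ‖x‖ ≤ 2 * max ‖y‖ 1 := by
      have := norm_sub_norm_le x y
      have := le_max_left ‖y‖ 1; have := le_max_right ‖y‖ 1; linarith
    have e2 : ‖x‖ ^ α ≤ 2 ^ α * (‖y‖ ^ α + 1) := by
      refine (rpow_le_rpow (norm_nonneg _) e1 h4.le).trans ?_
      rw [mul_rpow (by norm_num) (by positivity)]
      gcongr
      rcases max_choice ‖y‖ 1 with h | h <;> rw [h]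
      · linarith
      · rw [one_rpow]; have : 0 ≤ ‖y‖ ^ α := by positivity
        linarith
    have e3 : u y ^ (p - 2) ≤ B ^ (p - 2) := rpow_le_rpow (h0 y) (hB y) (by linarith)
    have hy0 : 0 ≤ u y ^ (p - 2) := rpow_nonneg (h0 y) _
    calc _ ≤ 2 ^ α * (‖y‖ ^ α + 1) * u y ^ (p - 2) := by gcongr
      _ = 2 ^ α * (‖y‖ ^ α * u y ^ (p - 2) + u y ^ (p - 2)) := by ring
      _ ≤ _ := by rw [hD]; gcongr; exact hC y
  refine ⟨2 * (C * B) + ((p - 1) * D * L + (B ^ (p - 1) + α * (D + B ^ (p - 2)) * B)), by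
    have : 0 ≤ p - 1 := by linarith
    positivity, fun x y => ?_⟩
  have hp1 : 0 ≤ p - 1 := by linarith
  set d := ‖x - y‖ with hd
  have hd0 : 0 ≤ d := norm_nonneg _
  have hdg : 0 ≤ d ^ (min α 1) := by positivity
  have hR1 : 0 ≤ (p - 1) * D * L + (B ^ (p - 1) + α * (D + B ^ (p - 2)) * B) := by positivity
  have hR2 : 0 ≤ 2 * (C * B) := by positivity
  rcases le_total 1 d with h1 | h1
  · have := one_le_rpow h1 hγ.le
    have a1 := ff_le P h0 hB hC x
    have a2 := ff_le P h0 hB hC y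
    have := abs_sub (ff α p u x) (ff α p u y)
    nlinarith
  have hdle : d ≤ d ^ (min α 1) := by
    rcases hd0.eq_or_lt with h | h
    · rw [← h, zero_rpow hγ.ne']
    · conv_lhs => rw [← rpow_one d]
      exact rpow_le_rpow_of_exponent_ge h h1 (min_le_right _ _)
  have hsp : ff α p u x - ff α p u y = ‖x‖ ^ α * (u x ^ (p - 1) - u y ^ (p - 1)) + (‖x‖ ^ α - ‖y‖ ^ α) * u y ^ (p - 1) := by
    simp only [ff]; ring
  have t1 : |‖x‖ ^ α * (u x ^ (p - 1) - u y ^ (p - 1))| ≤ (p - 1) * D * L * d := by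
    rw [abs_mul, abs_of_nonneg (by positivity : 0 ≤ ‖x‖ ^ α)]
    have r := rpow_diff (h0 x) (h0 y) (by linarith : 1 ≤ p - 1)
    rw [show p - 1 - 1 = p - 2 by ring] at r
    have m : ‖x‖ ^ α * max (u x) (u y) ^ (p - 2) ≤ D := by
      rcases max_choice (u x) (u y) with h | h <;> rw [h]
      · exact (hC x).trans hCD
      · exact hmix x y h1
    have m0 : 0 ≤ max (u x) (u y) ^ (p - 2) := rpow_nonneg ((h0 x).trans (le_max_left _ _)) _
    calc _ ≤ ‖x‖ ^ α * ((p - 1) * max (u x) (u y) ^ (p - 2) * (L * d)) :=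
          mul_le_mul_of_nonneg_left (r.trans (mul_le_mul_of_nonneg_left (hL x y) (by positivity))) (by positivity)
      _ = (p - 1) * (‖x‖ ^ α * max (u x) (u y) ^ (p - 2)) * L * d := by ring
      _ ≤ _ := by gcongr
  have t2 : |(‖x‖ ^ α - ‖y‖ ^ α) * u y ^ (p - 1)| ≤ (B ^ (p - 1) + α * (D + B ^ (p - 2)) * B) * d ^ (min α 1) := by
    have hy1 : u y ^ (p - 1) ≤ B ^ (p - 1) := rpow_le_rpow (h0 y) (hB y) hp1
    have hy0 : 0 ≤ u y ^ (p - 1) := rpow_nonneg (h0 y) _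
    have hB1 : 0 ≤ B ^ (p - 1) := by positivity
    have hk0 : 0 ≤ α * (D + B ^ (p - 2)) * B := by positivity
    rw [abs_mul, abs_of_nonneg hy0]
    have hnn : |‖x‖ - ‖y‖| ≤ d := abs_norm_sub_norm_le x y
    rcases le_total α 1 with hα | hα
    · rw [min_eq_left hα] at hdg ⊢
      have : |‖x‖ ^ α - ‖y‖ ^ α| ≤ d ^ α := by
        have key : ∀ a b : ℝ, 0 ≤ a → 0 ≤ b → |a - b| ≤ d → a ^ α - b ^ α ≤ d ^ α := by
          intro a b ha hb hab
          have e1 : a ≤ b + d := by have := (le_abs_self _).trans hab; linarith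
          have := (rpow_le_rpow ha e1 h4.le).trans (rpow_add_le_add_rpow hb hd0 h4.le hα)
          linarith
        rw [abs_le]
        constructor
        · have := key ‖y‖ ‖x‖ (norm_nonneg _) (norm_nonneg _) (by rw [abs_sub_comm]; exact hnn)
          linarith
        · exact key _ _ (norm_nonneg _) (norm_nonneg _) hnn
      have := mul_le_mul this hy1 hy0 hdg
      nlinarith
    · rw [min_eq_right hα] at hdg ⊢
      rw [rpow_one] at hdg ⊢
      have r := rpow_diff (norm_nonneg x) (norm_nonneg y) hα
      set m := max ‖x‖ ‖y‖ with hm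
      have hm0 : 0 ≤ m := (norm_nonneg x).trans (le_max_left _ _)
      have m1 : m ^ (α - 1) ≤ m ^ α + 1 := by
        have : 0 ≤ m ^ α := by positivity
        rcases le_total m 1 with h | h
        · have := rpow_le_one hm0 h (by linarith : 0 ≤ α - 1); linarith
        · have := rpow_le_rpow_of_exponent_le h (by linarith : α - 1 ≤ α); linarith
      have m2 : m ^ α * u y ^ (p - 2) ≤ D := by
        rcases max_choice ‖x‖ ‖y‖ with h | h <;> rw [hm, h]
        · exact hmix x y h1
        · exact (hC y).trans hCD
      have e3 : u y ^ (p - 2) ≤ B ^ (p - 2) := rpow_le_rpow (h0 y) (hB y) (by linarith)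
      have hy2 : 0 ≤ u y ^ (p - 2) := rpow_nonneg (h0 y) _
      have hs : u y ^ (p - 1) = u y ^ (p - 2) * u y := by
        rw [← rpow_add_one' (h0 y) (by linarith)]; ring_nf
      calc _ ≤ α * (m ^ α + 1) * d * u y ^ (p - 1) := by
            refine mul_le_mul_of_nonneg_right (r.trans (mul_le_mul ?_ hnn (abs_nonneg _) (by positivity))) hy0
            gcongr
        _ = α * (m ^ α * u y ^ (p - 2) + u y ^ (p - 2)) * u y * d := by rw [hs]; ring
        _ ≤ α * (D + B ^ (p - 2)) * B * d := by gcongr; exacts [h0 y, hB y]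
        _ ≤ _ := by nlinarith
  rw [hsp]
  refine (abs_add_le _ _).trans ((add_le_add t1 t2).trans ?_)
  have : (p - 1) * D * L * d ≤ (p - 1) * D * L * d ^ (min α 1) := by gcongr
  nlinarith
end

def JJ (α p : ℝ) (u : Euc N → ℝ) : ℝ := ∫ x, ‖x‖ ^ α * u x ^ p
def II (v u : Euc N → ℝ) : ℝ := ∫ x, (inner ℝ (gradient v x) (gradient u x) + v x * u x)

lemma grad_comb {v u : Euc N → ℝ} (hv : ∀ x, DifferentiableAt ℝ v x) (hu : ∀ x, DifferentiableAt ℝ u x) (c : ℝ) (x : Euc N) :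
    gradient (fun x => v x - c * u x) x = gradient v x - c • gradient u x := by
  unfold gradient
  have : HasFDerivAt (fun x => v x - c * u x) (fderiv ℝ v x - c • fderiv ℝ u x) x := (hv x).hasFDerivAt.sub ((hu x).hasFDerivAt.const_mul c)
  rw [this.fderiv]; simp

lemma nsq_comb (a b : Euc N) (c : ℝ) : ‖a - c • b‖ ^ 2 = ‖a‖ ^ 2 - 2 * c * inner ℝ a b + c ^ 2 * ‖b‖ ^ 2 := by
  rw [norm_sub_sq_real, inner_smul_right, norm_smul, mul_pow, Real.norm_eq_abs, sq_abs]; ring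

lemma II_int {v u : Euc N → ℝ} (hv : MemH1 v) (hu : MemH1 u) : Integrable (fun x => inner ℝ (gradient v x) (gradient u x)) ∧ Integrable (fun x => v x * u x) := by
  refine ⟨?_, int_mul_of_sq hv.aesm hu.aesm hv.2.2.2 hu.2.2.2⟩
  have := int_mul_of_sq (meas_ngrad v) (meas_ngrad u) hv.2.2.1 hu.2.2.1
  refine this.mono' ((meas_grad v).inner (meas_grad u)).aestronglyMeasurable (.of_forall fun x => norm_inner_le_norm _ _)

lemma MemH1.comb {v u : Euc N → ℝ} (hv : MemH1 v) (hu : MemH1 u) (c : ℝ) :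
    MemH1 (fun x => v x - c * u x) ∧ N2 (fun x => v x - c * u x) = N2 v - 2 * c * II v u + c ^ 2 * N2 u := by
  obtain ⟨i1, i2⟩ := II_int hv hu
  have g := grad_comb hv.2.1 hu.2.1 c
  refine ⟨⟨hv.1.sub (continuous_const.mul hu.1), fun x => (hv.2.1 x).sub ((hu.2.1 x).const_mul c), ?_, ?_⟩, ?_⟩
  · simp only [g, nsq_comb]
    exact iadd (isub hv.2.2.1 (i1.const_mul _)) (hu.2.2.1.const_mul _)
  · refine (iadd (isub hv.2.2.2 (i2.const_mul (2 * c))) (hu.2.2.2.const_mul (c ^ 2))).congr (.of_forall fun x => ?_)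
    simp only; ring
  · unfold N2 II
    rw [← integral_const_mul, ← integral_const_mul, ← integral_sub hv.n2int ((iadd i1 i2).const_mul _),
      ← integral_add (isub hv.n2int ((iadd i1 i2).const_mul _)) (hu.n2int.const_mul _)]
    congr 1; ext x
    rw [g, nsq_comb]; ring

lemma N2_nn (u : Euc N → ℝ) : 0 ≤ N2 u := integral_nonneg fun x => by positivity

lemma MemH1.zero : MemH1 (fun _ : Euc N => (0:ℝ)) :=
  ⟨continuous_const, fun x => differentiableAt_const _, by simp [gradient], by simp⟩

lemma MemH1.cmul (hu : MemH1 u) (c : ℝ) : MemH1 (fun x => c * u x) ∧ N2 (fun x => c * u x) = c ^ 2 * N2 u := by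
  have := MemH1.zero.comb hu (-c)
  have e : N2 (fun _ : Euc N => (0:ℝ)) = 0 := by simp [N2, gradient]
  have e2 : II (fun _ : Euc N => (0:ℝ)) u = 0 := by simp [II, gradient]
  simpa [e, e2] using this

lemma II_cs {v u : Euc N → ℝ} (hv : MemH1 v) (hu : MemH1 u) : II v u ^ 2 ≤ N2 v * N2 u := by
  have h : ∀ c : ℝ, 0 ≤ N2 u * (c * c) + (-2 * II v u) * c + N2 v := fun c => by
    have := N2_nn (fun x => v x - c * u x)
    rw [(hv.comb hu c).2] at this; nlinarith
  have := discrim_le_zero h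
  unfold discrim at this
  nlinarith

lemma sqrtN2_sub {v u : Euc N → ℝ} (hv : MemH1 v) (hu : MemH1 u) : |√(N2 v) - √(N2 u)| ≤ √(N2 (fun x => v x - u x)) := by
  have e := (hv.comb hu 1).2
  simp only [one_mul] at e
  rw [e]
  refine abs_le_sqrt ?_
  have h := II_cs hv hu
  have h1 : II v u ≤ √(N2 v) * √(N2 u) := by
    rw [← sqrt_mul (N2_nn v)]; exact le_sqrt_of_sq_le h
  have := sq_sqrt (N2_nn v); have := sq_sqrt (N2_nn u)
  nlinarith

lemma N2_zero (hu : MemH1 u) (h : N2 u = 0) : u = fun _ => 0 := by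
  have h1 := hu.le_N2.2
  have h2 : ∫ x, u x ^ 2 = 0 := le_antisymm (h1.trans h.le) (integral_nonneg fun x => sq_nonneg _)
  rw [integral_eq_zero_iff_of_nonneg (fun x => sq_nonneg _) hu.2.2.2] at h2
  have := (hu.1.pow 2).ae_eq_iff_eq volume (continuous_const (y := (0:ℝ))) |>.1 h2
  ext x
  simpa using congrFun this x

lemma KC.cmul (h : KC n u) {c : ℝ} (hc : 0 ≤ c) : KC n (fun x => c * u x) :=
  ⟨fun x => mul_nonneg hc (h.1 x), fun x y h1 h2 => mul_le_mul_of_nonneg_left (h.2 x y h1 h2) hc⟩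

lemma JJ_cmul (h : ∀ x, 0 ≤ u x) {c : ℝ} (hc : 0 ≤ c) : JJ α p (fun x => c * u x) = c ^ p * JJ α p u := by
  unfold JJ
  rw [← integral_const_mul]
  congr 1; ext x
  rw [mul_rpow hc (h x)]; ring

lemma AD.norm (h : MemH1 u) (hk : KC n u) (h0 : 0 < N2 u) : AD n (fun x => (√(N2 u))⁻¹ * u x) := by
  obtain ⟨a, b⟩ := h.cmul (√(N2 u))⁻¹
  refine ⟨a, hk.cmul (by positivity), ?_⟩
  rw [b, inv_pow, sq_sqrt h0.le, inv_mul_cancel₀ h0.ne']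

lemma JJ_pos (P : PR n N α p) (hu : ∀ x, 0 < u x) (hi : Integrable fun x => ‖x‖ ^ α * u x ^ p) : 0 < JJ α p u := by
  unfold JJ
  rw [integral_pos_iff_support_of_nonneg (fun x => mul_nonneg (rpow_nonneg (norm_nonneg _) _) (rpow_nonneg (hu x).le _)) hi]
  have : ∀ᵐ x : Euc N, x ∈ Function.support (fun x => ‖x‖ ^ α * u x ^ p) := by
    filter_upwards [P.ae0] with x hx
    have := norm_pos_iff.2 hx
    have := hu x
    simp only [Function.mem_support]; positivity
  have h : volume (Function.support (fun x : Euc N => ‖x‖ ^ α * u x ^ p)) = volume univ := measure_congr (eventuallyEq_univ.2 this)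
  rw [h]
  exact isOpen_univ.measure_pos _ ⟨0, trivial⟩

lemma gk_AD (P : PR n N α p) : ∃ u : Euc N → ℝ, AD n u ∧ ∀ x, 0 < u x := by
  have hm : MemH1 (gk 1 : Euc N → ℝ) := by
    obtain ⟨C, hC, h⟩ := gk1_bound (N := N)
    have e1 : ∀ y : Euc N, gk 2 y ≤ 2 ^ (-(N : ℝ) / 2) := gk_le_const (by norm_num)
    refine ⟨gk_continuous 1, fun x => (gk_hasFDerivAt one_pos x).differentiableAt, ?_, ?_⟩
    · have hi : Integrable (fun y : Euc N => C ^ 2 * 2 ^ (-(N : ℝ) / 2) * gk 2 y) := (gk_integrable (by norm_num)).const_mul _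
      refine hi.mono' ((meas_grad _).norm.pow_const 2).aestronglyMeasurable (.of_forall fun x => ?_)
      rw [norm_grad, (gk_hasFDerivAt one_pos x).fderiv, Real.norm_of_nonneg (by positivity)]
      have h1 := h 1 one_pos x
      simp only [one_rpow, mul_one] at h1
      have h0 := gk_nonneg (by norm_num : (0:ℝ) < 2) x
      calc _ ≤ (C * gk 2 x) ^ 2 := by gcongr
        _ = C ^ 2 * gk 2 x * gk 2 x := by ring
        _ ≤ _ := by gcongr; exact e1 x
    · have hi : Integrable (fun y : Euc N => 1 ^ (-(N : ℝ) / 2) * gk 1 y) := (gk_integrable (by norm_num)).const_mul _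
      refine hi.mono' ((gk_continuous 1).pow 2).aestronglyMeasurable (.of_forall fun x => ?_)
      rw [Real.norm_of_nonneg (by positivity), sq]
      exact mul_le_mul_of_nonneg_right (gk_le_const one_pos x) (gk_nonneg one_pos x)
  have hk : KC n (gk 1 : Euc N → ℝ) := ⟨gk_nonneg one_pos, fun x y h _ => by simp [gk, h]⟩
  have h0 : 0 < N2 (gk 1 : Euc N → ℝ) := by
    refine lt_of_le_of_ne (N2_nn _) fun h => ?_
    have := congrFun (N2_zero hm h.symm) 0
    exact (gk_pos one_pos 0).ne' this
  exact ⟨_, AD.norm hm hk h0, fun x => mul_pos (by positivity) (gk_pos one_pos x)⟩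

def MM (n N : ℕ) (α p : ℝ) : ℝ := sSup {c | ∃ u : Euc N → ℝ, AD n u ∧ c = JJ α p u}

lemma JJ_le (P : PR n N α p) (hu : AD n u) : JJ α p u ≤ MM n N α p := by
  obtain ⟨C, _, h⟩ := JJ_bd P
  exact le_csSup ⟨C, by rintro _ ⟨v, hv, rfl⟩; exact (h v hv).2⟩ ⟨u, hu, rfl⟩

lemma JJ_int (P : PR n N α p) (hu : AD n u) : Integrable (fun x => ‖x‖ ^ α * u x ^ p) := by
  obtain ⟨C, _, h⟩ := JJ_bd P
  exact (h u hu).1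

lemma MM_pos (P : PR n N α p) : 0 < MM n N α p := by
  obtain ⟨u, hu, h0⟩ := gk_AD P
  exact (JJ_pos P h0 (JJ_int P hu)).trans_le (JJ_le P hu)

lemma JJ_all (P : PR n N α p) (hu : MemH1 u) (hk : KC n u) :
    Integrable (fun x => ‖x‖ ^ α * u x ^ p) ∧ JJ α p u ≤ MM n N α p * √(N2 u) ^ p := by
  have h2 := P.p2
  rcases (N2_nn u).eq_or_lt with h | h
  · have := N2_zero hu h.symm
    simp only [this, JJ, zero_rpow (by linarith : p ≠ 0), mul_zero, integral_zero]
    exact ⟨integrable_zero _ _ _, mul_nonneg (MM_pos P).le (rpow_nonneg (sqrt_nonneg _) _)⟩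
  · have ad := AD.norm hu hk h
    have hs : 0 < √(N2 u) := by positivity
    have e : ∀ x, u x = √(N2 u) * ((√(N2 u))⁻¹ * u x) := fun x => by field_simp
    have e' := funext e
    constructor
    · rw [e']
      refine ((JJ_int P ad).const_mul (√(N2 u) ^ p)).congr (.of_forall fun x => ?_)
      simp only
      rw [mul_rpow hs.le (ad.kc.1 x)]; ring
    · conv_lhs => rw [e', JJ_cmul ad.kc.1 hs.le]
      rw [mul_comm]
      exact mul_le_mul_of_nonneg_right (JJ_le P ad) (by positivity)

lemma trunc (P : PR n N α p) (hu : AD n u) {c : ℝ} (hc : c < JJ α p u) :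
    ∃ v : Euc N → ℝ, AD n v ∧ c < JJ α p v ∧ ∃ B, ∀ x, v x ≤ B := by
  have h2 := P.p2
  set w : ℕ → Euc N → ℝ := fun j x => u x / (1 + u x / (j + 1)) with hw
  have hu0 := hu.kc.1
  have hd : ∀ (j : ℕ) x, 1 ≤ 1 + u x / (j + 1) := fun j x => by have := div_nonneg (hu0 x) (by positivity : (0:ℝ) ≤ j + 1); linarith
  have hw0 : ∀ j x, 0 ≤ w j x := fun j x => div_nonneg (hu0 x) (by linarith [hd j x])
  have hwu : ∀ j x, w j x ≤ u x := fun j x => div_le_self (hu0 x) (hd j x)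
  have hder : ∀ j x, HasFDerivAt (w j) (((1 + u x / (j + 1)) ^ 2)⁻¹ • fderiv ℝ u x) x := fun j x => by
    have hux := (hu.h1.2.1 x).hasFDerivAt
    have hne : 1 + u x / (j + 1) ≠ 0 := by linarith [hd j x]
    have h1 : HasDerivAt (fun s : ℝ => s / (1 + s / ((j:ℝ) + 1))) (((1 + u x / (j + 1)) ^ 2)⁻¹) (u x) := by
      have := (hasDerivAt_id (u x)).div (((hasDerivAt_id (u x)).div_const ((j:ℝ) + 1)).const_add 1) hne
      refine this.congr_deriv ?_
      simp only [id]; field_simp; ring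
    exact h1.comp_hasFDerivAt x hux
  have hcont : ∀ j, Continuous (w j) := fun j => continuous_iff_continuousAt.2 fun x => (hder j x).continuousAt
  have hAD : ∀ j, AD n (w j) := fun j => by
    have hg : ∀ x, ‖gradient (w j) x‖ ≤ ‖gradient u x‖ := fun x => by
      rw [norm_grad, norm_grad, (hder j x).fderiv, norm_smul]
      have := one_le_pow₀ (hd j x) (n := 2)
      rw [Real.norm_of_nonneg (by positivity)]
      exact mul_le_of_le_one_left (norm_nonneg _) (inv_le_one_of_one_le₀ this)
    have hm : MemH1 (w j) := by
      refine ⟨hcont j, fun x => (hder j x).differentiableAt, ?_, ?_⟩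
      · refine hu.h1.2.2.1.mono' ((meas_grad _).norm.pow_const 2).aestronglyMeasurable (.of_forall fun x => ?_)
        rw [Real.norm_of_nonneg (by positivity)]
        gcongr; exact hg x
      · refine hu.h1.2.2.2.mono' ((hcont j).pow 2).aestronglyMeasurable (.of_forall fun x => ?_)
        rw [Real.norm_of_nonneg (by positivity)]
        have := hw0 j x
        gcongr; exact hwu j x
    refine ⟨hm, ⟨hw0 j, fun x y h1 h2 => ?_⟩, ?_⟩
    · have := hu.kc.2 x y h1 h2
      have a1 := hd j x; have a2 := hd j y
      show u x / _ ≤ u y / _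
      rw [div_le_div_iff₀ (by linarith) (by linarith)]
      have : u x * (u y / (j + 1)) = u y * (u x / (j + 1)) := by ring
      linarith
    · refine (integral_mono hm.n2int hu.h1.n2int fun x => ?_).trans hu.le1
      have := hw0 j x
      simp only
      gcongr; exacts [hg x, hwu j x]
  have hlim : Tendsto (fun j => JJ α p (w j)) atTop (nhds (JJ α p u)) := by
    refine tendsto_integral_of_dominated_convergence _ (fun j => (JJ_int P (hAD j)).1) (JJ_int P hu) (fun j => .of_forall fun x => ?_) (.of_forall fun x => ?_)
    · have := hw0 j x
      rw [Real.norm_of_nonneg (by positivity)]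
      gcongr; exact hwu j x
    · have : Tendsto (fun j : ℕ => u x / ((j:ℝ) + 1)) atTop (nhds 0) := by
        have := tendsto_one_div_add_atTop_nhds_zero_nat (𝕜 := ℝ) |>.const_mul (u x)
        simpa [div_eq_mul_inv] using this
      have h3 : Tendsto (fun j : ℕ => w j x) atTop (nhds (u x)) := by
        have := (tendsto_const_nhds (x := u x)).div ((tendsto_const_nhds (x := (1:ℝ))).add this) (by norm_num)
        rw [add_zero, div_one] at this
        exact this
      exact (h3.rpow_const (Or.inr (by linarith))).const_mul _
  obtain ⟨j, hj⟩ := (hlim.eventually (lt_mem_nhds hc)).exists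
  refine ⟨w j, hAD j, hj, j + 1, fun x => ?_⟩
  have := hd j x
  show u x / _ ≤ _
  rw [div_le_iff₀ (by linarith)]
  have : ((j:ℝ) + 1) * (1 + u x / (j + 1)) = j + 1 + u x := by field_simp
  rw [this]; have : (0:ℝ) ≤ j := j.cast_nonneg
  linarith

lemma ff_mul (hp : 2 < p) (h0 : ∀ x, 0 ≤ u x) (x : Euc N) : ff α p u x * u x = ‖x‖ ^ α * u x ^ p := by
  rw [ff, mul_assoc, ← rpow_add_one' (h0 x) (by linarith)]; ring_nf

lemma step {α p Q : ℝ} (P : PR n N α p) (hu : AD n u) (hR : RG (ff α p u) Q) (hJ : 0 < JJ α p u) :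
    JJ α p u ≤ √(N2 (TT (ff α p u))) ∧ AD n (fun x => (√(N2 (TT (ff α p u))))⁻¹ * TT (ff α p u) x) ∧
    JJ α p u ≤ JJ α p (fun x => (√(N2 (TT (ff α p u))))⁻¹ * TT (ff α p u) x) ∧
    ∫ x, (TT (ff α p u) x - MM n N α p * u x) ^ 2 ≤ 2 * MM n N α p ^ 2 - 2 * MM n N α p * JJ α p u := by
  have hp := P.p2
  set v := TT (ff α p u) with hv
  have hvm : MemH1 v := TT_MemH1 hR
  have hvk : KC n v := TT_KC P.hN hR (ff_KC P hu.kc)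
  have e1 : II v u = JJ α p u := by
    rw [II, TT_weak hR hu.h1]
    unfold JJ; congr 1; ext x; exact ff_mul hp hu.kc.1 x
  have e2 : II v v = N2 v := by
    unfold II N2; congr 1; ext x; rw [real_inner_self_eq_norm_sq]; ring
  have e3 : II v v = ∫ x, ff α p u x * v x := TT_weak hR hvm
  have h1 : JJ α p u ≤ √(N2 v) := by
    apply le_sqrt_of_sq_le
    have := II_cs hvm hu.h1
    rw [e1] at this
    nlinarith [hu.le1, N2_nn v]
  have hs : 0 < √(N2 v) := hJ.trans_le h1
  have hN0 : 0 < N2 v := sqrt_pos.1 hs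
  have had := AD.norm hvm hvk hN0
  set w : Euc N → ℝ := fun x => (√(N2 v))⁻¹ * v x with hw
  have e4 : √(N2 v) = ∫ x, ff α p u x * w x := by
    have : (fun x => ff α p u x * w x) = fun x => (√(N2 v))⁻¹ * (ff α p u x * v x) := by ext x; simp only [hw]; ring
    rw [this, integral_const_mul, ← e3, e2]
    field_simp
    exact sq_sqrt hN0.le
  have h2 : √(N2 v) ≤ (1 - 1 / p) * JJ α p u + 1 / p * JJ α p w := by
    rw [e4, JJ, JJ, ← integral_const_mul, ← integral_const_mul, ← integral_add ((JJ_int P hu).const_mul _) ((JJ_int P had).const_mul _)]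
    refine integral_mono (int_mul_of_sq hR.cont.aestronglyMeasurable had.h1.aesm hR.sq had.h1.2.2.2) (iadd ((JJ_int P hu).const_mul _) ((JJ_int P had).const_mul _)) fun x => ?_
    have hw0 := had.kc.1 x
    have hu0 := hu.kc.1 x
    have hp1 : 1 / p ≤ 1 := by rw [div_le_one (by linarith)]; linarith
    have := geom_mean_le_arith_mean2_weighted (by linarith : 0 ≤ 1 - 1 / p) (by positivity : 0 ≤ 1 / p) (rpow_nonneg hu0 p) (rpow_nonneg hw0 p) (by ring)
    rw [← rpow_mul hu0, ← rpow_mul hw0, mul_one_div_cancel (by linarith), rpow_one, show p * (1 - 1 / p) = p - 1 by field_simp] at this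
    have h5 := mul_le_mul_of_nonneg_left this (rpow_nonneg (norm_nonneg x) α)
    simp only [ff, hw] at h5 ⊢
    nlinarith
  have hp0 : 0 < 1 / p := by positivity
  have hp1 : 1 / p ≤ 1 := by rw [div_le_one (by linarith)]; linarith
  have hM1 := JJ_le P hu; have hM2 := JJ_le P had
  have hsM : √(N2 v) ≤ MM n N α p := by nlinarith
  refine ⟨h1, had, ?_, ?_⟩
  · by_contra h
    push Not at h
    nlinarith
  · obtain ⟨c1, c2⟩ := hvm.comb hu.h1 (MM n N α p)
    refine c1.le_N2.2.trans ?_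
    rw [c2, e1]
    have := sq_sqrt hN0.le
    nlinarith [hu.le1, sq_nonneg (MM n N α p)]

lemma good (P : PR n N α p) : ∃ B L : ℝ, 0 < B ∧ 2 * B ≤ L ∧ ∀ u : Euc N → ℝ, AD n u → (∃ B0, ∀ x, u x ≤ B0) →
    MM n N α p / 2 ≤ JJ α p u → ∃ v : Euc N → ℝ, AD n v ∧ JJ α p u ≤ JJ α p v ∧ (∀ x, v x ≤ B) ∧ ∀ x y, |v x - v y| ≤ L * ‖x - y‖ := by
  have hM := MM_pos P
  obtain ⟨σ, C, hσ0, hσ1, hC, hsup⟩ := sup_improve P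
  set C' : ℝ := 2 / MM n N α p * C + 1 with hC'
  have hC1 : 1 ≤ C' := by have : 0 < 2 / MM n N α p * C := by positivity
                          linarith
  set B : ℝ := (2 * C') ^ (1 / (1 - σ)) with hB
  have hB1 : 1 ≤ B := one_le_rpow (by linarith) (by have : 0 < 1 - σ := by linarith
                                                    positivity)
  have hBb : ∀ b, B ≤ b → C' * b ^ σ ≤ b / 2 := by
    intro b hb
    have hb0 : 0 < b := by linarith
    have h1 := rpow_le_rpow (by linarith) hb (by linarith : 0 ≤ 1 - σ)
    rw [hB, ← rpow_mul (by linarith), one_div_mul_cancel (by linarith), rpow_one] at h1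
    have h2 : b = b ^ (1 - σ) * b ^ σ := by rw [← rpow_add hb0]; simp
    have h3 : 0 < b ^ σ := by positivity
    nlinarith
  obtain ⟨Q, hQ, hRG⟩ := ff_RG P (B := B) (by linarith)
  obtain ⟨C1, hC1', hT1⟩ := TT1_bound (N := N)
  have one : ∀ (u : Euc N → ℝ), AD n u → ∀ b, B ≤ b → (∀ x, u x ≤ b) → MM n N α p / 2 ≤ JJ α p u →
      ∃ v : Euc N → ℝ, AD n v ∧ JJ α p u ≤ JJ α p v ∧ (∀ x, v x ≤ b / 2) ∧ (b = B → ∀ x y, |v x - v y| ≤ (2 / MM n N α p * (C1 * Q)) * ‖x - y‖) := by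
    intro u hu b hb hub hJ
    obtain ⟨Q', _, hR'⟩ := ff_RG P (B := b) (by linarith)
    have hR := (hR' u hu hub).1
    obtain ⟨a1, a2, a3, -⟩ := step P hu hR (by linarith)
    have hi : (√(N2 (TT (ff α p u))))⁻¹ ≤ 2 / MM n N α p := by
      rw [show 2 / MM n N α p = (MM n N α p / 2)⁻¹ by field_simp]
      exact inv_anti₀ (by linarith) (hJ.trans a1)
    refine ⟨_, a2, a3, fun x => ?_, fun hbB x y => ?_⟩
    · refine le_trans ?_ (hBb b hb)
      have h1 := hsup u hu b (by linarith) hub x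
      have h2 := TT_nonneg hR.nn x
      have h3 : 0 < b ^ σ := by have : 0 < b := by linarith
                                positivity
      calc _ ≤ 2 / MM n N α p * (C * b ^ σ) := by gcongr
        _ ≤ _ := by rw [hC']; nlinarith
    · subst hbB
      have hR := (hRG u hu hub).1
      have := convex_univ.norm_image_sub_le_of_norm_fderiv_le (𝕜 := ℝ) (f := TT (ff α p u)) (C := C1 * Q) (fun z _ => (TT_hasFDerivAt hR z).differentiableAt)
        (fun z _ => by rw [TT_fderiv hR]; exact hT1 _ _ hR z) (mem_univ y) (mem_univ x)
      rw [Real.norm_eq_abs] at this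
      rw [← mul_sub, abs_mul, abs_of_nonneg (by positivity), mul_assoc]
      exact mul_le_mul hi this (abs_nonneg _) (by positivity)
  have iter : ∀ (k : ℕ) (u : Euc N → ℝ), AD n u → (∀ x, u x ≤ 2 ^ k * B) → MM n N α p / 2 ≤ JJ α p u →
      ∃ v : Euc N → ℝ, AD n v ∧ JJ α p u ≤ JJ α p v ∧ ∀ x, v x ≤ B := by
    intro k
    induction k with
    | zero => exact fun u hu h _ => ⟨u, hu, le_rfl, by simpa using h⟩
    | succ k ih =>
      intro u hu h hJ
      have h2 : (1:ℝ) ≤ 2 ^ (k + 1) := one_le_pow₀ (by norm_num)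
      obtain ⟨v, v1, v2, v3, -⟩ := one u hu (2 ^ (k + 1) * B) (by nlinarith) h hJ
      obtain ⟨w, w1, w2, w3⟩ := ih v v1 (fun x => (v3 x).trans_eq (by ring)) (hJ.trans v2)
      exact ⟨w, w1, v2.trans w2, w3⟩
  refine ⟨B, max (2 * B) (2 / MM n N α p * (C1 * Q)), by linarith, le_max_left _ _, fun u hu ⟨B0, hB0⟩ hJ => ?_⟩
  obtain ⟨k, hk⟩ := pow_unbounded_of_one_lt B0 (one_lt_two)
  obtain ⟨v, v1, v2, v3⟩ := iter k u hu (fun x => (hB0 x).trans (hk.le.trans (le_mul_of_one_le_right (by positivity) hB1))) hJ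
  obtain ⟨w, w1, w2, w3, w4⟩ := one v v1 B le_rfl v3 (hJ.trans v2)
  refine ⟨w, w1, v2.trans w2, fun x => (w3 x).trans (by linarith), fun x y => (w4 rfl x y).trans ?_⟩
  gcongr; exact le_max_right _ _

lemma subseq {uk : ℕ → Euc N → ℝ} {B L : ℝ} (h0 : ∀ k x, 0 ≤ uk k x) (hB : ∀ k x, uk k x ≤ B) (hL0 : 0 < L) (hL : ∀ k x y, |uk k x - uk k y| ≤ L * ‖x - y‖) :
    ∃ (φ : ℕ → ℕ) (u : Euc N → ℝ), StrictMono φ ∧ ∀ x, Tendsto (fun k => uk (φ k) x) atTop (nhds (u x)) := by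
  set D := TopologicalSpace.denseSeq (Euc N)
  have hc : IsCompact (Set.pi univ fun _ : ℕ => Icc (0:ℝ) B) := isCompact_univ_pi fun _ => isCompact_Icc
  obtain ⟨a, _, φ, hφ, hl⟩ := hc.tendsto_subseq (x := fun k i => uk k (D i)) fun k i _ => ⟨h0 k _, hB k _⟩
  have hl' := tendsto_pi_nhds.1 hl
  have hex : ∀ x, ∃ l, Tendsto (fun k => uk (φ k) x) atTop (nhds l) := by
    intro x
    refine cauchySeq_tendsto_of_complete (Metric.cauchySeq_iff'.2 fun ε hε => ?_)
    obtain ⟨i, hi⟩ : ∃ i, ‖x - D i‖ < ε / (4 * L) := by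
      obtain ⟨y, ⟨i, rfl⟩, hy⟩ := (TopologicalSpace.denseRange_denseSeq (Euc N)).exists_dist_lt x (by positivity : 0 < ε / (4 * L)) |> fun ⟨i, hi⟩ => (⟨D i, ⟨i, rfl⟩, hi⟩ : ∃ y, (∃ i, D i = y) ∧ dist x y < ε / (4 * L))
      exact ⟨i, by rwa [dist_eq_norm] at hy⟩
    obtain ⟨K, hK⟩ := Metric.cauchySeq_iff'.1 (hl' i).cauchySeq (ε / 2) (by positivity)
    refine ⟨K, fun k hk => ?_⟩
    have h1 := hK k hk
    rw [Real.dist_eq] at h1 ⊢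
    simp only [Function.comp] at h1
    have h2 := hL (φ k) x (D i); have h3 := hL (φ K) x (D i)
    have h4 : L * ‖x - D i‖ < ε / 4 := by
      have := mul_lt_mul_of_pos_left hi hL0
      rwa [show L * (ε / (4 * L)) = ε / 4 by field_simp] at this
    rw [abs_lt] at h1 ⊢
    rw [abs_le] at h2 h3
    constructor <;> linarith
  choose u hu using hex
  exact ⟨φ, u, hφ, hu⟩

lemma tight (P : PR n N α p) {w : ℕ → Euc N → ℝ} {B c : ℝ} (hc : 0 < c) (hw : ∀ k, AD n (w k)) (hB : ∀ k x, w k x ≤ B)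
    (hJ : ∀ k, c ≤ JJ α p (w k)) (hl : ∀ x, Tendsto (fun k => w k x) atTop (nhds 0)) : False := by
  have h0 := P.N2; have h1 := P.hp1; have h2 := P.p2; have h3 := P.n2; have h4 := P.hα
  obtain ⟨C, hC, hE⟩ := EE (N := N) P.hn P.hN (q := p) (e := (n - 1) * p - N + 2) h2.le (by linarith) le_rfl
  set e : ℝ := (n - 1) * p - N + 2 with he
  have hδ : 0 < e - α := by linarith
  obtain ⟨R, hR1, hR⟩ : ∃ R : ℝ, 1 ≤ R ∧ R ^ (-(e - α)) * C < c / 2 := by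
    have t := (tendsto_rpow_neg_atTop hδ).mul_const C
    rw [zero_mul] at t
    exact ((eventually_ge_atTop 1).and (t.eventually (gt_mem_nhds (by linarith)))).exists
  have hR0 : 0 < R := by linarith
  set S := Metric.closedBall (0 : Euc N) R
  have hlim : Tendsto (fun k => ∫ x in S, ‖x‖ ^ α * w k x ^ p) atTop (nhds (∫ x in S, (0:ℝ))) := by
    refine tendsto_integral_of_dominated_convergence (fun _ => R ^ α * B ^ p) (fun k => (JJ_int P (hw k)).1.restrict) (integrableOn_const measure_closedBall_lt_top.ne) (fun k => ?_) (.of_forall fun x => ?_)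
    · filter_upwards [ae_restrict_mem measurableSet_closedBall] with x hx
      rw [mem_closedBall_zero_iff] at hx
      have := (hw k).kc.1 x
      rw [Real.norm_of_nonneg (by positivity)]
      gcongr
      exact hB k x
    · have := ((hl x).rpow_const (p := p) (Or.inr (by linarith))).const_mul (‖x‖ ^ α)
      rwa [zero_rpow (by linarith), mul_zero] at this
  rw [integral_zero] at hlim
  obtain ⟨k, hk⟩ := (hlim.eventually (gt_mem_nhds (by linarith : 0 < c / 2))).exists
  obtain ⟨e1, e2⟩ := hE _ (hw k)
  have hi := JJ_int P (hw k)
  have hJk := hJ k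
  rw [← integral_indicator measurableSet_closedBall] at hk
  have : JJ α p (w k) ≤ ∫ x, (R ^ (-(e - α)) * (‖x‖ ^ e * w k x ^ p) + S.indicator (fun x => ‖x‖ ^ α * w k x ^ p) x) := by
    refine integral_mono hi (iadd (e1.const_mul _) (hi.indicator measurableSet_closedBall)) fun x => ?_
    have hw0 := (hw k).kc.1 x
    have hp : 0 ≤ w k x ^ p := by positivity
    by_cases hx : x ∈ S
    · simp only [indicator_of_mem hx]
      have : 0 ≤ R ^ (-(e - α)) * (‖x‖ ^ e * w k x ^ p) := by positivity
      linarith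
    · simp only [indicator_of_notMem hx, add_zero]
      have hx' : R < ‖x‖ := by simpa [S] using hx
      have hx0 : 0 < ‖x‖ := by linarith
      have a1 : R ^ (e - α) ≤ ‖x‖ ^ (e - α) := by gcongr
      have a2 : ‖x‖ ^ e = ‖x‖ ^ α * ‖x‖ ^ (e - α) := by rw [← rpow_add hx0]; ring_nf
      have a3 : 0 < R ^ (e - α) := by positivity
      rw [a2, rpow_neg hR0.le, inv_mul_eq_div, le_div_iff₀ a3]
      have : 0 ≤ ‖x‖ ^ α * w k x ^ p := by positivity
      nlinarith
  rw [integral_add (e1.const_mul _) (hi.indicator measurableSet_closedBall), integral_const_mul] at this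
  have h9 : R ^ (-(e - α)) * ∫ x, ‖x‖ ^ e * w k x ^ p ≤ R ^ (-(e - α)) * C := by gcongr
  linarith

lemma maximizer (P : PR n N α p) : ∃ u : Euc N → ℝ, MemH1 u ∧ KC n u ∧ N2 u = 1 ∧ JJ α p u = MM n N α p ∧
    (∀ x, 0 < u x) ∧ ContDiff ℝ 2 (fun x => MM n N α p * u x) ∧ ∀ x, - lap (fun x => MM n N α p * u x) x + MM n N α p * u x = ff α p u x := by
  have hM := MM_pos P; have hp := P.p2
  set M := MM n N α p with hMdef
  obtain ⟨B, L, hB0, hBL, hgood⟩ := good P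
  have hL0 : 0 < L := by linarith
  obtain ⟨C, hC0, hdec⟩ := decay P hB0 hBL
  obtain ⟨Q, hQ0, hRG⟩ := ff_RG P hB0.le
  have hex : ∀ k : ℕ, ∃ v : Euc N → ℝ, AD n v ∧ M - M / (k + 2) ≤ JJ α p v ∧ (∀ x, v x ≤ B) ∧ ∀ x y, |v x - v y| ≤ L * ‖x - y‖ := by
    intro k
    have h1 : 0 < M / ((k:ℝ) + 2) := by positivity
    have h2 : M / ((k:ℝ) + 2) ≤ M / 2 := by
      gcongr; have : (0:ℝ) ≤ k := k.cast_nonneg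
      linarith
    have hne : {c | ∃ u : Euc N → ℝ, AD n u ∧ c = JJ α p u}.Nonempty := by
      obtain ⟨u, hu, _⟩ := gk_AD P
      exact ⟨_, u, hu, rfl⟩
    obtain ⟨_, ⟨u, hu, rfl⟩, hc⟩ := exists_lt_of_lt_csSup hne (show M - M / (k + 2) < sSup _ by show _ < M; linarith)
    obtain ⟨v, v1, v2, v3⟩ := trunc P hu hc
    obtain ⟨w, w1, w2, w3, w4⟩ := hgood v v1 v3 (by rw [← hMdef]; linarith)
    exact ⟨w, w1, v2.le.trans w2, w3, w4⟩
  choose v v1 v2 v3 v4 using hex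
  obtain ⟨φ, u, hφ, hl⟩ := subseq (fun k => (v1 k).kc.1) v3 hL0 v4
  set w : ℕ → Euc N → ℝ := fun k => v (φ k) with hw
  have hwJ : ∀ k : ℕ, M - M / (k + 2) ≤ JJ α p (w k) := fun k => by
    refine le_trans ?_ (v2 (φ k))
    have : (k:ℝ) ≤ φ k := by exact_mod_cast hφ.le_apply
    gcongr
  have hu0 : ∀ x, 0 ≤ u x := fun x => ge_of_tendsto' (hl x) fun k => (v1 _).kc.1 x
  have huB : ∀ x, u x ≤ B := fun x => le_of_tendsto' (hl x) fun k => v3 _ x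
  have huL : ∀ x y, |u x - u y| ≤ L * ‖x - y‖ := fun x y => le_of_tendsto' ((hl x).sub (hl y)).abs fun k => v4 _ x y
  have huk : KC n u := ⟨hu0, fun x y h1 h2 => le_of_tendsto_of_tendsto' (hl x) (hl y) fun k => (v1 _).kc.2 x y h1 h2⟩
  have huc : Continuous u := by
    have : LipschitzWith (Real.toNNReal L) u := LipschitzWith.of_dist_le_mul fun x y => by
      rw [Real.dist_eq, dist_eq_norm, Real.coe_toNNReal _ hL0.le]; exact huL x y
    exact this.continuous
  have huC : ∀ x, ‖x‖ ^ α * u x ^ (p - 2) ≤ C := fun x =>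
    le_of_tendsto' (((hl x).rpow_const (Or.inr (by linarith))).const_mul _) fun k => hdec _ (v1 _) (v3 _) (v4 _) x
  have hfl : ∀ x, Tendsto (fun k => ff α p (w k) x) atTop (nhds (ff α p u x)) := fun x =>
    ((hl x).rpow_const (Or.inr (by linarith))).const_mul _
  have hfb : ∀ k x, |ff α p (w k) x| ≤ C * B := fun k x => ff_le P (v1 _).kc.1 (v3 _) (hdec _ (v1 _) (v3 _) (v4 _)) x
  have hRk : ∀ k, RG (ff α p (w k)) Q := fun k => (hRG _ (v1 _) (v3 _)).1
  have hR : RG (ff α p u) Q := RG_lim hRk (fun k => (hRG _ (v1 _) (v3 _)).2) hfb hfl (ff_cont P huc)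
  have hTl := TT_lim (fun k => (hRk k).cont) hfb hfl
  have hTm := TT_MemH1 hR
  have hTu : ∀ x, TT (ff α p u) x = M * u x := by
    have hj : ∀ j : ℕ, Integrable (fun x => (TT (ff α p u) x - M * u x) ^ 2) ∧ ∫ x, (TT (ff α p u) x - M * u x) ^ 2 ≤ 2 * M ^ 2 / (j + 2) := by
      intro j
      refine fatou (gk := fun k x => (TT (ff α p (w (k + j))) x - M * w (k + j) x) ^ 2) (fun k x => sq_nonneg _) (fun k => ?_) (fun k => ?_) (fun x => ?_)
      · exact ((TT_MemH1 (hRk (k + j))).comb (v1 _).h1 M).1.2.2.2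
      · have hjj := hwJ (k + j)
        have hkj : M / ((k + j : ℕ) + 2 : ℝ) ≤ M / (j + 2) := by
          gcongr; push_cast; linarith [(k.cast_nonneg : (0:ℝ) ≤ k)]
        have hk2 : M / ((k + j : ℕ) + 2 : ℝ) ≤ M / 2 := by
          gcongr; have : (0:ℝ) ≤ ((k + j : ℕ):ℝ) := Nat.cast_nonneg _
          linarith
        have := (step P (v1 (φ (k + j))) (hRk (k + j)) (by show 0 < JJ α p (w (k + j)); linarith)).2.2.2
        rw [← hMdef] at this
        refine this.trans ?_
        have e : 2 * M ^ 2 / ((j:ℝ) + 2) = 2 * M * (M / (j + 2)) := by ring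
        rw [e]
        have : JJ α p (v (φ (k + j))) = JJ α p (w (k + j)) := rfl
        nlinarith
      · exact (((hTl x).sub ((hl x).const_mul M)).pow 2).comp (tendsto_add_atTop_nat j)
    have hz : ∫ x, (TT (ff α p u) x - M * u x) ^ 2 = 0 := by
      refine le_antisymm ?_ (integral_nonneg fun x => sq_nonneg _)
      refine ge_of_tendsto' (f := fun j : ℕ => 2 * M ^ 2 / ((j:ℝ) + 2)) (x := atTop) ?_ fun j => (hj j).2
      exact tendsto_const_nhds.div_atTop (tendsto_atTop_add_const_right _ _ tendsto_natCast_atTop_atTop)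
    rw [integral_eq_zero_iff_of_nonneg (fun x => sq_nonneg _) (hj 0).1] at hz
    have := ((hTm.1.sub (continuous_const.mul huc)).pow 2).ae_eq_iff_eq volume (continuous_const (y := (0:ℝ))) |>.1 hz
    intro x
    have := congrFun this x
    simp only [Pi.pow_apply, Pi.sub_apply, Pi.mul_apply] at this
    have := pow_eq_zero_iff (two_ne_zero) |>.1 this
    linarith
  have hTe : TT (ff α p u) = fun x => M * u x := funext hTu
  have hue : u = fun x => M⁻¹ * TT (ff α p u) x := by ext x; rw [hTu]; field_simp
  have hum : MemH1 u := by rw [hue]; exact (hTm.cmul _).1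
  have hJN : JJ α p u = M * N2 u := by
    have e1 := TT_weak hR hum
    have e2 : ∫ x, ff α p u x * u x = JJ α p u := by unfold JJ; congr 1; ext x; exact ff_mul hp hu0 x
    rw [e2] at e1
    rw [← e1, hTe, N2, ← integral_const_mul]
    congr 1; ext x
    have g : gradient (fun x => M * u x) x = M • gradient u x := by
      unfold gradient
      rw [((hum.2.1 x).hasFDerivAt.const_mul M).fderiv]; simp
    rw [g, inner_smul_left, real_inner_self_eq_norm_sq]
    simp; ring
  have hne : N2 u ≠ 0 := by
    intro h
    have hz := N2_zero hum h
    refine tight P (c := M / 2) (by linarith) (fun k => v1 (φ k)) (fun k => v3 _) (fun k => ?_) (fun x => ?_)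
    · have := hwJ k
      have hk2 : M / ((k : ℝ) + 2) ≤ M / 2 := by
        gcongr; linarith [(k.cast_nonneg : (0:ℝ) ≤ k)]
      show _ ≤ JJ α p (w k)
      linarith
    · have := hl x; rwa [hz] at this
  have hpos : 0 < N2 u := lt_of_le_of_ne (N2_nn u) (Ne.symm hne)
  have hJM : JJ α p u ≤ M := (fatou (gk := fun k x => ‖x‖ ^ α * w k x ^ p) (fun k x => mul_nonneg (rpow_nonneg (norm_nonneg _) _) (rpow_nonneg ((v1 _).kc.1 x) _))
    (fun k => JJ_int P (v1 _)) (fun k => JJ_le P (v1 (φ k))) fun x => ((hl x).rpow_const (Or.inr (by linarith))).const_mul _).2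
  have hN1 : N2 u = 1 := by
    refine le_antisymm (by rw [hJN] at hJM; nlinarith) ?_
    have h1 := (JJ_all P hum huk).2
    rw [hJN] at h1
    by_contra h
    push Not at h
    have hs0 : 0 < √(N2 u) := by positivity
    have hs1 : √(N2 u) < 1 := by rw [sqrt_lt' one_pos]; simpa using h
    have h3 := rpow_lt_rpow_of_exponent_gt hs0 hs1 hp
    rw [rpow_two, sq_sqrt hpos.le] at h3
    nlinarith
  have hJ : JJ α p u = M := by rw [hJN, hN1, mul_one]
  obtain ⟨H, hH0, hH⟩ := ff_holder P hu0 huB huC huL hL0.le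
  have hC2 := TT_C2 hR (ff_le P hu0 huB huC) (lt_min P.hα one_pos) hH0 hH
  have hnf : ∃ x, ff α p u x ≠ 0 := by
    by_contra h
    push Not at h
    have : JJ α p u = 0 := by
      unfold JJ
      have : ∀ x, ‖x‖ ^ α * u x ^ p = 0 := fun x => by rw [← ff_mul hp hu0, h, zero_mul]
      simp [this]
    linarith
  refine ⟨u, hum, huk, hN1, hJ, fun x => ?_, ?_, ?_⟩
  · have := TT_pos hR hnf x
    rw [hTu] at this
    exact (mul_pos_iff_of_pos_left hM).1 this
  · rw [← hTe]; exact hC2.1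
  · intro x; have := hC2.2 x; rwa [hTe] at this

lemma energy_eq (h : ∀ x, 0 ≤ u x) : energy α p u = (1 / 2) * N2 u - (1 / p) * JJ α p u := by
  unfold energy N2 JJ
  simp only [fun x => abs_of_nonneg (h x)]

lemma vnorm_cmul (hp : 2 < p) {w : Euc N → ℝ} (hw : MemH1 w) (h0 : ∀ x, 0 ≤ w x) (k : ℝ) : vnorm α p (fun x => k * w x) = |k| * vnorm α p w := by
  have e1 : ∫ x, (‖gradient (fun x => k * w x) x‖ ^ 2 + (k * w x) ^ 2) = k ^ 2 * N2 w := (hw.cmul k).2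
  have e2 : ∫ x, ‖x‖ ^ α * |k * w x| ^ p = |k| ^ p * ∫ x, ‖x‖ ^ α * |w x| ^ p := by
    rw [← integral_const_mul]; congr 1; ext x
    rw [abs_mul, mul_rpow (abs_nonneg _) (abs_nonneg _)]; ring
  have hJ : 0 ≤ ∫ x, ‖x‖ ^ α * |w x| ^ p := integral_nonneg fun x => by positivity
  unfold vnorm
  rw [e1, e2, mul_rpow (sq_nonneg _) (N2_nn w), mul_rpow (by positivity) hJ, ← rpow_mul (abs_nonneg k), mul_one_div_cancel (by linarith), rpow_one,
    ← sqrt_eq_rpow, sqrt_sq_eq_abs, N2]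
  ring

lemma sqrt_le_vnorm (α p : ℝ) (u : Euc N → ℝ) : √(N2 u) ≤ vnorm α p u := by
  unfold vnorm
  rw [← sqrt_eq_rpow]
  have : 0 ≤ (∫ x, ‖x‖ ^ α * |u x| ^ p) ^ (1 / p) := rpow_nonneg (integral_nonneg fun x => by positivity) _
  unfold N2; linarith

lemma lap_cmul {g : Euc N → ℝ} (hg : ContDiff ℝ 2 g) (k : ℝ) (x : Euc N) : lap (fun x => k * g x) x = k * lap g x := by
  unfold lap
  rw [Finset.mul_sum]
  refine Finset.sum_congr rfl fun i _ => ?_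
  have : (fun x => k * g x) = k • g := by ext; simp
  rw [this, iteratedFDeriv_const_smul_apply (hg.contDiffAt)]
  simp

lemma bern {p s : ℝ} (hp : 2 < p) (hs : 0 ≤ s) : s ^ 2 / 2 - s ^ p / p ≤ 1 / 2 - 1 / p := by
  have h := one_add_mul_self_le_rpow_one_add (s := s ^ 2 - 1) (by nlinarith [sq_nonneg s]) (p := p / 2) (by linarith)
  rw [show 1 + (s ^ 2 - 1) = s ^ 2 by ring, ← rpow_natCast s 2, ← rpow_mul hs] at h
  push_cast at h
  rw [show 2 * (p / 2) = p by ring] at h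
  have h2 : (1 + p / 2 * (s ^ (2:ℝ) - 1)) / p ≤ s ^ p / p := by gcongr
  rw [rpow_two] at h2
  have h3 : (1 + p / 2 * (s ^ 2 - 1)) / p = 1 / p + (s ^ 2 - 1) / 2 := by field_simp
  linarith

lemma mp_level (P : PR n N α p) {w : Euc N → ℝ} {c : ℝ} (hc : 0 < c) (hcM : MM n N α p * c ^ p = c ^ 2)
    (hw : MemH1 w) (hk : KC n w) (hN2 : N2 w = c ^ 2) (hJ : JJ α p w = c ^ 2) :
    mountainPassLevel α p (KplusFull n : Set (Euc N → ℝ)) = energy α p w := by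
  have hp := P.p2; have hM := MM_pos P
  have hn1 : 1 ≤ n := by have := P.hn; omega
  have hnN : n < N := by have := P.hn; have := P.hN; omega
  have hE : energy α p w = c ^ 2 * (1 / 2 - 1 / p) := by rw [energy_eq hk.1, hN2, hJ]; ring
  refine IsLeast.csInf_eq ⟨?_, ?_⟩
  · obtain ⟨T, hT1, hT⟩ : ∃ T : ℝ, 1 ≤ T ∧ T ^ 2 / 2 - T ^ p / p ≤ 0 := by
      refine ⟨(p / 2) ^ (1 / (p - 2)), one_le_rpow (by linarith) (by have : 0 < p - 2 := by linarith
                                                                     positivity), ?_⟩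
      set T := (p / 2) ^ (1 / (p - 2))
      have hT0 : 0 < T := by positivity
      have e : T ^ (p - 2) = p / 2 := by rw [← rpow_mul (by positivity), one_div_mul_cancel (by linarith), rpow_one]
      have e2 : T ^ p = T ^ (p - 2) * T ^ 2 := by rw [← rpow_natCast T 2, ← rpow_add hT0]; push_cast; ring_nf
      rw [e2, e]; apply le_of_eq; field_simp; ring
    have hen : ∀ s : ℝ, 0 ≤ s → energy α p (fun x => s * w x) = c ^ 2 * (s ^ 2 / 2 - s ^ p / p) := fun s hs => by
      rw [energy_eq (hk.cmul hs).1, (hw.cmul s).2, JJ_cmul hk.1 hs, hN2, hJ]; ring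
    have hT0 : 0 < T := by linarith
    have hw0 : w ≠ 0 := by
      rintro rfl
      have : N2 (0 : Euc N → ℝ) = 0 := by
        have := (hw.cmul 0).2
        simpa [Pi.zero_def] using this
      rw [this] at hN2; have := pow_pos hc 2; linarith
    refine ⟨fun t x => (t * T) * w x, fun t ht => ?_, fun t ht ε hε => ?_, ?_, ?_, ?_, ?_⟩
    · exact mem_Kplus_of_KC hn1 hnN (hk.cmul (mul_nonneg ht.1 hT0.le)) (hw.cmul _).1
    · have hv : 0 ≤ vnorm α p w := (sqrt_nonneg _).trans (sqrt_le_vnorm α p w)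
      refine ⟨ε / (T * vnorm α p w + 1), by positivity, fun s hs hst => ?_⟩
      have : ((fun x => s * T * w x) - fun x => t * T * w x) = fun x => ((s - t) * T) * w x := by ext x; simp; ring
      rw [this, vnorm_cmul hp hw hk.1, abs_mul, abs_of_pos hT0]
      rw [lt_div_iff₀ (by positivity)] at hst
      have h5 := abs_nonneg (s - t)
      rcases h5.eq_or_lt with h | h
      · rw [← h]; simpa using hε
      · nlinarith
    · ext x; simp
    · intro h
      apply hw0
      ext x
      have := congrFun h x
      simpa [hT0.ne'] using this
    · have := hen T hT0.le
      simp only [one_mul]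
      rw [this]
      exact mul_nonpos_of_nonneg_of_nonpos (by positivity) hT
    · symm
      refine IsGreatest.csSup_eq ⟨⟨1 / T, ⟨by positivity, (div_le_one hT0).2 hT1⟩, ?_⟩, ?_⟩
      · simp [hT0.ne']
      · rintro _ ⟨t, ht, rfl⟩
        simp only
        rw [hen _ (mul_nonneg ht.1 hT0.le), hE]
        exact mul_le_mul_of_nonneg_left (bern hp (mul_nonneg ht.1 hT0.le)) (sq_nonneg c)
  · rintro _ ⟨γ, hγK, hγc, hγ0, hγ1, hγE, rfl⟩
    have hm : ∀ t ∈ Icc (0:ℝ) 1, MemH1 (γ t) := fun t ht => (hγK t ht).1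
    have hkc : ∀ t ∈ Icc (0:ℝ) 1, KC n (γ t) := fun t ht => KC_of_mem_Kplus hn1 hnN (hγK t ht)
    have hcont : ContinuousOn (fun t => √(N2 (γ t))) (Icc 0 1) := by
      rw [Metric.continuousOn_iff]
      intro t ht ε hε
      obtain ⟨δ, hδ, h⟩ := hγc t ht ε hε
      refine ⟨δ, hδ, fun s hs hst => ?_⟩
      rw [Real.dist_eq] at hst ⊢
      refine (sqrtN2_sub (hm s hs) (hm t ht)).trans_lt (lt_of_le_of_lt ?_ (h s hs hst))
      exact sqrt_le_vnorm α p (γ s - γ t)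
    have hlow : ∀ t ∈ Icc (0:ℝ) 1, (1 / 2) * √(N2 (γ t)) ^ 2 - (1 / p) * (MM n N α p * √(N2 (γ t)) ^ p) ≤ energy α p (γ t) := fun t ht => by
      rw [energy_eq (hkc t ht).1, sq_sqrt (N2_nn _)]
      have := (JJ_all P (hm t ht) (hkc t ht)).2
      gcongr
    have h0m : (0:ℝ) ∈ Icc (0:ℝ) 1 := by simp
    have h1m : (1:ℝ) ∈ Icc (0:ℝ) 1 := by simp
    have hg0 : √(N2 (γ 0)) = 0 := by
      have : N2 (γ 0) = 0 := by
        rw [hγ0]; simpa [Pi.zero_def] using (hw.cmul 0).2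
      rw [this, sqrt_zero]
    have hg1 : c ≤ √(N2 (γ 1)) := by
      have h := hlow 1 h1m
      have hs0 : 0 < √(N2 (γ 1)) := by
        rw [sqrt_pos]
        refine lt_of_le_of_ne (N2_nn _) fun h => hγ1 ?_
        exact N2_zero (hm 1 h1m) h.symm
      set s := √(N2 (γ 1))
      by_contra hlt
      push Not at hlt
      have e2 : ∀ a : ℝ, 0 < a → a ^ p = a ^ (p - 2) * a ^ 2 := fun a ha => by rw [← rpow_natCast a 2, ← rpow_add ha]; push_cast; ring_nf
      have h3 : s ^ (p - 2) ≤ c ^ (p - 2) := rpow_le_rpow hs0.le hlt.le (by linarith)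
      rw [e2 c hc] at hcM
      have hc1 : MM n N α p * c ^ (p - 2) = 1 := by
        have : c ^ 2 ≠ 0 := by positivity
        apply mul_right_cancel₀ this; linarith
      rw [e2 s hs0] at h
      have h4 : MM n N α p * s ^ (p - 2) ≤ 1 := by rw [← hc1]; gcongr
      have h5 : (1 / p) * (MM n N α p * (s ^ (p - 2) * s ^ 2)) ≤ (1 / p) * s ^ 2 := by
        have : MM n N α p * (s ^ (p - 2) * s ^ 2) ≤ 1 * s ^ 2 := by rw [← mul_assoc]; gcongr
        rw [one_mul] at this; gcongr
      have h6 : 1 / p < 1 / 2 := by gcongr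
      have h7 : 0 < s ^ 2 := by positivity
      nlinarith
    obtain ⟨t, ht, htc⟩ : c ∈ (fun t => √(N2 (γ t))) '' Icc 0 1 :=
      intermediate_value_Icc zero_le_one hcont ⟨hg0.trans_le hc.le, hg1⟩
    have hbd : BddAbove ((fun t => energy α p (γ t)) '' Icc (0:ℝ) 1) := by
      obtain ⟨K, hK⟩ := (isCompact_Icc.image_of_continuousOn hcont).bddAbove
      refine ⟨(1 / 2) * K ^ 2, ?_⟩
      rintro _ ⟨t, ht, rfl⟩
      have h1 : √(N2 (γ t)) ≤ K := hK ⟨t, ht, rfl⟩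
      simp only
      rw [energy_eq (hkc t ht).1, ← sq_sqrt (N2_nn (γ t))]
      have h2 : 0 ≤ JJ α p (γ t) := integral_nonneg fun x => mul_nonneg (rpow_nonneg (norm_nonneg _) _) (rpow_nonneg ((hkc t ht).1 x) _)
      have h3 : √(N2 (γ t)) ^ 2 ≤ K ^ 2 := by gcongr
      have : 0 ≤ (1 / p) * JJ α p (γ t) := by positivity
      linarith
    refine le_trans ?_ (le_csSup hbd ⟨t, ht, rfl⟩)
    have := hlow t ht
    simp only at htc ⊢
    rw [htc, hcM] at this
    rw [hE]; linarith

lemma final (P : PR n N α p) : ∃ u : Euc N → ℝ,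
      IsGroundState α p (KplusFull n) u ∧ (∀ x, 0 < u x) ∧ (∀ x, ContDiffAt ℝ 2 u x) ∧
      (∀ x, - lap u x + u x = ‖x‖ ^ α * u x ^ (p - 1)) := by
  have hp := P.p2; have hM := MM_pos P
  obtain ⟨u, hm, hk, hN1, hJ, hpos, hC2, heq⟩ := maximizer P
  set M := MM n N α p with hMd
  set c : ℝ := M ^ (-(1 / (p - 2))) with hc
  have hc0 : 0 < c := by positivity
  have e1 : M * c ^ (p - 2) = 1 := by
    rw [hc, ← rpow_mul hM.le, neg_mul, one_div_mul_cancel (by linarith), rpow_neg_one, mul_inv_cancel₀ hM.ne']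
  have hcM : M * c ^ p = c ^ 2 := by
    have : c ^ p = c ^ (p - 2) * c ^ 2 := by rw [← rpow_natCast c 2, ← rpow_add hc0]; push_cast; ring_nf
    rw [this, ← mul_assoc, e1, one_mul]
  have hw := hm.cmul c
  have hkw := hk.cmul hc0.le
  have hN2 : N2 (fun x => c * u x) = c ^ 2 := by rw [hw.2, hN1, mul_one]
  have hJw : JJ α p (fun x => c * u x) = c ^ 2 := by rw [JJ_cmul hk.1 hc0.le, hJ, ← hcM]; ring
  have hwe : (fun x => c * u x) = fun x => (c / M) * (M * u x) := by ext x; field_simp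
  refine ⟨fun x => c * u x, ⟨?_, ?_, ?_⟩, fun x => mul_pos hc0 (hpos x), fun x => ?_, fun x => ?_⟩
  · exact mem_Kplus_of_KC (by have := P.hn; omega) (by have := P.hn; have := P.hN; omega) hkw hw.1
  · rw [energy_eq hkw.1, hN2, hJw]
    have h6 : 1 / p < 1 / 2 := by gcongr
    have : 0 < c ^ 2 := by positivity
    nlinarith
  · exact (mp_level P hc0 hcM hw.1 hkw hN2 hJw).symm
  · rw [hwe]; exact (contDiff_const.mul hC2).contDiffAt
  · have h1 := heq x
    rw [hwe, lap_cmul hC2, show (fun x => c / M * (M * u x)) x = c / M * (M * u x) from rfl]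
    have h2 : -(c / M * lap (fun x => M * u x) x) + c / M * (M * u x) = c / M * ff α p u x := by rw [← h1]; ring
    rw [h2, ff, show c / M * (M * u x) = c * u x by field_simp, mul_rpow hc0.le (hk.1 x)]
    have h3 : c ^ (p - 1) = c ^ (p - 2) * c := by rw [← rpow_add_one hc0.ne']; ring_nf
    have h4 : c ^ (p - 1) = c / M := by
      rw [h3, eq_div_iff hM.ne']
      linear_combination c * e1
    rw [h4]; ring

lemma PR_mk (hn : 2 ≤ n) (hN : N = 2 * n) (hα : 0 < α) (hp1 : (2 * N + 2 * α - 4) / ((N : ℝ) - 2) < p)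
    (hp2 : p < (2 * N + 2 * α) / ((N : ℝ) - 2)) : PR n N α p := by
  have h2 : (2:ℝ) ≤ n := by exact_mod_cast hn
  have hr : (N:ℝ) = 2 * n := by rw [hN]; push_cast; ring
  rw [hr] at hp1 hp2
  rw [div_lt_iff₀ (by linarith)] at hp1
  rw [lt_div_iff₀ (by linarith)] at hp2
  exact ⟨hn, hN, hα, by linarith, by linarith⟩

end Proof

theorem statement12
    (n N : ℕ) (hn : 2 ≤ n) (hN : N = 2 * n)
    (α : ℝ) (hα : 0 < α)
    (p : ℝ) (hp1 : (2 * N + 2 * α - 4) / ((N : ℝ) - 2) < p)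
    (hp2 : p < (2 * N + 2 * α) / ((N : ℝ) - 2)) :
    ∃ u : Euc N → ℝ,
      IsGroundState α p (KplusFull n) u ∧
      (∀ x, 0 < u x) ∧
      (∀ x, ContDiffAt ℝ 2 u x) ∧
      (∀ x, - lap u x + u x = ‖x‖ ^ α * u x ^ (p - 1)) := by
  exact final (PR_mk hn hN hα hp1 hp2)

end
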